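/- Fix ℓ ≥ 3 and λ ∈ (0,1/2), let W be an (ℓ,λ)-graph statistic with the edge indicators drawn from G(n,m), p = m/C(n,2) ∈ (λ,1−λ), and let 𝒦 = (W − W_0 − W_2)/σ be its normalized version. Then for every ε > 0 there is a constant C = C(ℓ,λ,ε) such that for all n ≥ 3, all admissible m, and all t ∈ ℝ: |E[exp(it·𝒦)] − exp(−t²/2)| ≤ C·|t|·n^{ε−1/2}. -/

import Mathlib

open MeasureTheory ProbabilityTheory
open scoped ENNReal NNReal

noncomputable section

/-- The uniform probability measure on a subset of a finite type. -/
def finUniform {γ : Type*} [Fintype γ] [MeasurableSpace γ] (s : Set γ) : Measure γ :=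
  (Nat.card s : ℝ≥0∞)⁻¹ • ∑ a : γ, s.indicator (fun _ => (1 : ℝ≥0∞)) a • Measure.dirac a

/-- The product Bernoulli(p) measure on `ι → Bool`. -/
def bernoulliPi (ι : Type*) [Fintype ι] [DecidableEq ι] (p : ℝ) : Measure (ι → Bool) :=
  ∑ x : ι → Bool, (∏ i : ι, ENNReal.ofReal (if x i then p else 1 - p)) • Measure.dirac x

/-- The Erdős–Rényi G(n,p) measure, as a measure on edge-indicator functions. -/
def gnp (n : ℕ) (p : ℝ) : Measure (Sym2 (Fin n) → Bool) := bernoulliPi _ p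

/-- The G(n,m) measure: uniform over edge-indicator functions with exactly `m` edges
(diagonal coordinates forced to `false`). -/
def gnm (n m : ℕ) : Measure (Sym2 (Fin n) → Bool) :=
  finUniform {x | (∀ e : Sym2 (Fin n), e.IsDiag → x e = false) ∧
    (Finset.univ.filter fun e : Sym2 (Fin n) => x e = true).card = m}

open Classical in
/-- The graph factor `γ_H(x) = Σ_{E ≅ H} Π_{e ∈ E} χ_e`, where
`χ_e = (x_e − p)/√(p(1−p))`, and the sum is over edge sets `E` spanning a copy of `H`. -/
def graphFactor {β : Type*} [Fintype β] (H : SimpleGraph β) (p : ℝ) {n : ℕ}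
    (x : Sym2 (Fin n) → Bool) : ℝ :=
  ∑ E : Finset (Sym2 (Fin n)),
    if ∃ f : β ↪ Fin n, (↑E : Set (Sym2 (Fin n))) = Sym2.map f '' H.edgeSet then
      ∏ e ∈ E, (((if x e then (1 : ℝ) else 0) - p) / Real.sqrt (p * (1 - p)))
    else 0

/-- The `(ℓ,λ)`-graph statistic `W = Σ_{H ∈ ℋ} n^{ℓ−v(H)} Δ_H γ_H(x)`, where graphs on at
most `ℓ` vertices with no isolated vertices are represented as graphs on `Fin ℓ` padded with
isolated vertices, and `v(H) = Nat.card H.support` is the number of non-isolated vertices. -/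
def graphStat (ℓ : ℕ) (ℋ : Finset (SimpleGraph (Fin ℓ))) (Δ : SimpleGraph (Fin ℓ) → ℝ)
    (p : ℝ) {n : ℕ} (x : Sym2 (Fin n) → Bool) : ℝ :=
  ∑ G ∈ ℋ, (n : ℝ) ^ (ℓ - Nat.card G.support) * Δ G * graphFactor G p x

/-- The order-`k` portion `W_k` of an `(ℓ,λ)`-graph statistic: the terms with `v(H) = k`. -/
def graphStatPart (ℓ : ℕ) (ℋ : Finset (SimpleGraph (Fin ℓ))) (Δ : SimpleGraph (Fin ℓ) → ℝ)
    (p : ℝ) (kk : ℕ) {n : ℕ} (x : Sym2 (Fin n) → Bool) : ℝ :=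
  ∑ G ∈ ℋ.filter fun G => Nat.card G.support = kk,
    (n : ℝ) ^ (ℓ - Nat.card G.support) * Δ G * graphFactor G p x

/-- The data of an `(ℓ,λ)`-factor system: `ℋ` is a set of pairwise non-isomorphic graphs
(with no isolated vertices, padded to `Fin ℓ`), `ℋ' ⊆ ℋ` contains a connected graph on `k`
vertices for every `3 ≤ k ≤ ℓ`, and the coefficients satisfy `|Δ_H| ≤ 1/λ` on `ℋ` and
`|Δ_H| ≥ λ` on `ℋ'`. -/
def IsFactorSystem (ℓ : ℕ) (lam : ℝ) (ℋ ℋ' : Finset (SimpleGraph (Fin ℓ)))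
    (Δ : SimpleGraph (Fin ℓ) → ℝ) : Prop :=
  ℋ' ⊆ ℋ ∧
  (∀ G₁ ∈ ℋ, ∀ G₂ ∈ ℋ, Nonempty (G₁ ≃g G₂) → G₁ = G₂) ∧
  (∀ kk : ℕ, 3 ≤ kk → kk ≤ ℓ →
    ∃ G ∈ ℋ', (G.induce G.support).Connected ∧ Nat.card G.support = kk) ∧
  (∀ G ∈ ℋ, |Δ G| ≤ 1 / lam) ∧ (∀ G ∈ ℋ', lam ≤ |Δ G|)

end

noncomputable section
namespace GS

/-- Average over a finite set. -/
def Ex {X V : Type*} [AddCommGroup V] [Module ℝ V] (Ω : Finset X) (g : X → V) : V :=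
  ((Ω.card : ℝ)⁻¹) • ∑ x ∈ Ω, g x

section ExBasic
variable {X V : Type*} [NormedAddCommGroup V] [NormedSpace ℝ V] (Ω : Finset X)

lemma Ex_congr {f g : X → V} (h : ∀ x ∈ Ω, f x = g x) : Ex Ω f = Ex Ω g := by
  unfold Ex; rw [Finset.sum_congr rfl h]

lemma Ex_add (f g : X → V) : Ex Ω (fun x => f x + g x) = Ex Ω f + Ex Ω g := by
  simp [Ex, Finset.sum_add_distrib]

lemma Ex_sub (f g : X → V) : Ex Ω (fun x => f x - g x) = Ex Ω f - Ex Ω g := by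
  simp [Ex, Finset.sum_sub_distrib, smul_sub]

lemma Ex_sum {κ : Type*} (s : Finset κ) (f : κ → X → V) :
    Ex Ω (fun x => ∑ k ∈ s, f k x) = ∑ k ∈ s, Ex Ω (f k) := by
  unfold Ex; rw [Finset.sum_comm, Finset.smul_sum]

lemma Ex_smul (c : ℝ) (f : X → V) : Ex Ω (fun x => c • f x) = c • Ex Ω f := by
  unfold Ex; rw [← Finset.smul_sum, smul_comm]

lemma Ex_mul (c : ℝ) (f : X → ℝ) : Ex Ω (fun x => c * f x) = c * Ex Ω f := Ex_smul Ω c f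

lemma Ex_cmul (c : ℂ) (f : X → ℂ) : Ex Ω (fun x => c * f x) = c * Ex Ω f := by
  unfold Ex; rw [← Finset.mul_sum, mul_smul_comm]

lemma Ex_const (h : Ω.Nonempty) (c : V) : Ex Ω (fun _ => c) = c := by
  have : (Ω.card : ℝ) ≠ 0 := by simpa using h.ne_empty
  simp only [Ex, Finset.sum_const]
  rw [← Nat.cast_smul_eq_nsmul ℝ, smul_smul, inv_mul_cancel₀ this, one_smul]

lemma norm_Ex_le (f : X → V) : ‖Ex Ω f‖ ≤ Ex Ω (fun x => ‖f x‖) := by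
  unfold Ex; rw [norm_smul, norm_inv, Real.norm_natCast, smul_eq_mul]
  gcongr; exact norm_sum_le _ _

lemma Ex_mono {f g : X → ℝ} (h : ∀ x ∈ Ω, f x ≤ g x) : Ex Ω f ≤ Ex Ω g := by
  unfold Ex; simp only [smul_eq_mul]; gcongr with x hx; exact h x hx

lemma Ex_nonneg {f : X → ℝ} (h : ∀ x ∈ Ω, 0 ≤ f x) : 0 ≤ Ex Ω f := by
  unfold Ex; simp only [smul_eq_mul]
  exact mul_nonneg (by positivity) (Finset.sum_nonneg h)

lemma Ex_le_const (hΩ : Ω.Nonempty) {f : X → ℝ} {c : ℝ} (h : ∀ x ∈ Ω, f x ≤ c) : Ex Ω f ≤ c :=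
  (Ex_mono Ω h).trans (Ex_const Ω hΩ c).le

lemma norm_Ex_le_of (hΩ : Ω.Nonempty) {f : X → V} {c : ℝ} (h : ∀ x ∈ Ω, ‖f x‖ ≤ c) :
    ‖Ex Ω f‖ ≤ c := (norm_Ex_le Ω f).trans (Ex_le_const Ω hΩ h)

/-- Cauchy-Schwarz. -/
lemma Ex_mul_le (f g : X → ℝ) : (Ex Ω (fun x => |f x| * |g x|)) ^ 2 ≤
    Ex Ω (fun x => f x ^ 2) * Ex Ω (fun x => g x ^ 2) := by
  unfold Ex; simp only [smul_eq_mul]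
  have := Finset.sum_mul_sq_le_sq_mul_sq Ω (fun x => |f x|) (fun x => |g x|)
  simp only [sq_abs] at this
  have h2 : 0 ≤ ((Ω.card : ℝ)⁻¹) ^ 2 := by positivity
  calc _ = ((Ω.card : ℝ)⁻¹) ^ 2 * (∑ x ∈ Ω, |f x| * |g x|) ^ 2 := by ring
    _ ≤ ((Ω.card : ℝ)⁻¹) ^ 2 * ((∑ x ∈ Ω, f x ^ 2) * ∑ x ∈ Ω, g x ^ 2) := by gcongr
    _ = _ := by ring

lemma Ex_abs_mul_le {f g : X → ℝ} {a b : ℝ} (ha : 0 ≤ a) (hb : 0 ≤ b)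
    (hf : Ex Ω (fun x => f x ^ 2) ≤ a ^ 2) (hg : Ex Ω (fun x => g x ^ 2) ≤ b ^ 2) :
    Ex Ω (fun x => |f x| * |g x|) ≤ a * b := by
  apply le_of_sq_le_sq _ (by positivity)
  rw [mul_pow]
  refine (Ex_mul_le Ω f g).trans ?_
  exact mul_le_mul hf hg (Ex_nonneg Ω fun x _ => sq_nonneg _) (by positivity)

lemma Ex_abs_le (hΩ : Ω.Nonempty) {f : X → ℝ} {a : ℝ} (ha : 0 ≤ a)
    (hf : Ex Ω (fun x => f x ^ 2) ≤ a ^ 2) :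
    Ex Ω (fun x => |f x|) ≤ a := by
  have := Ex_abs_mul_le Ω (f := f) (g := fun _ => 1) ha zero_le_one hf
    (by rw [Ex_const Ω hΩ]; )
  simpa using this

end ExBasic

section Slice
variable {α : Type*} [DecidableEq α]

/-- Normalized indicator. -/
def chi (p : ℝ) (e : α) (x : α → Bool) : ℝ :=
  ((if x e then (1 : ℝ) else 0) - p) / Real.sqrt (p * (1 - p))

/-- Swapping the two coordinates. -/
def sw (e f : α) (x : α → Bool) : α → Bool := x ∘ Equiv.swap e f

lemma chi_sw (p : ℝ) (e f g : α) (x : α → Bool) :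
    chi p g (sw e f x) = chi p (Equiv.swap e f g) x := rfl

lemma sw_sw (e f : α) (x : α → Bool) : sw e f (sw e f x) = x := by
  funext g; simp [sw]

/-- Properties of the slice that we use. -/
structure Good (A : Finset α) (Ω : Finset (α → Bool)) (p B c : ℝ) : Prop where
  swap : ∀ e ∈ A, ∀ f ∈ A, ∀ x ∈ Ω, sw e f x ∈ Ω
  sum0 : ∀ x ∈ Ω, ∑ e ∈ A, chi p e x = 0
  hc : |c| ≤ B
  sq : ∀ (e : α) (x : α → Bool), chi p e x ^ 2 = 1 + c * chi p e x
  bd : ∀ (e : α) (x : α → Bool), |chi p e x| ≤ B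
  hB : 1 ≤ B
  ne : Ω.Nonempty
  neA : A.Nonempty

variable {A : Finset α} {Ω : Finset (α → Bool)} {p B c : ℝ}
variable {V : Type*} [NormedAddCommGroup V] [NormedSpace ℝ V]

lemma Good.Ex_sw (h : Good A Ω p B c) {e f : α} (he : e ∈ A) (hf : f ∈ A)
    (g : (α → Bool) → V) : Ex Ω (fun x => g (sw e f x)) = Ex Ω g := by
  unfold Ex
  congr 1
  refine Finset.sum_nbij' (sw e f) (sw e f) ?_ ?_ ?_ ?_ ?_
  · exact h.swap e he f hf
  · exact h.swap e he f hf
  · intro x _; exact sw_sw e f x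
  · intro x _; exact sw_sw e f x
  · intro x _; rfl

lemma Good.ibp (h : Good A Ω p B c) {e : α} (he : e ∈ A) (g : (α → Bool) → V) :
    Ex Ω (fun x => chi p e x • g x) = (1 / (2 * (A.card : ℝ))) • ∑ f ∈ A,
      Ex Ω (fun x => (chi p e x - chi p f x) • (g x - g (sw e f x))) := by
  have hN : (A.card : ℝ) ≠ 0 := by simpa using h.neA.ne_empty
  have h1 : ∀ f ∈ A, Ex Ω (fun x => (chi p e x - chi p f x) • (g x - g (sw e f x))) =
      (2 : ℝ) • Ex Ω (fun x => (chi p e x - chi p f x) • g x) := by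
    intro f hf
    have h2 := h.Ex_sw he hf (fun x => (chi p e x - chi p f x) • g x)
    simp only [chi_sw, Equiv.swap_apply_left, Equiv.swap_apply_right] at h2
    simp only [smul_sub]
    rw [Ex_sub, two_smul, sub_eq_add_neg]
    congr 1
    rw [← h2]
    simp only [sub_smul, Ex_sub]
    abel
  rw [Finset.sum_congr rfl h1, ← Finset.smul_sum, ← Ex_sum, smul_smul, ← Ex_smul]
  apply Ex_congr
  intro x hx
  rw [← Finset.sum_smul, Finset.sum_sub_distrib, h.sum0 x hx, Finset.sum_const, nsmul_eq_mul, smul_smul]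
  congr 1; field_simp; ring

lemma Good.sum_sq_sub (h : Good A Ω p B c) {x : α → Bool} (hx : x ∈ Ω) (e : α) :
    ∑ f ∈ A, (chi p e x - chi p f x) ^ 2 = A.card * (2 + c * chi p e x) := by
  have : ∀ f ∈ A, (chi p e x - chi p f x) ^ 2 =
      (2 + c * chi p e x) + (c - 2 * chi p e x) * chi p f x := by
    intro f _
    have h1 := h.sq e x
    have h2 := h.sq f x
    linear_combination h1 + h2
  rw [Finset.sum_congr rfl this, Finset.sum_add_distrib, ← Finset.mul_sum, h.sum0 x hx]
  simp; ring

end Slice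

lemma exp_second (y : ℝ) : ‖Complex.exp (Complex.I * y) - 1 - Complex.I * y‖ ≤ 3 * y ^ 2 := by
  by_cases hy : |y| ≤ 1
  · have := Complex.norm_exp_sub_one_sub_id_le (x := Complex.I * y) (by simpa using hy)
    refine this.trans ?_
    simp; nlinarith [sq_nonneg y]
  · push Not at hy
    have h1 := Real.norm_exp_I_mul_ofReal_sub_one_le (x := y)
    refine (norm_sub_le _ _).trans ?_
    have h2 : ‖Complex.I * (y : ℂ)‖ = |y| := by simp
    rw [h2]
    rw [Real.norm_eq_abs] at h1
    nlinarith [sq_abs y]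

/-- `e^{ity}`. -/
def cis (t y : ℝ) : ℂ := Complex.exp (Complex.I * ((t * y : ℝ) : ℂ))

lemma norm_cis (t y : ℝ) : ‖cis t y‖ = 1 := by
  unfold cis; rw [mul_comm]; exact Complex.norm_exp_ofReal_mul_I _

lemma cis_sub (t y z : ℝ) : cis t y - cis t z = cis t y * (1 - Complex.exp (Complex.I * ((t * (z - y) : ℝ) : ℂ))) := by
  unfold cis
  rw [mul_sub, mul_one, ← Complex.exp_add]
  congr 2; push_cast; ring

lemma norm_cis_sub (t y z : ℝ) : ‖cis t y - cis t z‖ ≤ |t| * |y - z| := by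
  rw [cis_sub, norm_mul, norm_cis, one_mul, norm_sub_rev]
  refine Real.norm_exp_I_mul_ofReal_sub_one_le.trans ?_
  rw [Real.norm_eq_abs, abs_mul, abs_sub_comm]

lemma norm_cis_second (t y z : ℝ) :
    ‖cis t y - cis t z - Complex.I * t * ((y - z : ℝ) : ℂ) * cis t y‖ ≤ 3 * t ^ 2 * (y - z) ^ 2 := by
  have h := exp_second (t * (z - y))
  have : cis t y - cis t z - Complex.I * t * ((y - z : ℝ) : ℂ) * cis t y =
    - cis t y * (Complex.exp (Complex.I * ((t * (z - y) : ℝ) : ℂ)) - 1 - Complex.I * ((t * (z - y) : ℝ) : ℂ)) := by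
    rw [cis_sub]; push_cast; ring
  rw [this, norm_mul, norm_neg, norm_cis, one_mul]
  refine h.trans (le_of_eq ?_); ring

end GS

end


noncomputable section
namespace GS

section SteinSec
variable {α : Type*} [DecidableEq α]

structure Stein (A : Finset α) (Ω : Finset (α → Bool)) (p : ℝ) (F : (α → Bool) → ℝ)
    (G L : α → (α → Bool) → ℝ) (Y Z : α → α → (α → Bool) → ℝ) (δ V q : ℝ) : Prop where
  h1 : ∀ x ∈ Ω, F x = ∑ e ∈ A, chi p e x * G e x
  h2 : ∀ e ∈ A, ∀ f ∈ A, ∀ x ∈ Ω, F x - F (sw e f x) =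
    (chi p e x - chi p f x) * (L e x - L f x + (chi p e x - chi p f x) * Y e f x)
  h3 : ∀ e ∈ A, ∀ f ∈ A, ∀ x ∈ Ω, G e x - G e (sw e f x) = (chi p f x - chi p e x) * Z e f x
  h4 : ∀ e ∈ A, ∀ f ∈ A, ∀ x ∈ Ω, L e x - L e (sw e f x) = (chi p f x - chi p e x) * Y e f x
  hδ : 0 ≤ δ
  hV : 0 ≤ V
  bG : ∀ e ∈ A, ∀ x ∈ Ω, |G e x| ≤ δ
  bL : ∀ e ∈ A, ∀ x ∈ Ω, |L e x| ≤ δ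
  bY : ∀ e ∈ A, ∀ x ∈ Ω, ∑ f ∈ A, |Y e f x| ≤ δ
  bZ : ∀ e ∈ A, ∀ x ∈ Ω, ∑ f ∈ A, |Z e f x| ≤ δ
  vL : Ex Ω (fun x => ∑ e ∈ A, L e x ^ 2) ≤ V
  vG : Ex Ω (fun x => ∑ e ∈ A, G e x ^ 2) ≤ V
  q1 : Ex Ω (fun x => |∑ e ∈ A, G e x * L e x - 1|) ≤ q
  q2 : Ex Ω (fun x => |1 / (2 * (A.card : ℝ)) *
    ∑ e ∈ A, ∑ f ∈ A, (chi p e x - chi p f x) ^ 2 * (G e x * L f x)|) ≤ q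

variable {A : Finset α} {Ω : Finset (α → Bool)} {p B c : ℝ} {F : (α → Bool) → ℝ}
    {G L : α → (α → Bool) → ℝ} {Y Z : α → α → (α → Bool) → ℝ} {δ V q : ℝ}

lemma Good.bd2 (h : Good A Ω p B c) (e f : α) (x : α → Bool) :
    |chi p e x - chi p f x| ≤ 2 * B := by
  have := h.bd e x; have := h.bd f x
  refine (abs_sub _ _).trans ?_
  linarith

lemma Stein.bY' (hs : Stein A Ω p F G L Y Z δ V q) {e f : α} (he : e ∈ A) (hf : f ∈ A)
    {x : α → Bool} (hx : x ∈ Ω) : |Y e f x| ≤ δ :=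
  (Finset.single_le_sum (f := fun f => |Y e f x|) (fun _ _ => abs_nonneg _) hf).trans (hs.bY e he x hx)

lemma Stein.pt1 (h : Good A Ω p B c) (hs : Stein A Ω p F G L Y Z δ V q) (t : ℝ)
    {e f : α} (he : e ∈ A) (hf : f ∈ A) {x : α → Bool} (hx : x ∈ Ω) :
    ‖(chi p e x - chi p f x) • (G e x • cis t (F x) - G e (sw e f x) • cis t (F (sw e f x))) -
      ((chi p e x - chi p f x) ^ 2 * (G e x * (L e x - L f x))) • (Complex.I * t * cis t (F x))‖ ≤
    4 * B ^ 2 * |Z e f x| + 8 * B ^ 3 * δ * |t| * |Y e f x| +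
      72 * B ^ 3 * δ * t ^ 2 * (L e x ^ 2 + L f x ^ 2 + 4 * B ^ 2 * δ * |Y e f x|) := by
  have hB := h.hB
  have hd := h.bd2 e f x
  have e2 := hs.h2 e he f hf x hx
  have e3 := hs.h3 e he f hf x hx
  have bG := hs.bG e he x hx
  have bY := hs.bY' he hf hx
  have hδ := hs.hδ
  set d := chi p e x - chi p f x with hdd
  set Φ := cis t (F x) with hΦ
  set Φ' := cis t (F (sw e f x)) with hΦ'
  set g := G e x
  set g' := G e (sw e f x)
  set y := F x - F (sw e f x) with hy
  have n1 : ‖Φ'‖ = 1 := norm_cis _ _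
  have n2 : ‖Φ‖ = 1 := norm_cis _ _
  have n3 := norm_cis_second t (F x) (F (sw e f x))
  rw [← hΦ, ← hΦ', ← hy] at n3
  have key : d • (g • Φ - g' • Φ') - (d ^ 2 * (g * (L e x - L f x))) • (Complex.I * t * Φ) =
      ((d * (g - g') : ℝ) : ℂ) * Φ' + ((d * g : ℝ) : ℂ) * (Φ - Φ' - Complex.I * t * (y : ℂ) * Φ) +
      ((d * g * t * (y - d * (L e x - L f x)) : ℝ) : ℂ) * (Complex.I * Φ) := by
    simp only [Complex.real_smul]; push_cast; ring
  rw [key]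
  have hyd : y - d * (L e x - L f x) = d ^ 2 * Y e f x := by rw [e2]; ring
  have hgd : d * (g - g') = - (d ^ 2 * Z e f x) := by rw [e3, hdd]; ring
  have hd2 : d ^ 2 ≤ 4 * B ^ 2 := by
    rw [← sq_abs]; calc |d| ^ 2 ≤ (2 * B) ^ 2 := by gcongr
      _ = _ := by ring
  have A1 : ‖((d * (g - g') : ℝ) : ℂ) * Φ'‖ ≤ 4 * B ^ 2 * |Z e f x| := by
    rw [norm_mul, n1, mul_one, Complex.norm_real, Real.norm_eq_abs, hgd, abs_neg, abs_mul,
      abs_of_nonneg (sq_nonneg d)]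
    gcongr
  have hdg : |d * g| ≤ 2 * B * δ := by rw [abs_mul]; gcongr
  have A3 : ‖((d * g * t * (y - d * (L e x - L f x)) : ℝ) : ℂ) * (Complex.I * Φ)‖ ≤
      8 * B ^ 3 * δ * |t| * |Y e f x| := by
    rw [norm_mul, norm_mul, n2, Complex.norm_I, mul_one, mul_one, Complex.norm_real, Real.norm_eq_abs, hyd,
      abs_mul, abs_mul, abs_mul (d ^ 2), abs_of_nonneg (sq_nonneg d)]
    calc |d * g| * |t| * (d ^ 2 * |Y e f x|) ≤ (2 * B * δ) * |t| * (4 * B ^ 2 * |Y e f x|) := by gcongr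
      _ = _ := by ring
  have hy2 : y ^ 2 ≤ 12 * B ^ 2 * (L e x ^ 2 + L f x ^ 2 + 4 * B ^ 2 * δ * |Y e f x|) := by
    have hYY : (d * Y e f x) ^ 2 ≤ 4 * B ^ 2 * δ * |Y e f x| := by
      rw [mul_pow, ← sq_abs (Y e f x), pow_two |Y e f x|]
      calc d ^ 2 * (|Y e f x| * |Y e f x|) ≤ (4 * B ^ 2) * (δ * |Y e f x|) := by gcongr
        _ = _ := by ring
    rw [e2, mul_pow]
    calc d ^ 2 * (L e x - L f x + d * Y e f x) ^ 2 ≤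
        (4 * B ^ 2) * (3 * (L e x ^ 2 + L f x ^ 2 + (d * Y e f x) ^ 2)) := by
          gcongr
          nlinarith [sq_nonneg (L e x + L f x), sq_nonneg (L e x - d * Y e f x),
            sq_nonneg (L f x + d * Y e f x)]
      _ ≤ (4 * B ^ 2) * (3 * (L e x ^ 2 + L f x ^ 2 + 4 * B ^ 2 * δ * |Y e f x|)) := by gcongr
      _ = _ := by ring
  have A2 : ‖((d * g : ℝ) : ℂ) * (Φ - Φ' - Complex.I * t * (y : ℂ) * Φ)‖ ≤
      72 * B ^ 3 * δ * t ^ 2 * (L e x ^ 2 + L f x ^ 2 + 4 * B ^ 2 * δ * |Y e f x|) := by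
    rw [norm_mul, Complex.norm_real, Real.norm_eq_abs]
    calc |d * g| * ‖Φ - Φ' - Complex.I * t * (y : ℂ) * Φ‖ ≤ (2 * B * δ) * (3 * t ^ 2 * y ^ 2) := by gcongr
      _ ≤ (2 * B * δ) * (3 * t ^ 2 * (12 * B ^ 2 * (L e x ^ 2 + L f x ^ 2 + 4 * B ^ 2 * δ * |Y e f x|))) := by gcongr
      _ = _ := by ring
  refine (norm_add₃_le).trans ?_
  linarith

lemma Stein.pt2 (h : Good A Ω p B c) (hs : Stein A Ω p F G L Y Z δ V q) (t : ℝ)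
    {e f : α} (he : e ∈ A) (hf : f ∈ A) {x : α → Bool} (hx : x ∈ Ω) :
    ‖(chi p e x - chi p f x) • ((G e x * L e x) • cis t (F x) -
      (G e (sw e f x) * L e (sw e f x)) • cis t (F (sw e f x)))‖ ≤
    4 * B ^ 2 * δ * (|Z e f x| + |Y e f x|) +
      8 * B ^ 2 * (1 + B) * δ * |t| * ((G e x ^ 2 + L e x ^ 2) / 2) := by
  have hB := h.hB
  have hd := h.bd2 e f x
  have e2 := hs.h2 e he f hf x hx
  have e3 := hs.h3 e he f hf x hx
  have e4 := hs.h4 e he f hf x hx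
  have bG := hs.bG e he _ (h.swap e he f hf x hx)
  have bL := hs.bL e he x hx
  have bLf := hs.bL f hf x hx
  have bY := hs.bY' he hf hx
  have hδ := hs.hδ
  have n3 := norm_cis_sub t (F x) (F (sw e f x))
  have hd' : |chi p f x - chi p e x| ≤ 2 * B := h.bd2 f e x
  set d := chi p e x - chi p f x with hdd
  set Φ := cis t (F x) with hΦ
  set Φ' := cis t (F (sw e f x)) with hΦ'
  set g := G e x
  set g' := G e (sw e f x)
  set l := L e x
  set l' := L e (sw e f x)
  have n1 : ‖Φ'‖ = 1 := norm_cis _ _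
  have key : ((g * l) • Φ - (g' * l') • Φ') =
      (((g - g') * l + g' * (l - l') : ℝ) : ℂ) * Φ' + ((g * l : ℝ) : ℂ) * (Φ - Φ') := by
    simp only [Complex.real_smul]; push_cast; ring
  rw [norm_smul, Real.norm_eq_abs, key]
  have A1 : ‖(((g - g') * l + g' * (l - l') : ℝ) : ℂ) * Φ'‖ ≤ 2 * B * δ * (|Z e f x| + |Y e f x|) := by
    rw [norm_mul, n1, mul_one, Complex.norm_real, Real.norm_eq_abs, e3, e4]
    refine (abs_add_le _ _).trans ?_
    rw [abs_mul, abs_mul, abs_mul, abs_mul]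
    calc _ ≤ (2 * B) * |Z e f x| * δ + δ * ((2 * B) * |Y e f x|) := by gcongr
      _ = _ := by ring
  have hy : |F x - F (sw e f x)| ≤ 4 * B * (1 + B) * δ := by
    rw [e2, abs_mul]
    have : |l - L f x + d * Y e f x| ≤ 2 * (1 + B) * δ := by
      refine (abs_add_le _ _).trans ?_
      have h5 := abs_sub l (L f x)
      have : |d * Y e f x| ≤ 2 * B * δ := by rw [abs_mul]; gcongr
      linarith
    calc _ ≤ (2 * B) * (2 * (1 + B) * δ) := by gcongr
      _ = _ := by ring
  have hgl : |g * l| ≤ (g ^ 2 + l ^ 2) / 2 := by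
    rw [abs_le]; constructor <;> nlinarith [sq_nonneg (g + l), sq_nonneg (g - l)]
  have A2 : ‖((g * l : ℝ) : ℂ) * (Φ - Φ')‖ ≤ (g ^ 2 + l ^ 2) / 2 * (|t| * (4 * B * (1 + B) * δ)) := by
    rw [norm_mul, Complex.norm_real, Real.norm_eq_abs]
    have : ‖Φ - Φ'‖ ≤ |t| * (4 * B * (1 + B) * δ) := n3.trans (by gcongr)
    gcongr
  calc _ ≤ (2 * B) * (2 * B * δ * (|Z e f x| + |Y e f x|) +
        (g ^ 2 + l ^ 2) / 2 * (|t| * (4 * B * (1 + B) * δ))) := by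
        gcongr; exact (norm_add_le _ _).trans (by linarith)
    _ = _ := by ring

lemma Stein.sumbound (h : Good A Ω p B c) (hs : Stein A Ω p F G L Y Z δ V q) {b1 b2 b3 b4 : ℝ}
    (hb1 : 0 ≤ b1) (hb2 : 0 ≤ b2) (hb3 : 0 ≤ b3) (hb4 : 0 ≤ b4) :
    1 / (2 * (A.card : ℝ)) * ∑ e ∈ A, ∑ f ∈ A, Ex Ω (fun x => b1 * |Z e f x| + b2 * |Y e f x| +
      b3 * (L e x ^ 2 + L f x ^ 2) + b4 * (G e x ^ 2 + L e x ^ 2)) ≤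
    (b1 + b2) * δ / 2 + (b3 + b4) * V := by
  have hN : 0 < (A.card : ℝ) := by simpa using h.neA
  have e1 : ∑ e ∈ A, ∑ f ∈ A, Ex Ω (fun x => b1 * |Z e f x| + b2 * |Y e f x| +
      b3 * (L e x ^ 2 + L f x ^ 2) + b4 * (G e x ^ 2 + L e x ^ 2)) =
      Ex Ω (fun x => ∑ e ∈ A, ∑ f ∈ A, (b1 * |Z e f x| + b2 * |Y e f x| +
      b3 * (L e x ^ 2 + L f x ^ 2) + b4 * (G e x ^ 2 + L e x ^ 2))) := by
    rw [Ex_sum]; refine Finset.sum_congr rfl fun e _ => ?_; rw [Ex_sum]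
  have e2 : Ex Ω (fun x => ∑ e ∈ A, ∑ f ∈ A, (b1 * |Z e f x| + b2 * |Y e f x| +
      b3 * (L e x ^ 2 + L f x ^ 2) + b4 * (G e x ^ 2 + L e x ^ 2))) ≤
      Ex Ω (fun x => A.card * ((b1 + b2) * δ) +
        A.card * ((2 * b3 + b4) * ∑ e ∈ A, L e x ^ 2 + b4 * ∑ e ∈ A, G e x ^ 2)) := by
    apply Ex_mono
    intro x hx
    have i1 : ∀ e ∈ A, ∑ f ∈ A, (b1 * |Z e f x| + b2 * |Y e f x|) ≤ (b1 + b2) * δ := by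
      intro e he
      rw [Finset.sum_add_distrib, ← Finset.mul_sum, ← Finset.mul_sum]
      have := hs.bZ e he x hx
      have := hs.bY e he x hx
      nlinarith
    have i2 := Finset.sum_le_sum i1
    simp only [Finset.sum_const, nsmul_eq_mul] at i2
    simp only [Finset.sum_add_distrib, Finset.sum_const, nsmul_eq_mul, ← Finset.mul_sum,
      mul_add] at i2 ⊢
    linarith
  have e3 : Ex Ω (fun x => A.card * ((b1 + b2) * δ) +
        A.card * ((2 * b3 + b4) * ∑ e ∈ A, L e x ^ 2 + b4 * ∑ e ∈ A, G e x ^ 2)) ≤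
      A.card * ((b1 + b2) * δ) + A.card * ((2 * b3 + b4) * V + b4 * V) := by
    rw [Ex_add, Ex_const _ h.ne, Ex_mul, Ex_add, Ex_mul, Ex_mul]
    gcongr
    · exact hs.vL
    · exact hs.vG
  rw [e1]
  calc _ ≤ 1 / (2 * (A.card : ℝ)) * (A.card * ((b1 + b2) * δ) + A.card * ((2 * b3 + b4) * V + b4 * V)) := by
        gcongr; exact e2.trans e3
    _ = _ := by field_simp; ring

lemma Stein.stepA (h : Good A Ω p B c) (hs : Stein A Ω p F G L Y Z δ V q) (t : ℝ) :
    ‖Ex Ω (fun x => F x • cis t (F x)) - (1 / (2 * (A.card : ℝ))) • ∑ e ∈ A, ∑ f ∈ A,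
      Ex Ω (fun x => ((chi p e x - chi p f x) ^ 2 * (G e x * (L e x - L f x))) •
        (Complex.I * t * cis t (F x)))‖ ≤
    (4 * B ^ 2 + (8 * B ^ 3 * δ * |t| + 72 * B ^ 3 * δ * t ^ 2 * (4 * B ^ 2 * δ))) * δ / 2 +
      (72 * B ^ 3 * δ * t ^ 2) * V := by
  have hB := h.hB
  have hδ := hs.hδ
  have e1 : Ex Ω (fun x => F x • cis t (F x)) = (1 / (2 * (A.card : ℝ))) • ∑ e ∈ A, ∑ f ∈ A,
      Ex Ω (fun x => (chi p e x - chi p f x) • (G e x • cis t (F x) -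
        G e (sw e f x) • cis t (F (sw e f x)))) := by
    rw [Finset.smul_sum]
    have : Ex Ω (fun x => F x • cis t (F x)) =
        ∑ e ∈ A, Ex Ω (fun x => chi p e x • (G e x • cis t (F x))) := by
      rw [← Ex_sum]; apply Ex_congr; intro x hx
      conv_lhs => rw [hs.h1 x hx]
      rw [Finset.sum_smul]
      refine Finset.sum_congr rfl fun e _ => ?_
      rw [smul_smul, hs.h1 x hx]
    rw [this]
    refine Finset.sum_congr rfl fun e he => ?_
    exact h.ibp he (fun x => G e x • cis t (F x))
  rw [e1, ← smul_sub, norm_smul, Real.norm_of_nonneg (by positivity), ← Finset.sum_sub_distrib]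
  refine le_trans ?_ (((hs.sumbound h (b1 := 4 * B ^ 2)
    (b2 := 8 * B ^ 3 * δ * |t| + 72 * B ^ 3 * δ * t ^ 2 * (4 * B ^ 2 * δ))
    (b3 := 72 * B ^ 3 * δ * t ^ 2) (b4 := 0)
    (by positivity) (by positivity) (by positivity) le_rfl)).trans (by rw [add_zero]))
  gcongr
  refine norm_sum_le_of_le _ fun e he => ?_
  rw [← Finset.sum_sub_distrib]
  refine norm_sum_le_of_le _ fun f hf => ?_
  rw [← Ex_sub]
  refine (norm_Ex_le _ _).trans (Ex_mono _ fun x hx => ?_)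
  refine (hs.pt1 h t he hf hx).trans (le_of_eq ?_)
  ring

lemma Stein.stepB (h : Good A Ω p B c) (hs : Stein A Ω p F G L Y Z δ V q) (t : ℝ) :
    ‖∑ e ∈ A, Ex Ω (fun x => chi p e x • ((G e x * L e x) • cis t (F x)))‖ ≤
    4 * B ^ 2 * δ ^ 2 + 4 * B ^ 2 * (1 + B) * δ * |t| * V := by
  have hB := h.hB
  have hδ := hs.hδ
  have e1 : ∑ e ∈ A, Ex Ω (fun x => chi p e x • ((G e x * L e x) • cis t (F x))) =
     (1 / (2 * (A.card : ℝ))) • ∑ e ∈ A, ∑ f ∈ A,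
      Ex Ω (fun x => (chi p e x - chi p f x) • ((G e x * L e x) • cis t (F x) -
        (G e (sw e f x) * L e (sw e f x)) • cis t (F (sw e f x)))) := by
    rw [Finset.smul_sum]
    refine Finset.sum_congr rfl fun e he => ?_
    exact h.ibp he (fun x => (G e x * L e x) • cis t (F x))
  rw [e1, norm_smul, Real.norm_of_nonneg (by positivity)]
  refine le_trans ?_ (((hs.sumbound h (b1 := 4 * B ^ 2 * δ)
    (b2 := 4 * B ^ 2 * δ)
    (b3 := 0) (b4 := 4 * B ^ 2 * (1 + B) * δ * |t|)
    (by positivity) (by positivity) le_rfl (by positivity))).trans (le_of_eq (by ring)))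
  gcongr
  refine norm_sum_le_of_le _ fun e he => ?_
  refine norm_sum_le_of_le _ fun f hf => ?_
  refine (norm_Ex_le _ _).trans (Ex_mono _ fun x hx => ?_)
  refine (hs.pt2 h t he hf hx).trans (le_of_eq ?_)
  ring

lemma Stein.stepC (h : Good A Ω p B c) (hs : Stein A Ω p F G L Y Z δ V q) (t : ℝ) :
    ‖(1 / (2 * (A.card : ℝ))) • ∑ e ∈ A, ∑ f ∈ A,
      Ex Ω (fun x => ((chi p e x - chi p f x) ^ 2 * (G e x * (L e x - L f x))) •
        (Complex.I * t * cis t (F x))) - Complex.I * t * Ex Ω (fun x => cis t (F x))‖ ≤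
    |t| * q + B / 2 * |t| * (4 * B ^ 2 * δ ^ 2 + 4 * B ^ 2 * (1 + B) * δ * |t| * V) + |t| * q := by
  have hB := h.hB
  have hδ := hs.hδ
  have hN : (A.card : ℝ) ≠ 0 := by simpa using h.neA.ne_empty
  have e1 : (1 / (2 * (A.card : ℝ))) • ∑ e ∈ A, ∑ f ∈ A,
      Ex Ω (fun x => ((chi p e x - chi p f x) ^ 2 * (G e x * (L e x - L f x))) •
        (Complex.I * t * cis t (F x))) - Complex.I * t * Ex Ω (fun x => cis t (F x)) =
      Ex Ω (fun x => (∑ e ∈ A, G e x * L e x - 1) • (Complex.I * t * cis t (F x))) +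
      Complex.I * t * ((c / 2 : ℝ) : ℂ) *
        ∑ e ∈ A, Ex Ω (fun x => chi p e x • ((G e x * L e x) • cis t (F x))) -
      Ex Ω (fun x => (1 / (2 * (A.card : ℝ)) *
        ∑ e ∈ A, ∑ f ∈ A, (chi p e x - chi p f x) ^ 2 * (G e x * L f x)) •
          (Complex.I * t * cis t (F x))) := by
    rw [← Ex_sum, ← Ex_cmul, ← Ex_cmul, ← Ex_add, ← Ex_sub]
    simp_rw [← Ex_sum]
    rw [← Ex_smul, ← Ex_sub]
    apply Ex_congr
    intro x hx
    have k1 : ∑ e ∈ A, ∑ f ∈ A, (chi p e x - chi p f x) ^ 2 * (G e x * (L e x - L f x)) =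
        A.card * (2 * ∑ e ∈ A, G e x * L e x + c * ∑ e ∈ A, chi p e x * (G e x * L e x)) -
        ∑ e ∈ A, ∑ f ∈ A, (chi p e x - chi p f x) ^ 2 * (G e x * L f x) := by
      rw [Finset.mul_sum, Finset.mul_sum, ← Finset.sum_add_distrib, Finset.mul_sum,
        ← Finset.sum_sub_distrib]
      refine Finset.sum_congr rfl fun e he => ?_
      have := h.sum_sq_sub hx e
      calc _ = (∑ f ∈ A, (chi p e x - chi p f x) ^ 2) * (G e x * L e x) -
          ∑ f ∈ A, (chi p e x - chi p f x) ^ 2 * (G e x * L f x) := by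
            rw [Finset.sum_mul, ← Finset.sum_sub_distrib]
            refine Finset.sum_congr rfl fun f hf => ?_
            ring
        _ = _ := by rw [this]; ring
    have k2 : ∑ e ∈ A, ∑ f ∈ A, ((chi p e x - chi p f x) ^ 2 * (G e x * (L e x - L f x))) •
        (Complex.I * t * cis t (F x)) = (∑ e ∈ A, ∑ f ∈ A, (chi p e x - chi p f x) ^ 2 *
          (G e x * (L e x - L f x))) • (Complex.I * t * cis t (F x)) := by
      rw [Finset.sum_smul]
      refine Finset.sum_congr rfl fun e he => ?_
      rw [Finset.sum_smul]
    have k3 : ∑ e ∈ A, chi p e x • ((G e x * L e x) • cis t (F x)) =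
        (∑ e ∈ A, chi p e x * (G e x * L e x)) • cis t (F x) := by
      rw [Finset.sum_smul]
      refine Finset.sum_congr rfl fun e he => ?_
      rw [smul_smul]
    rw [k2, k1, k3]
    simp only [Complex.real_smul]
    have hN' : (A.card : ℂ) ≠ 0 := by exact_mod_cast hN
    push_cast
    field_simp
    ring
  have bnd : ∀ u : (α → Bool) → ℝ, ‖Ex Ω (fun x => u x • (Complex.I * t * cis t (F x)))‖ ≤
      |t| * Ex Ω (fun x => |u x|) := by
    intro u
    refine (norm_Ex_le _ _).trans ?_
    rw [← Ex_mul]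
    apply Ex_mono; intro x _
    rw [norm_smul, norm_mul, norm_mul, norm_cis, Complex.norm_I, Complex.norm_real]
    simp [mul_comm]
  rw [e1]
  refine (norm_sub_le _ _).trans (add_le_add ((norm_add_le _ _).trans (add_le_add ?_ ?_)) ?_)
  · refine (bnd _).trans ?_
    have := hs.q1; gcongr
  · rw [norm_mul, norm_mul, norm_mul, Complex.norm_I, Complex.norm_real, Complex.norm_real,
      Real.norm_eq_abs, Real.norm_eq_abs]
    have hc : |c / 2| ≤ B / 2 := by
      rw [abs_div, abs_two]; have := h.hc; gcongr
    have := hs.stepB h t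
    calc _ = |c / 2| * |t| * ‖∑ e ∈ A, Ex Ω (fun x => chi p e x • ((G e x * L e x) • cis t (F x)))‖ := by ring
      _ ≤ _ := by gcongr
  · refine (bnd _).trans ?_
    have := hs.q2; gcongr

lemma Stein.final (h : Good A Ω p B c) (hs : Stein A Ω p F G L Y Z δ V q) (t : ℝ) :
    ‖Ex Ω (fun x => F x • cis t (F x)) - Complex.I * t * Ex Ω (fun x => cis t (F x))‖ ≤
    (200 * B ^ 5 * (1 + δ ^ 2) * (1 + V) * (δ + q)) * (1 + |t| + t ^ 2) := by
  have hA := hs.stepA h t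
  have hC := hs.stepC h t
  have hB := h.hB
  have hδ := hs.hδ
  have hV := hs.hV
  have hq : 0 ≤ q := le_trans (Ex_nonneg _ fun _ _ => abs_nonneg _) hs.q1
  have ht := abs_nonneg t
  rw [← sq_abs t] at hA ⊢
  refine (norm_sub_le_norm_sub_add_norm_sub _ _ _).trans ((add_le_add hA hC).trans ?_)
  set s := |t|
  have b2 : B ^ 2 ≤ B ^ 5 := pow_le_pow_right₀ hB (by norm_num)
  have b3 : B ^ 3 ≤ B ^ 5 := pow_le_pow_right₀ hB (by norm_num)
  have b4 : B ^ 4 ≤ B ^ 5 := pow_le_pow_right₀ hB (by norm_num)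
  have b0 : 1 ≤ B ^ 5 := one_le_pow₀ hB
  have d1 : δ ≤ 1 + δ ^ 2 := by nlinarith [sq_nonneg (δ - 1)]
  have hb5 : (0:ℝ) ≤ B ^ 5 := by positivity
  calc _ = B ^ 2 * (2 * δ) + B ^ 3 * (4 * δ * δ * s + 36 * 2 * δ * s ^ 2 * V + 2 * s * δ * δ + 2 * δ * s ^ 2 * V)
        + B ^ 5 * (144 * δ ^ 2 * δ * s ^ 2) + B ^ 4 * (2 * δ * s ^ 2 * V) + 1 * (2 * s * q) := by ring
    _ ≤ B ^ 5 * (2 * δ) + B ^ 5 * (4 * δ * δ * s + 36 * 2 * δ * s ^ 2 * V + 2 * s * δ * δ + 2 * δ * s ^ 2 * V)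
        + B ^ 5 * (144 * δ ^ 2 * δ * s ^ 2) + B ^ 5 * (2 * δ * s ^ 2 * V) + B ^ 5 * (2 * s * q) := by
        gcongr
    _ ≤ B ^ 5 * (2 * δ) + B ^ 5 * (4 * (1 + δ ^ 2) * δ * s + 36 * 2 * δ * s ^ 2 * V + 2 * s * (1 + δ ^ 2) * δ + 2 * δ * s ^ 2 * V)
        + B ^ 5 * (144 * δ ^ 2 * δ * s ^ 2) + B ^ 5 * (2 * δ * s ^ 2 * V) + B ^ 5 * (2 * s * q) := by
        gcongr
    _ = B ^ 5 * (2 * δ + 4 * (1 + δ ^ 2) * δ * s + 36 * 2 * δ * s ^ 2 * V + 2 * s * (1 + δ ^ 2) * δ + 2 * δ * s ^ 2 * V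
        + 144 * δ ^ 2 * δ * s ^ 2 + 2 * δ * s ^ 2 * V + 2 * s * q) := by ring
    _ ≤ B ^ 5 * (200 * (1 + δ ^ 2) * (1 + V) * (δ + q) * (1 + s + s ^ 2)) := by
        gcongr
        have p1 : 0 ≤ δ * s := by positivity
        have p2 : 0 ≤ δ * s ^ 2 := by positivity
        have p3 : 0 ≤ δ * s ^ 2 * V := by positivity
        have p4 : 0 ≤ δ ^ 2 * (δ * s) := by positivity
        have p5 : 0 ≤ δ ^ 2 * (δ * s ^ 2) := by positivity
        have p6 : 0 ≤ s * q := by positivity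
        have expand : 200 * (1 + δ ^ 2) * (1 + V) * (δ + q) * (1 + s + s ^ 2) =
          200 * (δ + δ * s + δ * s ^ 2 + δ * s ^ 2 * V + δ ^ 2 * (δ * s) + δ ^ 2 * (δ * s ^ 2) + s * q) +
          200 * (V * (δ + δ * s) + δ ^ 2 * δ + δ ^ 2 * V * (δ * (1 + s + s ^ 2)) + q + q * s ^ 2 + (δ ^ 2 + V + δ ^ 2 * V) * q * (1 + s + s ^ 2)) := by ring
        have pos : 0 ≤ 200 * (V * (δ + δ * s) + δ ^ 2 * δ + δ ^ 2 * V * (δ * (1 + s + s ^ 2)) + q + q * s ^ 2 + (δ ^ 2 + V + δ ^ 2 * V) * q * (1 + s + s ^ 2)) := by positivity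
        rw [expand]
        nlinarith
    _ = _ := by ring

end SteinSec

/-- The ODE comparison. -/
lemma ode_nonneg (φ φ' : ℝ → ℂ) (hφ : ∀ t, HasDerivAt φ (φ' t) t) (h0 : φ 0 = 1) {κ : ℝ}
    (hb : ∀ t, ‖φ' t + t * φ t‖ ≤ κ * (1 + |t| + t ^ 2)) (t : ℝ) (ht : 0 ≤ t) :
    ‖φ t - (Real.exp (-(t ^ 2) / 2) : ℝ)‖ ≤ 3 * κ * t := by
  have hκ : 0 ≤ κ := by
    have := (norm_nonneg _).trans (hb 0); simpa using this
  have hE : ∀ s : ℝ, HasDerivAt (fun s : ℝ => Real.exp (s ^ 2 / 2)) (Real.exp (s ^ 2 / 2) * s) s := by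
    intro s
    have : HasDerivAt (fun s : ℝ => s ^ 2 / 2) s s := by
      have := (hasDerivAt_pow 2 s).div_const 2
      exact this.congr_deriv (by norm_num)
    exact this.exp
  have hψ : ∀ s : ℝ, HasDerivAt (fun s : ℝ => (Real.exp (s ^ 2 / 2) : ℂ) * φ s - 1)
      ((Real.exp (s ^ 2 / 2) : ℂ) * (φ' s + s * φ s)) s := by
    intro s
    have := (((hE s).ofReal_comp).mul (hφ s)).sub_const 1
    refine this.congr_deriv ?_
    push_cast; ring
  have hBd : ∀ s : ℝ, HasDerivAt (fun s : ℝ => 3 * κ * (s * Real.exp (s ^ 2 / 2)))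
      (3 * κ * (1 * Real.exp (s ^ 2 / 2) + s * (Real.exp (s ^ 2 / 2) * s))) s := by
    intro s
    exact ((hasDerivAt_id s).mul (hE s)).const_mul _
  have := image_norm_le_of_norm_deriv_right_le_deriv_boundary (a := 0) (b := t)
    (f := fun s : ℝ => (Real.exp (s ^ 2 / 2) : ℂ) * φ s - 1)
    (fun s _ => (hψ s).continuousAt.continuousWithinAt)
    (fun s _ => (hψ s).hasDerivWithinAt)
    (B := fun s : ℝ => 3 * κ * (s * Real.exp (s ^ 2 / 2)))
    (by simp [h0]) (fun s => hBd s)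
    (by
      intro s hs
      rw [norm_mul, Complex.norm_real, Real.norm_of_nonneg (Real.exp_pos _).le]
      have h1 := hb s
      rw [abs_of_nonneg hs.1] at h1
      have h2 := (Real.exp_pos (s ^ 2 / 2))
      calc _ ≤ Real.exp (s ^ 2 / 2) * (κ * (1 + s + s ^ 2)) := by gcongr
        _ ≤ Real.exp (s ^ 2 / 2) * (κ * (3 * (1 + s ^ 2))) := by
            gcongr; nlinarith [sq_nonneg (s - 1)]
        _ = _ := by ring)
    (x := t) ⟨ht, le_rfl⟩
  have e1 : φ t - (Real.exp (-(t ^ 2) / 2) : ℝ) = (Real.exp (-(t ^ 2) / 2) : ℝ) *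
      ((Real.exp (t ^ 2 / 2) : ℂ) * φ t - 1) := by
    have : (Real.exp (-(t ^ 2) / 2) : ℂ) * (Real.exp (t ^ 2 / 2) : ℂ) = 1 := by
      rw [← Complex.ofReal_mul, ← Real.exp_add]
      have : -t ^ 2 / 2 + t ^ 2 / 2 = 0 := by ring
      rw [this]; simp
    rw [mul_sub, ← mul_assoc, this]; ring
  rw [e1, norm_mul, Complex.norm_real, Real.norm_of_nonneg (Real.exp_pos _).le]
  calc _ ≤ Real.exp (-(t ^ 2) / 2) * (3 * κ * (t * Real.exp (t ^ 2 / 2))) := by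
        gcongr
    _ = 3 * κ * t * (Real.exp (-(t ^ 2) / 2) * Real.exp (t ^ 2 / 2)) := by ring
    _ = _ := by
        rw [← Real.exp_add]
        have : -t ^ 2 / 2 + t ^ 2 / 2 = 0 := by ring
        rw [this]; simp

lemma ode_comp (φ φ' : ℝ → ℂ) (hφ : ∀ t, HasDerivAt φ (φ' t) t) (h0 : φ 0 = 1) {κ : ℝ}
    (hb : ∀ t, ‖φ' t + t * φ t‖ ≤ κ * (1 + |t| + t ^ 2)) (t : ℝ) :
    ‖φ t - (Real.exp (-(t ^ 2) / 2) : ℝ)‖ ≤ 3 * κ * |t| := by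
  rcases le_total 0 t with ht | ht
  · rw [abs_of_nonneg ht]; exact ode_nonneg φ φ' hφ h0 hb t ht
  · have := ode_nonneg (fun s => φ (-s)) (fun s => - φ' (-s)) (fun s => by
      have := (hφ (-s)).scomp s (hasDerivAt_neg s)
      exact this.congr_deriv (by simp)) (by simpa using h0) (κ := κ) (fun s => by
        have := hb (-s)
        rw [← norm_neg]
        convert this using 1
        · congr 1; push_cast; ring
        · simp) (-t) (by linarith)
    rw [abs_of_nonpos ht]
    simpa using this

lemma Ex_ode {X : Type*} (Ω : Finset X) (hΩ : Ω.Nonempty) (F : X → ℝ) {κ : ℝ}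
    (hb : ∀ t : ℝ, ‖Ex Ω (fun x => F x • cis t (F x)) - Complex.I * t * Ex Ω (fun x => cis t (F x))‖
      ≤ κ * (1 + |t| + t ^ 2)) (t : ℝ) :
    ‖Ex Ω (fun x => cis t (F x)) - (Real.exp (-(t ^ 2) / 2) : ℝ)‖ ≤ 3 * κ * |t| := by
  apply ode_comp (fun t => Ex Ω (fun x => cis t (F x)))
    (fun t => Complex.I * Ex Ω (fun x => F x • cis t (F x)))
  · intro t
    rw [← Ex_cmul]
    unfold Ex
    apply HasDerivAt.fun_const_smul
    apply HasDerivAt.fun_sum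
    intro x _
    unfold cis
    have h1 : HasDerivAt (fun t : ℝ => Complex.I * ((t * F x : ℝ) : ℂ)) (Complex.I * ((1 * F x : ℝ) : ℂ)) t := by
      apply HasDerivAt.const_mul
      exact ((hasDerivAt_id t).mul_const (F x)).ofReal_comp
    refine h1.cexp.congr_deriv ?_
    rw [Complex.real_smul]; push_cast; ring
  · simp only [cis, zero_mul, Complex.ofReal_zero, mul_zero, Complex.exp_zero]
    exact Ex_const Ω hΩ 1
  · intro t
    refine le_trans (le_of_eq ?_) (hb t)
    rw [← one_mul ‖Ex Ω (fun x => F x • cis t (F x)) - _‖, ← Complex.norm_I, ← norm_mul]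
    congr 1
    rw [mul_sub, ← mul_assoc, ← mul_assoc, Complex.I_mul_I]; ring

end GS

end


noncomputable section
namespace GS

section Moments
variable {α : Type*} [DecidableEq α]

/-- Monomial. -/
def mon (p : ℝ) (S : Finset α) (x : α → Bool) : ℝ := ∏ e ∈ S, chi p e x

/-- Moment constants. -/
def mC (B : ℝ) : ℕ → ℝ
  | 0 => 1
  | 1 => 1
  | (k + 2) => 2 * (k + 1) * (mC B k + B * mC B (k + 1)) + (B * (2 * k + 2)) ^ (k + 2)

variable {A : Finset α} {Ω : Finset (α → Bool)} {p B c : ℝ}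

lemma mC_nonneg (hB : 1 ≤ B) (k : ℕ) : 0 ≤ mC B k := by
  induction k using Nat.strong_induction_on with
  | _ k ih =>
    match k with
    | 0 => simp [mC]
    | 1 => simp [mC]
    | k + 2 =>
      have := ih k (by omega)
      have := ih (k + 1) (by omega)
      simp only [mC]; positivity

lemma Good.mon_bd (h : Good A Ω p B c) (S : Finset α) (x : α → Bool) : |mon p S x| ≤ B ^ S.card := by
  unfold mon; rw [Finset.abs_prod]
  exact (Finset.prod_le_prod (fun _ _ => abs_nonneg _) (fun e _ => h.bd e x)).trans (by simp)

lemma Good.mom_rec (h : Good A Ω p B c) {S : Finset α} (hS : S ⊆ A) {e : α} (he : e ∈ A)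
    (heS : e ∉ S) :
    ((A.card : ℝ) - S.card) * Ex Ω (mon p (insert e S)) +
      ∑ f ∈ S, (Ex Ω (mon p (S.erase f)) + c * Ex Ω (mon p S)) = 0 := by
  have h0 : Ex Ω (fun x => ∑ f ∈ A, chi p f x * mon p S x) = 0 := by
    rw [Ex_congr Ω (g := fun _ => (0 : ℝ)), Ex_const _ h.ne]
    intro x hx
    rw [← Finset.sum_mul, h.sum0 x hx, zero_mul]
  rw [Ex_sum, ← Finset.sum_sdiff hS] at h0
  have h1 : ∀ f ∈ A \ S, Ex Ω (fun x => chi p f x * mon p S x) = Ex Ω (mon p (insert e S)) := by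
    intro f hf
    rw [Finset.mem_sdiff] at hf
    rw [← h.Ex_sw he hf.1]
    apply Ex_congr; intro x _
    unfold mon
    rw [Finset.prod_insert heS, chi_sw, Equiv.swap_apply_right]
    congr 1
    refine Finset.prod_congr rfl fun g hg => ?_
    rw [chi_sw, Equiv.swap_apply_of_ne_of_ne]
    · rintro rfl; exact heS hg
    · rintro rfl; exact hf.2 hg
  have h2 : ∀ f ∈ S, Ex Ω (fun x => chi p f x * mon p S x) =
      Ex Ω (mon p (S.erase f)) + c * Ex Ω (mon p S) := by
    intro f hf
    rw [← Ex_mul, ← Ex_add]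
    apply Ex_congr; intro x _
    unfold mon
    rw [← Finset.mul_prod_erase S _ hf]
    have := h.sq f x
    linear_combination (∏ x_1 ∈ S.erase f, chi p x_1 x) * this
  rw [Finset.sum_congr rfl h1, Finset.sum_congr rfl h2, Finset.sum_const, Finset.card_sdiff_of_subset hS,
    nsmul_eq_mul, Nat.cast_sub (Finset.card_le_card hS)] at h0
  exact h0

lemma Good.moment (h : Good A Ω p B c) {r : ℝ} (hr : 1 ≤ r) (hrN : r ^ 2 ≤ A.card) (k : ℕ) :
    ∀ S ⊆ A, S.card = k → |Ex Ω (mon p S)| * r ^ k ≤ mC B k := by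
  have hB := h.hB
  induction k using Nat.strong_induction_on with
  | _ k ih =>
    match k with
    | 0 =>
      intro S _ hS
      rw [Finset.card_eq_zero] at hS
      subst hS
      simp only [mC, pow_zero, mul_one]
      rw [← Real.norm_eq_abs]
      refine norm_Ex_le_of Ω h.ne fun x _ => ?_
      simp [mon]
    | 1 =>
      intro S hSA hS
      obtain ⟨e, rfl⟩ := Finset.card_eq_one.mp hS
      have := h.mom_rec (S := ∅) (by simp) (e := e) (by simpa using hSA) (by simp)
      have hN : (A.card : ℝ) ≠ 0 := by simpa using h.neA.ne_empty
      simp [hN] at this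
      rw [this]; simp [mC]
    | k + 2 =>
      intro S hSA hS
      obtain ⟨e, S', heS, rfl, hc'⟩ := Finset.card_eq_succ.mp hS
      have hS'A : S' ⊆ A := (Finset.subset_insert _ _).trans hSA
      have heA : e ∈ A := hSA (Finset.mem_insert_self _ _)
      have rec1 := h.mom_rec hS'A heA heS
      rw [hc'] at rec1
      push_cast at rec1
      simp only [mC]
      have m0 := mC_nonneg hB k
      have m1 := mC_nonneg hB (k + 1)
      by_cases hN : (2 * (k + 1) : ℝ) ≤ A.card
      · have hpos : (0 : ℝ) < A.card := lt_of_lt_of_le (by positivity) hN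
        have b1 : ∀ f ∈ S', |Ex Ω (mon p (S'.erase f)) + c * Ex Ω (mon p S')| * r ^ k ≤
            mC B k + B * mC B (k + 1) := by
          intro f hf
          have i1 := ih k (by omega) (S'.erase f) ((Finset.erase_subset _ _).trans hS'A)
            (by rw [Finset.card_erase_of_mem hf, hc']; simp)
          have i2 := ih (k + 1) (by omega) S' hS'A hc'
          have i3 : |Ex Ω (mon p S')| * r ^ k ≤ mC B (k + 1) := by
            refine le_trans ?_ i2
            gcongr
            omega
          calc _ ≤ (|Ex Ω (mon p (S'.erase f))| + |c| * |Ex Ω (mon p S')|) * r ^ k := by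
                gcongr; refine (abs_add_le _ _).trans ?_; rw [abs_mul]
            _ = |Ex Ω (mon p (S'.erase f))| * r ^ k + |c| * (|Ex Ω (mon p S')| * r ^ k) := by ring
            _ ≤ _ := by
                have := h.hc
                gcongr
        have b2 : |∑ f ∈ S', (Ex Ω (mon p (S'.erase f)) + c * Ex Ω (mon p S'))| * r ^ k ≤
            (k + 1) * (mC B k + B * mC B (k + 1)) := by
          calc _ ≤ (∑ f ∈ S', |(Ex Ω (mon p (S'.erase f)) + c * Ex Ω (mon p S'))|) * r ^ k := by
                gcongr; exact Finset.abs_sum_le_sum_abs _ _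
            _ ≤ ∑ f ∈ S', (mC B k + B * mC B (k + 1)) := by
                rw [Finset.sum_mul]; exact Finset.sum_le_sum b1
            _ = _ := by rw [Finset.sum_const, hc']; simp; ring
        have b3 : ((A.card : ℝ) / 2) * |Ex Ω (mon p (insert e S'))| ≤
            |∑ f ∈ S', (Ex Ω (mon p (S'.erase f)) + c * Ex Ω (mon p S'))| := by
          have : ∑ f ∈ S', (Ex Ω (mon p (S'.erase f)) + c * Ex Ω (mon p S')) =
            -(((A.card : ℝ) - (k + 1)) * Ex Ω (mon p (insert e S'))) := by linarith
          rw [this, abs_neg, abs_mul]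
          gcongr
          rw [abs_of_nonneg (by linarith)]
          linarith
        have b4 : |Ex Ω (mon p (insert e S'))| * r ^ (k + 2) ≤ 2 * ((k + 1) * (mC B k + B * mC B (k + 1))) := by
          calc |Ex Ω (mon p (insert e S'))| * r ^ (k + 2) = |Ex Ω (mon p (insert e S'))| * r ^ 2 * r ^ k := by ring
            _ ≤ |Ex Ω (mon p (insert e S'))| * A.card * r ^ k := by gcongr
            _ = 2 * (((A.card : ℝ) / 2) * |Ex Ω (mon p (insert e S'))| * r ^ k) := by ring
            _ ≤ 2 * ((k + 1) * (mC B k + B * mC B (k + 1))) := by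
                have b5 := mul_le_mul_of_nonneg_right b3 (show 0 ≤ r ^ k by positivity)
                linarith
        have : 0 ≤ (B * (2 * (k:ℝ) + 2)) ^ (k + 2) := by positivity
        linarith
      · push Not at hN
        have hr2 : r ≤ 2 * k + 2 := by nlinarith
        have : |Ex Ω (mon p (insert e S'))| ≤ B ^ (k + 2) := by
          rw [← Real.norm_eq_abs]
          refine norm_Ex_le_of Ω h.ne fun x _ => ?_
          have := h.mon_bd (insert e S') x
          rwa [hS] at this
        calc _ ≤ B ^ (k + 2) * (2 * k + 2) ^ (k + 2) := by gcongr
          _ = (B * (2 * k + 2)) ^ (k + 2) := by rw [mul_pow]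
          _ ≤ _ := by
            have : 0 ≤ 2 * ((k:ℝ) + 1) * (mC B k + B * mC B (k + 1)) := by positivity
            linarith

/-- bound on all moment constants up to `K` -/
def mM (B : ℝ) (K : ℕ) : ℝ := ∑ j ∈ Finset.range (K + 1), mC B j

lemma mC_le_mM (hB : 1 ≤ B) {j K : ℕ} (h : j ≤ K) : mC B j ≤ mM B K :=
  Finset.single_le_sum (f := fun j => mC B j) (fun i _ => mC_nonneg hB i) (by simp; omega)

lemma mM_nonneg (hB : 1 ≤ B) (K : ℕ) : 0 ≤ mM B K :=
  Finset.sum_nonneg fun i _ => mC_nonneg hB i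

lemma Good.moment_aux (h : Good A Ω p B c) {r : ℝ} (hr : 1 ≤ r) (hrN : r ^ 2 ≤ A.card) (K : ℕ)
    (W : Finset α) : ∀ U : Finset α, Disjoint U W → U ⊆ A → W ⊆ A → U.card + W.card ≤ K →
    |Ex Ω (fun x => mon p U x * ∏ e ∈ W, (1 + c * chi p e x))| * r ^ U.card ≤
      (1 + B) ^ W.card * mM B K := by
  have hB := h.hB
  have hM := mM_nonneg hB K
  induction W using Finset.induction_on with
  | empty =>
    intro U _ hU _ hK
    simp only [Finset.prod_empty, mul_one, Finset.card_empty, pow_zero, one_mul]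
    refine (h.moment hr hrN U.card U hU rfl).trans (mC_le_mM hB (by simpa using hK))
  | insert e W heW ih =>
    intro U hd hU hW hK
    rw [Finset.card_insert_of_notMem heW] at hK ⊢
    rw [Finset.disjoint_insert_right] at hd
    have hWA := (Finset.subset_insert _ _).trans hW
    have i1 := ih U hd.2 hU hWA (by omega)
    have i2 := ih (insert e U) (by rw [Finset.disjoint_insert_left]; exact ⟨heW, hd.2⟩)
      (Finset.insert_subset (hW (Finset.mem_insert_self _ _)) hU) hWA
      (by rw [Finset.card_insert_of_notMem hd.1]; omega)
    rw [Finset.card_insert_of_notMem hd.1] at i2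
    have e1 : Ex Ω (fun x => mon p U x * ∏ e ∈ insert e W, (1 + c * chi p e x)) =
       Ex Ω (fun x => mon p U x * ∏ e ∈ W, (1 + c * chi p e x)) +
       c * Ex Ω (fun x => mon p (insert e U) x * ∏ e ∈ W, (1 + c * chi p e x)) := by
      rw [← Ex_mul, ← Ex_add]
      apply Ex_congr; intro x _
      unfold mon
      rw [Finset.prod_insert heW, Finset.prod_insert hd.1]; ring
    set a := Ex Ω (fun x => mon p U x * ∏ e ∈ W, (1 + c * chi p e x))
    set b := Ex Ω (fun x => mon p (insert e U) x * ∏ e ∈ W, (1 + c * chi p e x))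
    have i3 : |b| * r ^ U.card ≤ (1 + B) ^ W.card * mM B K := by
      refine le_trans ?_ i2
      gcongr
      omega
    rw [e1]
    calc |a + c * b| * r ^ U.card ≤ (|a| + |c| * |b|) * r ^ U.card := by
          gcongr; refine (abs_add_le _ _).trans ?_; rw [abs_mul]
      _ = |a| * r ^ U.card + |c| * (|b| * r ^ U.card) := by ring
      _ ≤ (1 + B) ^ W.card * mM B K + B * ((1 + B) ^ W.card * mM B K) := by
          have := h.hc
          gcongr
      _ = _ := by ring

lemma Good.moment2 (h : Good A Ω p B c) {r : ℝ} (hr : 1 ≤ r) (hrN : r ^ 2 ≤ A.card) {K : ℕ}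
    {S T : Finset α} (hS : S ⊆ A) (hT : T ⊆ A) (hSc : S.card = K) (hTc : T.card = K) :
    |Ex Ω (fun x => mon p S x * mon p T x)| * r ^ (2 * (T \ S).card) ≤
      (1 + B) ^ K * mM B (2 * K) := by
  have hB := h.hB
  have hM := mM_nonneg hB (2 * K)
  have hcard : ((S \ T) ∪ (T \ S)).card = 2 * (T \ S).card := by
    rw [Finset.card_union_of_disjoint disjoint_sdiff_sdiff]
    have := Finset.card_sdiff_add_card_inter S T
    have := Finset.card_sdiff_add_card_inter T S
    rw [Finset.inter_comm] at this
    omega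
  have hW : (S ∩ T).card ≤ K := hSc ▸ Finset.card_le_card Finset.inter_subset_left
  have h1 := h.moment_aux hr hrN (2 * K) (S ∩ T) ((S \ T) ∪ (T \ S))
    (by
      rw [Finset.disjoint_left]; intro a ha hb
      simp only [Finset.mem_union, Finset.mem_sdiff, Finset.mem_inter] at ha hb
      tauto)
    (by intro a ha; simp only [Finset.mem_union, Finset.mem_sdiff] at ha
        rcases ha with ha | ha
        · exact hS ha.1
        · exact hT ha.1)
    (Finset.inter_subset_left.trans hS)
    (by
      rw [hcard]
      have := Finset.card_sdiff_add_card_inter T S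
      rw [Finset.inter_comm] at this
      omega)
  rw [hcard] at h1
  have e1 : Ex Ω (fun x => mon p S x * mon p T x) =
      Ex Ω (fun x => mon p ((S \ T) ∪ (T \ S)) x * ∏ e ∈ S ∩ T, (1 + c * chi p e x)) := by
    apply Ex_congr; intro x _
    unfold mon
    rw [Finset.prod_union disjoint_sdiff_sdiff]
    have a1 : ∏ e ∈ S, chi p e x = (∏ e ∈ S \ T, chi p e x) * ∏ e ∈ S ∩ T, chi p e x := by
      rw [← Finset.prod_union (by
        rw [Finset.disjoint_left]; intro a ha hb
        simp only [Finset.mem_sdiff, Finset.mem_inter] at ha hb; tauto), Finset.sdiff_union_inter]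
    have a2 : ∏ e ∈ T, chi p e x = (∏ e ∈ T \ S, chi p e x) * ∏ e ∈ S ∩ T, chi p e x := by
      rw [Finset.inter_comm, ← Finset.prod_union (by
        rw [Finset.disjoint_left]; intro a ha hb
        simp only [Finset.mem_sdiff, Finset.mem_inter] at ha hb; tauto), Finset.sdiff_union_inter]
    have a3 : ∏ e ∈ S ∩ T, (1 + c * chi p e x) = (∏ e ∈ S ∩ T, chi p e x) * ∏ e ∈ S ∩ T, chi p e x := by
      rw [← Finset.prod_mul_distrib]
      refine Finset.prod_congr rfl fun e _ => ?_
      rw [← h.sq e x]; ring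
    rw [a1, a2, a3]; ring
  rw [e1]
  refine h1.trans ?_
  gcongr
  linarith

end Moments

section Core

/-- non-diagonal edges -/
def Ed (n : ℕ) : Finset (Sym2 (Fin n)) := Finset.univ.filter fun e => ¬ e.IsDiag

lemma card_Ed (n : ℕ) : (Ed n).card = n.choose 2 := by
  have := Sym2.card_subtype_not_diag (α := Fin n)
  rw [Fintype.card_subtype, Fintype.card_fin] at this
  exact this

/-- the slice -/
def Om (n m : ℕ) : Finset (Sym2 (Fin n) → Bool) := Finset.univ.filter fun x =>
  (∀ e : Sym2 (Fin n), e.IsDiag → x e = false) ∧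
    (Finset.univ.filter fun e : Sym2 (Fin n) => x e = true).card = m

/-- the skewness constant -/
def cc (p : ℝ) : ℝ := (1 - 2 * p) / Real.sqrt (p * (1 - p))

lemma good_gnm {n m : ℕ} (hn : 3 ≤ n) {lam : ℝ} (hlam : lam ∈ Set.Ioo (0 : ℝ) (1 / 2))
    (hp : (m : ℝ) / (n.choose 2) ∈ Set.Ioo lam (1 - lam)) :
    Good (Ed n) (Om n m) ((m : ℝ) / (n.choose 2)) (1 / lam) (cc ((m : ℝ) / (n.choose 2))) := by
  obtain ⟨hl0, hl1⟩ := hlam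
  obtain ⟨hp0, hp1⟩ := hp
  have hch : 0 < n.choose 2 := Nat.choose_pos (by omega)
  have hchR : (0 : ℝ) < n.choose 2 := by exact_mod_cast hch
  set p := (m : ℝ) / (n.choose 2) with hpdef
  have hpq : lam ^ 2 ≤ p * (1 - p) := by nlinarith
  have hs : lam ≤ Real.sqrt (p * (1 - p)) := Real.le_sqrt_of_sq_le hpq
  have hs0 : 0 < Real.sqrt (p * (1 - p)) := lt_of_lt_of_le hl0 hs
  have hss : Real.sqrt (p * (1 - p)) ^ 2 = p * (1 - p) := Real.sq_sqrt (by nlinarith)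
  have bnd : ∀ y : ℝ, |y| ≤ 1 → |y / Real.sqrt (p * (1 - p))| ≤ 1 / lam := by
    intro y hy
    rw [abs_div, abs_of_pos hs0]
    exact div_le_div₀ zero_le_one hy hl0 hs
  have hmm : m ≤ n.choose 2 := by
    have : (m : ℝ) < n.choose 2 := by
      have h1 : p < 1 := by linarith
      rwa [hpdef, div_lt_one hchR] at h1
    exact_mod_cast this.le
  refine ⟨?_, ?_, ?_, ?_, ?_, ?_, ?_, ?_⟩
  · intro e he f hf x hx
    simp only [Om, Finset.mem_filter, Finset.mem_univ, true_and, Ed] at *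
    constructor
    · intro g hg
      have : Equiv.swap e f g = g := Equiv.swap_apply_of_ne_of_ne
        (by rintro rfl; exact he hg) (by rintro rfl; exact hf hg)
      simp only [sw, Function.comp, this]; exact hx.1 g hg
    · rw [← hx.2]
      apply Finset.card_bij (fun g _ => Equiv.swap e f g)
      · intro g hg; rw [Finset.mem_filter] at hg ⊢; refine ⟨Finset.mem_univ _, ?_⟩; simpa [sw] using hg.2
      · intro a _ b _ hab; exact (Equiv.swap e f).injective hab
      · intro b hb; exact ⟨Equiv.swap e f b, by
          rw [Finset.mem_filter] at hb ⊢; refine ⟨Finset.mem_univ _, ?_⟩; simpa [sw] using hb.2, by simp⟩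
  · intro x hx
    simp only [Om, Finset.mem_filter, Finset.mem_univ, true_and] at hx
    unfold chi
    rw [← Finset.sum_div, Finset.sum_sub_distrib, Finset.sum_const, card_Ed, Finset.sum_boole,
      nsmul_eq_mul]
    have : (Ed n).filter (fun e => x e = true) = Finset.univ.filter fun e => x e = true := by
      ext e; simp only [Ed, Finset.mem_filter, Finset.mem_univ, true_and]
      constructor
      · exact fun h => h.2
      · intro h; refine ⟨fun hd => ?_, h⟩
        rw [hx.1 e hd] at h; exact absurd h (by simp)
    rw [this, hx.2, hpdef]
    have : (m : ℝ) - (n.choose 2 : ℝ) * (m / (n.choose 2)) = 0 := by field_simp; ring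
    rw [this, zero_div]
  · exact bnd _ (by rw [abs_le]; constructor <;> linarith)
  · intro e x
    unfold chi cc
    rw [div_pow, hss]
    have : p * (1 - p) ≠ 0 := by nlinarith
    have h2 : (1 - 2 * p) / Real.sqrt (p * (1 - p)) * (((if x e = true then (1:ℝ) else 0) - p) / Real.sqrt (p * (1 - p)))
      = (1 - 2 * p) * ((if x e = true then (1:ℝ) else 0) - p) / (p * (1 - p)) := by
      rw [div_mul_div_comm, ← pow_two, hss]
    rw [h2]
    rw [eq_comm, ← sub_eq_zero]
    have h1p : (1 - p) ≠ 0 := by linarith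
    have hp' : p ≠ 0 := by linarith
    split_ifs <;> field_simp <;> ring
  · intro e x
    apply bnd
    split_ifs <;> rw [abs_le] <;> constructor <;> linarith
  · rw [le_div_iff₀ hl0]; linarith
  · obtain ⟨s, hs, hsc⟩ := Finset.exists_subset_card_eq (s := Ed n) (n := m) (by rwa [card_Ed])
    refine ⟨fun e => decide (e ∈ s), ?_⟩
    simp only [Om, Finset.mem_filter, Finset.mem_univ, true_and, decide_eq_true_eq, decide_eq_false_iff_not]
    constructor
    · intro e he hes
      have := hs hes
      simp only [Ed, Finset.mem_filter] at this
      exact this.2 he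
    · simpa using hsc
  · rw [← Finset.card_pos, card_Ed]; exact hch

variable {β : Type*} [Fintype β] [DecidableEq β]

/-- image of an edge set -/
def img {n : ℕ} (Γ : Finset (Sym2 β)) (f : β → Fin n) : Finset (Sym2 (Fin n)) := Γ.image (Sym2.map f)

/-- core constant -/
def coreC (B : ℝ) (K k : ℕ) : ℝ := (1 + B) ^ K * mM B (2 * K) * 2 ^ k * ((k : ℝ) + 1) ^ k

lemma coreC_nonneg {B : ℝ} (hB : 1 ≤ B) (K k : ℕ) : 0 ≤ coreC B K k := by
  have := mM_nonneg hB (2 * K)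
  unfold coreC; positivity

lemma img_card {n : ℕ} (Γ : Finset (Sym2 β)) {f : β → Fin n} (hf : Function.Injective f) :
    (img Γ f).card = Γ.card := Finset.card_image_of_injective _ (Sym2.map.injective hf)

lemma img_sub {n : ℕ} {Γ : Finset (Sym2 β)} (hΓ : ∀ e ∈ Γ, ¬ e.IsDiag) {f : β → Fin n}
    (hf : Function.Injective f) : img Γ f ⊆ Ed n := by
  intro e he
  simp only [img, Finset.mem_image] at he
  obtain ⟨e', he', rfl⟩ := he
  simp only [Ed, Finset.mem_filter, Finset.mem_univ, true_and]
  rw [Sym2.isDiag_map hf]; exact hΓ e' he'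

lemma img_diff {n : ℕ} {Γ : Finset (Sym2 β)} (hcov : ∀ b : β, ∃ e ∈ Γ, b ∈ e) (f : β → Fin n)
    {g : β → Fin n} (hg : Function.Injective g) :
    (Finset.univ.filter fun b : β => g b ∉ Set.range f).card ≤ 2 * (img Γ g \ img Γ f).card := by
  classical
  have h1 : (Finset.univ.filter fun b : β => g b ∉ Set.range f).image g ⊆
      (img Γ g \ img Γ f).biUnion (fun e => e.toFinset) := by
    intro v hv
    simp only [Finset.mem_image, Finset.mem_filter, Finset.mem_univ, true_and] at hv
    obtain ⟨b, hb, rfl⟩ := hv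
    obtain ⟨e, he, hbe⟩ := hcov b
    simp only [Finset.mem_biUnion, Finset.mem_sdiff, Sym2.mem_toFinset]
    refine ⟨Sym2.map g e, ⟨Finset.mem_image_of_mem _ he, ?_⟩, Sym2.mem_map.mpr ⟨b, hbe, rfl⟩⟩
    intro hmem
    simp only [img, Finset.mem_image] at hmem
    obtain ⟨e', _, heq⟩ := hmem
    have : g b ∈ Sym2.map g e := Sym2.mem_map.mpr ⟨b, hbe, rfl⟩
    rw [← heq, Sym2.mem_map] at this
    obtain ⟨a, _, ha⟩ := this
    exact hb ⟨a, ha⟩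
  rw [← Finset.card_image_of_injective _ hg]
  refine (Finset.card_le_card h1).trans (Finset.card_biUnion_le.trans ?_)
  rw [mul_comm, ← smul_eq_mul, ← Finset.sum_const]
  refine Finset.sum_le_sum fun e _ => ?_
  rw [Sym2.card_toFinset]; split_ifs <;> omega

lemma core {n : ℕ} (hn : 2 ≤ n) {Ω : Finset (Sym2 (Fin n) → Bool)} {p B c : ℝ}
    (h : Good (Ed n) Ω p B c) (Γ : Finset (Sym2 β)) (hΓ : ∀ e ∈ Γ, ¬ e.IsDiag)
    (hcov : ∀ b : β, ∃ e ∈ Γ, b ∈ e) :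
    ∑ f : β ↪ Fin n, ∑ g : β ↪ Fin n, |Ex Ω (fun x => mon p (img Γ f) x * mon p (img Γ g) x)| ≤
      coreC B Γ.card (Fintype.card β) * (n : ℝ) ^ (Fintype.card β) := by
  classical
  have hB := h.hB
  have hM := mM_nonneg hB (2 * Γ.card)
  have hnR : (2 : ℝ) ≤ n := by exact_mod_cast hn
  have hr : (1 : ℝ) ≤ n / 2 := by linarith
  have hrN : ((n : ℝ) / 2) ^ 2 ≤ (Ed n).card := by
    rw [card_Ed, Nat.cast_choose_two]; nlinarith
  set k := Fintype.card β
  have b1 : ∀ f g : β ↪ Fin n, |Ex Ω (fun x => mon p (img Γ f) x * mon p (img Γ g) x)| ≤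
      ((1 + B) ^ Γ.card * mM B (2 * Γ.card) * 2 ^ k) *
        ∏ b : β, (if g b ∈ Set.range f then (1 : ℝ) else 1 / n) := by
    intro f g
    have m2 := h.moment2 hr hrN (img_sub hΓ f.injective) (img_sub hΓ g.injective)
      (img_card Γ f.injective) (img_card Γ g.injective)
    have d1 := img_diff hcov f g.injective
    set d := (Finset.univ.filter fun b : β => g b ∉ Set.range f).card with hd
    have hprod : ∏ b : β, (if g b ∈ Set.range f then (1 : ℝ) else 1 / n) = (1 / (n:ℝ)) ^ d := by
      rw [Finset.prod_ite]; simp [hd]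
    rw [hprod]
    have hdk : d ≤ k := (Finset.card_filter_le _ _).trans (by simp [k])
    set E := |Ex Ω (fun x => mon p (img Γ f) x * mon p (img Γ g) x)|
    have m3 : E * ((n : ℝ) / 2) ^ d ≤ (1 + B) ^ Γ.card * mM B (2 * Γ.card) := by
      refine le_trans ?_ m2
      gcongr
    have : E = E * ((n : ℝ) / 2) ^ d * 2 ^ d * (1 / (n : ℝ)) ^ d := by
      rw [div_pow, one_div, inv_pow]; field_simp
    rw [this]
    gcongr
    norm_num
  have b2 : ∀ f : β ↪ Fin n, ∑ g : β ↪ Fin n, |Ex Ω (fun x => mon p (img Γ f) x * mon p (img Γ g) x)| ≤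
      coreC B Γ.card k := by
    intro f
    calc _ ≤ ∑ g : β ↪ Fin n, ((1 + B) ^ Γ.card * mM B (2 * Γ.card) * 2 ^ k) *
        ∏ b : β, (if g b ∈ Set.range f then (1 : ℝ) else 1 / n) := Finset.sum_le_sum fun g _ => b1 f g
      _ = ((1 + B) ^ Γ.card * mM B (2 * Γ.card) * 2 ^ k) *
        ∑ g : β ↪ Fin n, ∏ b : β, (if g b ∈ Set.range f then (1 : ℝ) else 1 / n) := by rw [Finset.mul_sum]
      _ ≤ ((1 + B) ^ Γ.card * mM B (2 * Γ.card) * 2 ^ k) * ((k : ℝ) + 1) ^ k := by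
        gcongr
        calc _ = ∑ g ∈ ((Finset.univ : Finset (β ↪ Fin n)).image (DFunLike.coe : (β ↪ Fin n) → β → Fin n) : Finset (β → Fin n)),
              ∏ b : β, (if g b ∈ Set.range f then (1 : ℝ) else 1 / n) := by
              rw [Finset.sum_image]
              intro a _ b _ hab; exact DFunLike.coe_injective hab
          _ ≤ ∑ g : β → Fin n, ∏ b : β, (if g b ∈ Set.range f then (1 : ℝ) else 1 / n) := by
              apply Finset.sum_le_sum_of_subset_of_nonneg (Finset.subset_univ _)
              intro g _ _
              exact Finset.prod_nonneg fun b _ => by split_ifs <;> positivity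
          _ = ∏ b : β, ∑ v : Fin n, (if v ∈ Set.range f then (1 : ℝ) else 1 / n) := by
              rw [Finset.prod_univ_sum]; simp
          _ = (∑ v : Fin n, (if v ∈ Set.range f then (1 : ℝ) else 1 / n)) ^ k := by
              rw [Finset.prod_const]; rfl
          _ ≤ ((k : ℝ) + 1) ^ k := by
              apply pow_le_pow_left₀ (Finset.sum_nonneg fun v _ => by split_ifs <;> positivity)
              rw [Finset.sum_ite]
              simp only [Finset.sum_const, nsmul_eq_mul, mul_one]
              apply add_le_add
              · have : (Finset.univ.filter fun v => v ∈ Set.range f) = Finset.univ.image f := by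
                  ext v; simp
                rw [this]
                exact_mod_cast Finset.card_image_le
              · rw [mul_one_div, div_le_one (by linarith)]
                exact_mod_cast (Finset.card_filter_le _ _).trans (by simp)
      _ = _ := rfl
  calc _ ≤ ∑ f : β ↪ Fin n, coreC B Γ.card k := Finset.sum_le_sum fun f _ => b2 f
    _ = (Fintype.card (β ↪ Fin n)) * coreC B Γ.card k := by simp
    _ ≤ (n : ℝ) ^ k * coreC B Γ.card k := by
        have := coreC_nonneg hB Γ.card k
        gcongr
        have h2 : Fintype.card (β ↪ Fin n) ≤ Fintype.card (β → Fin n) :=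
          Fintype.card_le_of_injective _ DFunLike.coe_injective
        simp only [Fintype.card_pi, Fintype.card_fin, Finset.prod_const] at h2
        exact_mod_cast h2
    _ = _ := by ring

/-- generic second-moment bound -/
lemma core_sq {n : ℕ} (hn : 2 ≤ n) {Ω : Finset (Sym2 (Fin n) → Bool)} {p B c : ℝ}
    (h : Good (Ed n) Ω p B c) (Γ : Finset (Sym2 β)) (hΓ : ∀ e ∈ Γ, ¬ e.IsDiag)
    (hcov : ∀ b : β, ∃ e ∈ Γ, b ∈ e) (J : Finset (β ↪ Fin n)) :
    Ex Ω (fun x => (∑ f ∈ J, mon p (img Γ f) x) ^ 2) ≤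
      coreC B Γ.card (Fintype.card β) * (n : ℝ) ^ (Fintype.card β) := by
  refine le_trans ?_ (core hn h Γ hΓ hcov)
  have : Ex Ω (fun x => (∑ f ∈ J, mon p (img Γ f) x) ^ 2) = ∑ f ∈ J, ∑ g ∈ J,
      Ex Ω (fun x => mon p (img Γ f) x * mon p (img Γ g) x) := by
    simp_rw [← Ex_sum]
    apply Ex_congr; intro x _
    rw [pow_two, Finset.sum_mul_sum]
  rw [this]
  calc _ ≤ ∑ f ∈ J, ∑ g ∈ J, |Ex Ω (fun x => mon p (img Γ f) x * mon p (img Γ g) x)| := by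
        gcongr; exact le_abs_self _
    _ ≤ ∑ f ∈ J, ∑ g : β ↪ Fin n, |Ex Ω (fun x => mon p (img Γ f) x * mon p (img Γ g) x)| := by
        refine Finset.sum_le_sum fun f _ => ?_
        refine Finset.sum_le_sum_of_subset_of_nonneg (Finset.subset_univ J) ?_
        intro _ _ _; exact abs_nonneg _
    _ ≤ _ := by
        refine Finset.sum_le_sum_of_subset_of_nonneg (Finset.subset_univ J) ?_
        intro _ _ _; exact Finset.sum_nonneg fun _ _ => abs_nonneg _

end Core
end GS

end


set_option linter.unusedSectionVars false
noncomputable section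
namespace GS

section Multi
variable {α : Type*} [DecidableEq α]

/-- derivative of monomial -/
def dmon (p : ℝ) (e : α) (E : Finset α) (x : α → Bool) : ℝ := if e ∈ E then mon p (E.erase e) x else 0

/-- second derivative of monomial -/
def ddmon (p : ℝ) (e f : α) (E : Finset α) (x : α → Bool) : ℝ :=
  if e ∈ E ∧ f ∈ E ∧ e ≠ f then mon p ((E.erase e).erase f) x else 0

lemma mon_mul (p : ℝ) {e : α} {E : Finset α} (he : e ∈ E) (x : α → Bool) :
    mon p E x = chi p e x * mon p (E.erase e) x := by
  unfold mon; exact (Finset.mul_prod_erase _ (fun e => chi p e x) he).symm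

lemma mon_sw_of (p : ℝ) {e f : α} {E : Finset α} (he : e ∉ E) (hf : f ∉ E) (x : α → Bool) :
    mon p E (sw e f x) = mon p E x := by
  unfold mon
  refine Finset.prod_congr rfl fun g hg => ?_
  rw [chi_sw, Equiv.swap_apply_of_ne_of_ne] <;> rintro rfl <;> contradiction

lemma mon_diff (p : ℝ) (e f : α) (E : Finset α) (x : α → Bool) :
    mon p E x - mon p E (sw e f x) = (chi p e x - chi p f x) *
      (dmon p e E x - dmon p f E x + (chi p e x - chi p f x) * ddmon p e f E x) := by
  by_cases hef : e = f
  · subst hef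
    simp [sw]
  by_cases he : e ∈ E <;> by_cases hf : f ∈ E
  · have hf' : f ∈ E.erase e := Finset.mem_erase.mpr ⟨Ne.symm hef, hf⟩
    have he' : e ∈ E.erase f := Finset.mem_erase.mpr ⟨hef, he⟩
    have hn : mon p ((E.erase e).erase f) (sw e f x) = mon p ((E.erase e).erase f) x :=
      mon_sw_of p (by simp) (by simp) x
    simp only [dmon, ddmon, he, hf, hef, if_true, ne_eq, not_false_eq_true, and_self]
    rw [mon_mul p he x, mon_mul p he (sw e f x), mon_mul p hf' x, mon_mul p hf' (sw e f x), hn,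
      mon_mul p he' x, Finset.erase_right_comm, chi_sw, chi_sw]
    simp only [Equiv.swap_apply_left, Equiv.swap_apply_right]
    ring
  · have hn : mon p (E.erase e) (sw e f x) = mon p (E.erase e) x :=
      mon_sw_of p (by simp) (by simp [hf]) x
    simp only [dmon, ddmon, he, hf, if_true, false_and, and_false, if_false]
    rw [mon_mul p he x, mon_mul p he (sw e f x), hn, chi_sw]
    simp only [Equiv.swap_apply_left]
    ring
  · have hn : mon p (E.erase f) (sw e f x) = mon p (E.erase f) x :=
      mon_sw_of p (by simp [he]) (by simp) x
    simp only [dmon, ddmon, he, hf, if_true, false_and, if_false]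
    rw [mon_mul p hf x, mon_mul p hf (sw e f x), hn, chi_sw]
    simp only [Equiv.swap_apply_right]
    ring
  · simp only [dmon, ddmon, he, hf, false_and, if_false]
    rw [mon_sw_of p he hf]; ring

lemma dmon_diff (p : ℝ) (e f : α) (E : Finset α) (x : α → Bool) :
    dmon p e E x - dmon p e E (sw e f x) = (chi p f x - chi p e x) * ddmon p e f E x := by
  by_cases hef : e = f
  · subst hef
    simp [sw]
  by_cases he : e ∈ E <;> by_cases hf : f ∈ E
  · have hf' : f ∈ E.erase e := Finset.mem_erase.mpr ⟨Ne.symm hef, hf⟩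
    have hn : mon p ((E.erase e).erase f) (sw e f x) = mon p ((E.erase e).erase f) x :=
      mon_sw_of p (by simp) (by simp) x
    simp only [dmon, ddmon, he, hf, hef, if_true, ne_eq, not_false_eq_true, and_self]
    rw [mon_mul p hf' x, mon_mul p hf' (sw e f x), hn, chi_sw]
    simp only [Equiv.swap_apply_right]
    ring
  · have hn : mon p (E.erase e) (sw e f x) = mon p (E.erase e) x :=
      mon_sw_of p (by simp) (by simp [hf]) x
    simp only [dmon, ddmon, he, hf, if_true, false_and, and_false, if_false]
    rw [hn]; ring
  · simp [dmon, ddmon, he]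
  · simp [dmon, ddmon, he]

variable [Fintype α]
/-- multilinear polynomial -/
def PF (p : ℝ) (w : Finset α → ℝ) (x : α → Bool) : ℝ := ∑ E, w E * mon p E x
def PL (p : ℝ) (w : Finset α → ℝ) (e : α) (x : α → Bool) : ℝ := ∑ E, w E * dmon p e E x
def PY (p : ℝ) (w : Finset α → ℝ) (e f : α) (x : α → Bool) : ℝ := ∑ E, w E * ddmon p e f E x

lemma PF_diff (p : ℝ) (w : Finset α → ℝ) (e f : α) (x : α → Bool) :
    PF p w x - PF p w (sw e f x) = (chi p e x - chi p f x) *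
      (PL p w e x - PL p w f x + (chi p e x - chi p f x) * PY p w e f x) := by
  unfold PF PL PY
  rw [← Finset.sum_sub_distrib, ← Finset.sum_sub_distrib, Finset.mul_sum, ← Finset.sum_add_distrib,
    Finset.mul_sum]
  refine Finset.sum_congr rfl fun E _ => ?_
  linear_combination w E * mon_diff p e f E x

lemma PL_diff (p : ℝ) (w : Finset α → ℝ) (e f : α) (x : α → Bool) :
    PL p w e x - PL p w e (sw e f x) = (chi p f x - chi p e x) * PY p w e f x := by
  unfold PL PY
  rw [← Finset.sum_sub_distrib, Finset.mul_sum]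
  refine Finset.sum_congr rfl fun E _ => ?_
  linear_combination w E * dmon_diff p e f E x

lemma PL_lin (p : ℝ) (a b : ℝ) (w v : Finset α → ℝ) (e : α) (x : α → Bool) :
    PL p (fun E => a * w E + b * v E) e x = a * PL p w e x + b * PL p v e x := by
  unfold PL
  rw [Finset.mul_sum, Finset.mul_sum, ← Finset.sum_add_distrib]
  refine Finset.sum_congr rfl fun E _ => by ring

lemma PF_lin (p : ℝ) (a b : ℝ) (w v : Finset α → ℝ) (x : α → Bool) :
    PF p (fun E => a * w E + b * v E) x = a * PF p w x + b * PF p v x := by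
  unfold PF
  rw [Finset.mul_sum, Finset.mul_sum, ← Finset.sum_add_distrib]
  refine Finset.sum_congr rfl fun E _ => by ring

/-- Euler identity. -/
lemma PL_euler (p : ℝ) (A : Finset α) (k : ℝ) (w : Finset α → ℝ) (hA : ∀ E, w E ≠ 0 → E ⊆ A)
    (hk : ∀ E, w E ≠ 0 → (E.card : ℝ) = k) (x : α → Bool) :
    ∑ e ∈ A, chi p e x * PL p w e x = k * PF p w x := by
  unfold PL PF
  simp_rw [Finset.mul_sum]
  rw [Finset.sum_comm]
  refine Finset.sum_congr rfl fun E _ => ?_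
  by_cases h : w E = 0
  · simp [h]
  have : ∀ e ∈ A, chi p e x * (w E * dmon p e E x) = if e ∈ E then w E * mon p E x else 0 := by
    intro e _
    unfold dmon
    split_ifs with he
    · rw [mon_mul p he x]; ring
    · ring
  rw [Finset.sum_congr rfl this, ← Finset.sum_filter, Finset.sum_const, nsmul_eq_mul]
  have h2 : A.filter (fun e => e ∈ E) = E := by
    ext e; simp only [Finset.mem_filter]; exact ⟨fun h => h.2, fun h' => ⟨hA E h h', h'⟩⟩
  rw [h2, hk E h]

variable {A : Finset α} {Ω : Finset (α → Bool)} {p B c : ℝ}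

lemma Good.mon_bd' (h : Good A Ω p B c) (S : Finset α) (x : α → Bool) {k : ℕ} (hk : S.card ≤ k) :
    |mon p S x| ≤ B ^ k := (h.mon_bd S x).trans (pow_le_pow_right₀ h.hB hk)

lemma PL_bd (h : Good A Ω p B c) (w : Finset α → ℝ) {k : ℕ} (hk : ∀ E, w E ≠ 0 → E.card ≤ k)
    (e : α) (x : α → Bool) :
    |PL p w e x| ≤ B ^ k * ∑ E, (if e ∈ E then |w E| else 0) := by
  unfold PL
  refine (Finset.abs_sum_le_sum_abs _ _).trans ?_
  rw [Finset.mul_sum]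
  refine Finset.sum_le_sum fun E _ => ?_
  by_cases hw : w E = 0
  · simp [hw]
  unfold dmon
  split_ifs with he
  · rw [abs_mul, mul_comm]
    gcongr
    exact h.mon_bd' _ _ ((Finset.card_erase_le).trans (hk E hw))
  · simp

lemma PY_bd (h : Good A Ω p B c) (w : Finset α → ℝ) {k : ℕ} (hk : ∀ E, w E ≠ 0 → E.card ≤ k)
    (e : α) (x : α → Bool) :
    ∑ f ∈ A, |PY p w e f x| ≤ k * B ^ k * ∑ E, (if e ∈ E then |w E| else 0) := by
  have hB : 0 ≤ B := zero_le_one.trans h.hB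
  unfold PY
  calc _ ≤ ∑ f ∈ A, ∑ E, |w E * ddmon p e f E x| :=
        Finset.sum_le_sum fun f _ => Finset.abs_sum_le_sum_abs _ _
    _ = ∑ E, ∑ f ∈ A, |w E * ddmon p e f E x| := Finset.sum_comm
    _ ≤ _ := by
      rw [Finset.mul_sum]
      refine Finset.sum_le_sum fun E _ => ?_
      by_cases hw : w E = 0
      · simp [hw]
      by_cases he : e ∈ E
      · simp only [he, if_true]
        calc _ ≤ ∑ f ∈ A, if f ∈ E then B ^ k * |w E| else 0 := by
              refine Finset.sum_le_sum fun f _ => ?_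
              unfold ddmon
              by_cases hf : f ∈ E
              · simp only [hf, if_true]
                split_ifs
                · rw [abs_mul, mul_comm]
                  gcongr
                  exact h.mon_bd' _ _ ((Finset.card_erase_le).trans
                    ((Finset.card_erase_le).trans (hk E hw)))
                · simp; positivity
              · simp [hf]
          _ = ((A.filter fun f => f ∈ E).card : ℝ) * (B ^ k * |w E|) := by
              rw [← Finset.sum_filter, Finset.sum_const, nsmul_eq_mul]
          _ ≤ (k : ℝ) * (B ^ k * |w E|) := by
              gcongr
              refine le_trans (Finset.card_le_card ?_) (hk E hw)
              intro f hf; exact (Finset.mem_filter.mp hf).2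
          _ = _ := by ring
      · simp [ddmon, he]
end Multi

section Fiber
variable {β : Type*} [Fintype β] [DecidableEq β] {n : ℕ}

open Classical in
/-- indicator of copies of Γ -/
def ind (Γ : Finset (Sym2 β)) (E : Finset (Sym2 (Fin n))) : ℝ :=
  if ∃ f : β ↪ Fin n, E = img Γ f then 1 else 0

/-- number of automorphisms -/
def aut (Γ : Finset (Sym2 β)) : ℕ := (Finset.univ.filter fun π : Equiv.Perm β => Γ.image (Sym2.map π) = Γ).card

lemma img_comp (Γ : Finset (Sym2 β)) (f : β → Fin n) (π : β → β) :
    img Γ (f ∘ π) = img (Γ.image (Sym2.map π)) f := by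
  unfold img
  rw [Finset.image_image, ← Sym2.map_comp]

lemma img_inj {Γ Γ' : Finset (Sym2 β)} {f : β → Fin n} (hf : Function.Injective f)
    (h : img Γ f = img Γ' f) : Γ = Γ' := Finset.image_injective (Sym2.map.injective hf) h

lemma img_range {Γ : Finset (Sym2 β)} (hcov : ∀ b : β, ∃ e ∈ Γ, b ∈ e) {f g : β → Fin n}
    (h : img Γ f = img Γ g) (b : β) : ∃ a, g a = f b := by
  obtain ⟨e, he, hb⟩ := hcov b
  have h1 : Sym2.map f e ∈ img Γ g := h ▸ Finset.mem_image_of_mem _ he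
  simp only [img, Finset.mem_image] at h1
  obtain ⟨e', _, h2⟩ := h1
  have h3 : f b ∈ Sym2.map g e' := by rw [h2]; exact Sym2.mem_map.mpr ⟨b, hb, rfl⟩
  obtain ⟨a, _, ha⟩ := Sym2.mem_map.mp h3
  exact ⟨a, ha⟩

lemma fiber_card {Γ : Finset (Sym2 β)} (hcov : ∀ b : β, ∃ e ∈ Γ, b ∈ e) (g : β ↪ Fin n) :
    (Finset.univ.filter fun f : β ↪ Fin n => img Γ f = img Γ g).card = aut Γ := by
  symm
  apply Finset.card_bij (fun π _ => π.toEmbedding.trans g)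
  · intro π hπ
    rw [Finset.mem_filter] at hπ ⊢
    refine ⟨Finset.mem_univ _, ?_⟩
    have : ((π.toEmbedding.trans g : β ↪ Fin n) : β → Fin n) = g ∘ π := rfl
    rw [this, img_comp, hπ.2]
  · intro π _ π' _ h
    ext b
    have := DFunLike.congr_fun h b
    exact g.injective this
  · intro f hf
    rw [Finset.mem_filter] at hf
    have h1 := img_range hcov hf.2
    choose π hπ using h1
    have hinj : Function.Injective π := by
      intro a b hab
      apply f.injective
      rw [← hπ a, ← hπ b, hab]
    let π' : Equiv.Perm β := Equiv.ofBijective π (Finite.injective_iff_bijective.mp hinj)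
    have hfc : (f : β → Fin n) = g ∘ π' := by funext b; exact (hπ b).symm
    refine ⟨π', ?_, ?_⟩
    · rw [Finset.mem_filter]
      refine ⟨Finset.mem_univ _, ?_⟩
      apply img_inj g.injective
      rw [← img_comp, ← hfc, hf.2]
    · ext b; simp only [Function.Embedding.trans_apply]; exact congrArg _ (hπ b)

lemma ind_sum {Γ : Finset (Sym2 β)} (hcov : ∀ b : β, ∃ e ∈ Γ, b ∈ e)
    (φ : Finset (Sym2 (Fin n)) → ℝ) :
    ∑ f : β ↪ Fin n, φ (img Γ f) = aut Γ * ∑ E, ind Γ E * φ E := by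
  classical
  rw [← Finset.sum_fiberwise (s := Finset.univ) (g := fun f : β ↪ Fin n => img Γ f), Finset.mul_sum]
  refine Finset.sum_congr rfl fun E _ => ?_
  unfold ind
  split_ifs with h
  · obtain ⟨g, rfl⟩ := h
    rw [Finset.sum_congr rfl (g := fun _ => φ (img Γ g)), Finset.sum_const, fiber_card hcov, nsmul_eq_mul,
      one_mul]
    intro f hf; rw [(Finset.mem_filter.mp hf).2]
  · have : (Finset.univ.filter fun f : β ↪ Fin n => img Γ f = E) = ∅ := by
      rw [Finset.filter_eq_empty_iff]
      intro f _ hf; exact h ⟨f, hf.symm⟩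
    rw [this]; simp

lemma aut_pos (Γ : Finset (Sym2 β)) : 0 < aut Γ := by
  apply Finset.card_pos.mpr
  refine ⟨1, ?_⟩
  simp

/-- path -/
def GP : Finset (Sym2 (Fin 3)) := {s(0, 1), s(0, 2)}
/-- triangle -/
def GK : Finset (Sym2 (Fin 3)) := {s(0, 1), s(0, 2), s(1, 2)}
def GP4 : Finset (Sym2 (Fin 4)) := {s(0, 1), s(1, 2), s(2, 3)}
def GC4 : Finset (Sym2 (Fin 4)) := {s(0, 1), s(1, 2), s(2, 3), s(3, 0)}

lemma aut_GP : aut GP = 2 := by decide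
lemma aut_GK : aut GK = 6 := by decide
lemma cov_GP : ∀ b : Fin 3, ∃ e ∈ GP, b ∈ e := by decide
lemma cov_GK : ∀ b : Fin 3, ∃ e ∈ GK, b ∈ e := by decide
lemma cov_GP4 : ∀ b : Fin 4, ∃ e ∈ GP4, b ∈ e := by decide
lemma cov_GC4 : ∀ b : Fin 4, ∃ e ∈ GC4, b ∈ e := by decide
lemma nd_GP : ∀ e ∈ GP, ¬ e.IsDiag := by decide
lemma nd_GK : ∀ e ∈ GK, ¬ e.IsDiag := by decide
lemma nd_GP4 : ∀ e ∈ GP4, ¬ e.IsDiag := by decide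
lemma nd_GC4 : ∀ e ∈ GC4, ¬ e.IsDiag := by decide

lemma ind_ne {Γ : Finset (Sym2 β)} {E : Finset (Sym2 (Fin n))} (h : ind Γ E ≠ 0) :
    ∃ f : β ↪ Fin n, E = img Γ f := by
  unfold ind at h
  by_contra h2
  simp [h2] at h

lemma ind_card {Γ : Finset (Sym2 β)} {E : Finset (Sym2 (Fin n))} (h : ind Γ E ≠ 0) :
    E.card = Γ.card := by
  obtain ⟨f, rfl⟩ := ind_ne h
  exact img_card Γ f.injective

lemma ind_sub {Γ : Finset (Sym2 β)} (hΓ : ∀ e ∈ Γ, ¬ e.IsDiag) {E : Finset (Sym2 (Fin n))}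
    (h : ind Γ E ≠ 0) : E ⊆ Ed n := by
  obtain ⟨f, rfl⟩ := ind_ne h
  exact img_sub hΓ f.injective

lemma ind_nonneg (Γ : Finset (Sym2 β)) (E : Finset (Sym2 (Fin n))) : 0 ≤ ind Γ E := by
  unfold ind; split_ifs <;> norm_num
lemma ind_sq (Γ : Finset (Sym2 β)) (E : Finset (Sym2 (Fin n))) : ind Γ E ^ 2 = ind Γ E := by
  unfold ind; split_ifs <;> norm_num
end Fiber
end GS

end


set_option linter.unusedSectionVars false
noncomputable section
namespace GS

section Tuples
variable {n : ℕ}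

lemma emb_sum {k : ℕ} (φ : (Fin k → Fin n) → ℝ) :
    ∑ f : Fin k ↪ Fin n, φ f = ∑ g : Fin k → Fin n, if Function.Injective g then φ g else 0 := by
  classical
  rw [← Finset.sum_filter]
  refine Finset.sum_bij (fun f _ => (f : Fin k → Fin n)) ?_ ?_ ?_ ?_
  · intro f _; rw [Finset.mem_filter]; exact ⟨Finset.mem_univ _, f.injective⟩
  · intro f _ g _ h; exact DFunLike.coe_injective h
  · intro g hg; rw [Finset.mem_filter] at hg; exact ⟨⟨g, hg.2⟩, Finset.mem_univ _, rfl⟩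
  · intro f _; rfl

lemma fun_succ {k : ℕ} (φ : (Fin (k + 1) → Fin n) → ℝ) :
    ∑ g : Fin (k + 1) → Fin n, φ g = ∑ a : Fin n, ∑ g : Fin k → Fin n, φ (Matrix.vecCons a g) := by
  rw [← Fintype.sum_prod_type']
  exact ((Fin.consEquiv (fun _ : Fin (k + 1) => Fin n)).sum_comp φ).symm

lemma fun3 (φ : (Fin 3 → Fin n) → ℝ) :
    ∑ g : Fin 3 → Fin n, φ g = ∑ a : Fin n, ∑ b : Fin n, ∑ c : Fin n, φ ![a, b, c] := by
  simp only [fun_succ, Finset.univ_unique, Finset.sum_singleton]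
  refine Finset.sum_congr rfl fun a _ => Finset.sum_congr rfl fun b _ => Finset.sum_congr rfl fun c _ => ?_
  congr

lemma fun4 (φ : (Fin 4 → Fin n) → ℝ) :
    ∑ g : Fin 4 → Fin n, φ g =
      ∑ a : Fin n, ∑ b : Fin n, ∑ c : Fin n, ∑ d : Fin n, φ ![a, b, c, d] := by
  simp only [fun_succ, Finset.univ_unique, Finset.sum_singleton]
  refine Finset.sum_congr rfl fun a _ => Finset.sum_congr rfl fun b _ => Finset.sum_congr rfl fun c _ =>
    Finset.sum_congr rfl fun d _ => ?_
  congr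

lemma inj3 (a b c : Fin n) : Function.Injective ![a, b, c] ↔ a ≠ b ∧ a ≠ c ∧ b ≠ c := by
  constructor
  · intro h
    refine ⟨fun e => ?_, fun e => ?_, fun e => ?_⟩
    · exact absurd (@h 0 1 (by simpa using e)) (by decide)
    · exact absurd (@h 0 2 (by simpa using e)) (by decide)
    · exact absurd (@h 1 2 (by simpa using e)) (by decide)
  · rintro ⟨h1, h2, h3⟩ i j
    fin_cases i <;> fin_cases j <;> simp [h1, h2, h3, Ne.symm h1, Ne.symm h2, Ne.symm h3]

lemma inj4 (a b c d : Fin n) : Function.Injective ![a, b, c, d] ↔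
    a ≠ b ∧ a ≠ c ∧ a ≠ d ∧ b ≠ c ∧ b ≠ d ∧ c ≠ d := by
  constructor
  · intro h
    refine ⟨fun e => ?_, fun e => ?_, fun e => ?_, fun e => ?_, fun e => ?_, fun e => ?_⟩
    · exact absurd (@h 0 1 (by simpa using e)) (by decide)
    · exact absurd (@h 0 2 (by simpa using e)) (by decide)
    · exact absurd (@h 0 3 (by simpa using e)) (by decide)
    · exact absurd (@h 1 2 (by simpa using e)) (by decide)
    · exact absurd (@h 1 3 (by simpa using e)) (by decide)
    · exact absurd (@h 2 3 (by simpa using e)) (by decide)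
  · rintro ⟨h1, h2, h3, h4, h5, h6⟩ i j
    fin_cases i <;> fin_cases j <;> simp [h1, h2, h3, h4, h5, h6, Ne.symm h1, Ne.symm h2, Ne.symm h3,
      Ne.symm h4, Ne.symm h5, Ne.symm h6]

lemma img_GP (a b c : Fin n) : img GP ![a, b, c] = {s(a, b), s(a, c)} := by
  simp [img, GP, Finset.image_insert]
lemma img_GK (a b c : Fin n) : img GK ![a, b, c] = {s(a, b), s(a, c), s(b, c)} := by
  simp [img, GK, Finset.image_insert]
lemma img_GP4 (a b c d : Fin n) : img GP4 ![a, b, c, d] = {s(a, b), s(b, c), s(c, d)} := by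
  simp [img, GP4, Finset.image_insert]
lemma img_GC4 (a b c d : Fin n) : img GC4 ![a, b, c, d] = {s(a, b), s(b, c), s(c, d), s(d, a)} := by
  simp [img, GC4, Finset.image_insert]

/-- edge variable matrix -/
def XX (p : ℝ) (x : Sym2 (Fin n) → Bool) (u v : Fin n) : ℝ := if u = v then 0 else chi p s(u, v) x

lemma XX_symm (p : ℝ) (x : Sym2 (Fin n) → Bool) (u v : Fin n) : XX p x u v = XX p x v u := by
  unfold XX; rw [Sym2.eq_swap]; simp only [eq_comm]
lemma XX_self (p : ℝ) (x : Sym2 (Fin n) → Bool) (u : Fin n) : XX p x u u = 0 := by simp [XX]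
lemma XX_ne (p : ℝ) (x : Sym2 (Fin n) → Bool) {u v : Fin n} (h : u ≠ v) :
    XX p x u v = chi p s(u, v) x := by simp [XX, h]

lemma mon_GP (p : ℝ) (x : Sym2 (Fin n) → Bool) {a b c : Fin n} (h1 : a ≠ b) (h2 : a ≠ c) (h3 : b ≠ c) :
    mon p (img GP ![a, b, c]) x = XX p x a b * XX p x a c := by
  have e1 : s(a, b) ∉ ({s(a, c)} : Finset (Sym2 (Fin n))) := by
    simp; grind
  rw [img_GP, mon, Finset.prod_insert e1, Finset.prod_singleton, XX_ne p x h1, XX_ne p x h2]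

lemma mon_GK (p : ℝ) (x : Sym2 (Fin n) → Bool) {a b c : Fin n} (h1 : a ≠ b) (h2 : a ≠ c) (h3 : b ≠ c) :
    mon p (img GK ![a, b, c]) x = XX p x a b * XX p x a c * XX p x b c := by
  have e1 : s(a, b) ∉ ({s(a, c), s(b, c)} : Finset (Sym2 (Fin n))) := by
    simp; grind
  have e2 : s(a, c) ∉ ({s(b, c)} : Finset (Sym2 (Fin n))) := by
    simp; grind
  rw [img_GK, mon, Finset.prod_insert e1, Finset.prod_insert e2, Finset.prod_singleton, XX_ne p x h1, XX_ne p x h2,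
    XX_ne p x h3, mul_assoc]

lemma mon_GP4 (p : ℝ) (x : Sym2 (Fin n) → Bool) {a b c d : Fin n} (h1 : a ≠ b) (h2 : a ≠ c) (h3 : a ≠ d)
    (h4 : b ≠ c) (h5 : b ≠ d) (h6 : c ≠ d) :
    mon p (img GP4 ![a, b, c, d]) x = XX p x a b * XX p x b c * XX p x c d := by
  have e1 : s(a, b) ∉ ({s(b, c), s(c, d)} : Finset (Sym2 (Fin n))) := by
    simp; grind
  have e2 : s(b, c) ∉ ({s(c, d)} : Finset (Sym2 (Fin n))) := by
    simp; grind
  rw [img_GP4, mon, Finset.prod_insert e1, Finset.prod_insert e2, Finset.prod_singleton, XX_ne p x h1, XX_ne p x h4,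
    XX_ne p x h6, mul_assoc]

lemma mon_GC4 (p : ℝ) (x : Sym2 (Fin n) → Bool) {a b c d : Fin n} (h1 : a ≠ b) (h2 : a ≠ c) (h3 : a ≠ d)
    (h4 : b ≠ c) (h5 : b ≠ d) (h6 : c ≠ d) :
    mon p (img GC4 ![a, b, c, d]) x = XX p x a b * XX p x b c * XX p x c d * XX p x d a := by
  have e1 : s(a, b) ∉ ({s(b, c), s(c, d), s(d, a)} : Finset (Sym2 (Fin n))) := by
    simp; grind
  have e2 : s(b, c) ∉ ({s(c, d), s(d, a)} : Finset (Sym2 (Fin n))) := by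
    simp; grind
  have e3 : s(c, d) ∉ ({s(d, a)} : Finset (Sym2 (Fin n))) := by
    simp; grind
  rw [img_GC4, mon, Finset.prod_insert e1, Finset.prod_insert e2, Finset.prod_insert e3,
    Finset.prod_singleton, XX_ne p x h1, XX_ne p x h4, XX_ne p x h6, XX_ne p x h3.symm]
  ring

/-- Sum over injective tuples. -/
def SS {k : ℕ} (p : ℝ) (Γ : Finset (Sym2 (Fin k))) (x : Sym2 (Fin n) → Bool) : ℝ :=
  ∑ f : Fin k ↪ Fin n, mon p (img Γ f) x

/-- Kronecker -/
def dl (u v : Fin n) : ℝ := if u = v then 1 else 0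

lemma SS_GP (p : ℝ) (x : Sym2 (Fin n) → Bool) :
    SS p GP x = ∑ a, ∑ b, ∑ c, XX p x a b * XX p x a c * (1 - dl b c) := by
  unfold SS
  rw [emb_sum (fun g => mon p (img GP g) x), fun3]
  refine Finset.sum_congr rfl fun a _ => Finset.sum_congr rfl fun b _ => Finset.sum_congr rfl fun c _ => ?_
  simp only [inj3]
  split_ifs with h
  · rw [mon_GP p x h.1 h.2.1 h.2.2]; simp [dl, h.2.2]
  · by_cases h1 : a = b
    · subst h1; simp [XX_self]
    by_cases h2 : a = c
    · subst h2; simp [XX_self]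
    by_cases h3 : b = c
    · subst h3; simp [dl]
    · exact absurd ⟨h1, h2, h3⟩ h

lemma SS_GK (p : ℝ) (x : Sym2 (Fin n) → Bool) :
    SS p GK x = ∑ a, ∑ b, ∑ c, XX p x a b * XX p x a c * XX p x b c := by
  unfold SS
  rw [emb_sum (fun g => mon p (img GK g) x), fun3]
  refine Finset.sum_congr rfl fun a _ => Finset.sum_congr rfl fun b _ => Finset.sum_congr rfl fun c _ => ?_
  simp only [inj3]
  split_ifs with h
  · rw [mon_GK p x h.1 h.2.1 h.2.2]
  · by_cases h1 : a = b
    · subst h1; simp [XX_self]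
    by_cases h2 : a = c
    · subst h2; simp [XX_self]
    by_cases h3 : b = c
    · subst h3; simp [XX_self]
    · exact absurd ⟨h1, h2, h3⟩ h

lemma SS_GP4 (p : ℝ) (x : Sym2 (Fin n) → Bool) :
    SS p GP4 x = ∑ a, ∑ b, ∑ c, ∑ d, XX p x a b * XX p x b c * XX p x c d *
      ((1 - dl a c) * (1 - dl b d) * (1 - dl a d)) := by
  unfold SS
  rw [emb_sum (fun g => mon p (img GP4 g) x), fun4]
  refine Finset.sum_congr rfl fun a _ => Finset.sum_congr rfl fun b _ => Finset.sum_congr rfl fun c _ =>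
    Finset.sum_congr rfl fun d _ => ?_
  simp only [inj4]
  split_ifs with h
  · obtain ⟨h1, h2, h3, h4, h5, h6⟩ := h
    rw [mon_GP4 p x h1 h2 h3 h4 h5 h6]; simp [dl, h2, h3, h5]
  · by_cases h1 : a = b
    · subst h1; simp [XX_self]
    by_cases h2 : a = c
    · subst h2; simp [dl]
    by_cases h3 : a = d
    · subst h3; simp [dl]
    by_cases h4 : b = c
    · subst h4; simp [XX_self]
    by_cases h5 : b = d
    · subst h5; simp [dl]
    by_cases h6 : c = d
    · subst h6; simp [XX_self]
    · exact absurd ⟨h1, h2, h3, h4, h5, h6⟩ h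

lemma SS_GC4 (p : ℝ) (x : Sym2 (Fin n) → Bool) :
    SS p GC4 x = ∑ a, ∑ b, ∑ c, ∑ d, XX p x a b * XX p x b c * XX p x c d * XX p x d a *
      ((1 - dl a c) * (1 - dl b d)) := by
  unfold SS
  rw [emb_sum (fun g => mon p (img GC4 g) x), fun4]
  refine Finset.sum_congr rfl fun a _ => Finset.sum_congr rfl fun b _ => Finset.sum_congr rfl fun c _ =>
    Finset.sum_congr rfl fun d _ => ?_
  simp only [inj4]
  split_ifs with h
  · obtain ⟨h1, h2, h3, h4, h5, h6⟩ := h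
    rw [mon_GC4 p x h1 h2 h3 h4 h5 h6]; simp [dl, h2, h5]
  · by_cases h1 : a = b
    · subst h1; simp [XX_self]
    by_cases h2 : a = c
    · subst h2; simp [dl]
    by_cases h3 : a = d
    · subst h3; simp [XX_self]
    by_cases h4 : b = c
    · subst h4; simp [XX_self]
    by_cases h5 : b = d
    · subst h5; simp [dl]
    by_cases h6 : c = d
    · subst h6; simp [XX_self]
    · exact absurd ⟨h1, h2, h3, h4, h5, h6⟩ h

end Tuples
end GS

end


set_option linter.unusedSectionVars false
noncomputable section
namespace GS

section Mat
variable {n : ℕ}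

lemma sum_dl (a : Fin n) (g : Fin n → ℝ) : ∑ c, dl a c * g c = g a := by
  simp [dl]
lemma sum_dl1 (a : Fin n) (g : Fin n → ℝ) : ∑ c, (1 - dl a c) * g c = (∑ c, g c) - g a := by
  simp_rw [sub_mul, one_mul]; rw [Finset.sum_sub_distrib, sum_dl]

/-- Symmetric matrix conditions. -/
structure Mx (X : Fin n → Fin n → ℝ) (c : ℝ) : Prop where
  symm : ∀ u v, X u v = X v u
  diag : ∀ u, X u u = 0
  sq : ∀ u v, X u v ^ 2 = (1 - dl u v) + c * X u v
  tot : ∑ u, ∑ v, X u v = 0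

variable {X : Fin n → Fin n → ℝ} {c : ℝ}

/-- degrees -/
def DD (X : Fin n → Fin n → ℝ) (u : Fin n) : ℝ := ∑ v, X u v
/-- codegrees -/
def MM (X : Fin n → Fin n → ℝ) (u v : Fin n) : ℝ := ∑ w, X u w * X v w
/-- Sum of squared degrees -/
def D2 (X : Fin n → Fin n → ℝ) : ℝ := ∑ u, DD X u ^ 2

lemma Mx.q (h : Mx X c) (a : Fin n) : ∑ b, X a b ^ 2 = ((n : ℝ) - 1) + c * DD X a := by
  simp_rw [h.sq]
  rw [Finset.sum_add_distrib, ← Finset.mul_sum, DD]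
  congr 1
  have := sum_dl1 a (fun _ => (1 : ℝ))
  simp only [mul_one] at this
  rw [this]; simp

lemma Mx.MMd (h : Mx X c) (a : Fin n) : MM X a a = ((n : ℝ) - 1) + c * DD X a := by
  rw [← h.q a]; unfold MM; refine Finset.sum_congr rfl fun b _ => by ring

lemma Mx.D0 (h : Mx X c) : ∑ a, DD X a = 0 := h.tot

lemma MM_symm (X : Fin n → Fin n → ℝ) (u v : Fin n) : MM X u v = MM X v u := by
  unfold MM; refine Finset.sum_congr rfl fun b _ => by ring

lemma Mx.sumDq (h : Mx X c) : ∑ a, DD X a * (((n : ℝ) - 1) + c * DD X a) = c * D2 X := by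
  have : ∀ a, DD X a * (((n : ℝ) - 1) + c * DD X a) = ((n : ℝ) - 1) * DD X a + c * DD X a ^ 2 := by
    intro a; ring
  simp_rw [this]
  rw [Finset.sum_add_distrib, ← Finset.mul_sum, ← Finset.mul_sum, h.D0, D2]; ring

lemma Mx.sumq (h : Mx X c) : ∑ a : Fin n, (((n : ℝ) - 1) + c * DD X a) = n * ((n : ℝ) - 1) := by
  rw [Finset.sum_add_distrib, ← Finset.mul_sum, h.D0]; simp; ring

lemma Mx.sumq2 (h : Mx X c) :
    ∑ a : Fin n, (((n : ℝ) - 1) + c * DD X a) ^ 2 = n * ((n : ℝ) - 1) ^ 2 + c ^ 2 * D2 X := by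
  have : ∀ a, (((n : ℝ) - 1) + c * DD X a) ^ 2 =
     ((n : ℝ) - 1) ^ 2 + (2 * c * ((n : ℝ) - 1)) * DD X a + c ^ 2 * DD X a ^ 2 := by
    intro a; ring
  simp_rw [this]
  rw [Finset.sum_add_distrib, Finset.sum_add_distrib, ← Finset.mul_sum, ← Finset.mul_sum, h.D0, D2]; simp

lemma Mx.cube (h : Mx X c) (u v : Fin n) : X u v ^ 3 = X u v + c * X u v ^ 2 := by
  by_cases e : u = v
  · subst e; simp [h.diag]
  · have := h.sq u v
    simp only [dl, e, if_false] at this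
    linear_combination X u v * this

lemma Mx.X2 (h : Mx X c) : ∑ a, ∑ b, X a b ^ 2 = n * ((n : ℝ) - 1) := by
  simp_rw [h.q]; exact h.sumq

lemma Mx.X3 (h : Mx X c) : ∑ a, ∑ b, X a b ^ 3 = c * (n * ((n : ℝ) - 1)) := by
  simp_rw [h.cube, Finset.sum_add_distrib, ← Finset.mul_sum]
  rw [h.X2, h.tot]; ring

lemma Mx.X4 (h : Mx X c) : ∑ a, ∑ b, X a b ^ 4 = (1 + c ^ 2) * (n * ((n : ℝ) - 1)) := by
  have : ∀ a b, X a b ^ 4 = X a b ^ 2 + c * X a b ^ 3 := by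
    intro a b; linear_combination X a b * h.cube a b
  simp_rw [this, Finset.sum_add_distrib, ← Finset.mul_sum]
  rw [h.X2, h.X3]; ring

lemma Mx.SP (h : Mx X c) :
    ∑ a, ∑ b, ∑ d, X a b * X a d * (1 - dl b d) = D2 X - n * ((n : ℝ) - 1) := by
  rw [← h.X2, D2, ← Finset.sum_sub_distrib]
  refine Finset.sum_congr rfl fun a _ => ?_
  have : ∀ b, ∑ d, X a b * X a d * (1 - dl b d) = X a b * DD X a - X a b ^ 2 := by
    intro b
    have := sum_dl1 b (fun d => X a b * X a d)
    rw [← Finset.mul_sum] at this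
    rw [DD, pow_two, ← this]
    refine Finset.sum_congr rfl fun d _ => by ring
  simp_rw [this]
  rw [Finset.sum_sub_distrib, ← Finset.sum_mul]; unfold DD; ring

/-- the quadratic form -/
def DXD (X : Fin n → Fin n → ℝ) : ℝ := ∑ a, ∑ b, X a b * ∑ d, X b d * DD X d

lemma DXD_eq (h : Mx X c) : DXD X = ∑ a, ∑ b, DD X a * DD X b * X a b := by
  unfold DXD
  rw [Finset.sum_comm]
  refine Finset.sum_congr rfl fun b _ => ?_
  rw [← Finset.sum_mul, Finset.mul_sum]
  refine Finset.sum_congr rfl fun d _ => ?_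
  have : ∑ a, X a b = DD X b := by
    unfold DD; refine Finset.sum_congr rfl fun a _ => h.symm a b
  rw [this]; ring

/-- triangle trace -/
def T3 (X : Fin n → Fin n → ℝ) : ℝ := ∑ a, ∑ b, X a b * MM X a b

lemma Mx.SK (h : Mx X c) : ∑ a, ∑ b, ∑ d, X a b * X a d * X b d = T3 X := by
  unfold T3 MM
  refine Finset.sum_congr rfl fun a _ => Finset.sum_congr rfl fun b _ => ?_
  rw [Finset.mul_sum]; refine Finset.sum_congr rfl fun d _ => by ring

lemma Mx.DXDMM (h : Mx X c) : ∑ u, ∑ v, DD X u * MM X u v = DXD X := by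
  rw [DXD_eq h]
  refine Finset.sum_congr rfl fun u _ => ?_
  unfold MM
  rw [← Finset.mul_sum, Finset.sum_comm, Finset.mul_sum]
  refine Finset.sum_congr rfl fun w _ => ?_
  rw [← Finset.mul_sum]
  have : ∑ v, X v w = DD X w := by
    unfold DD; refine Finset.sum_congr rfl fun a _ => h.symm a w
  rw [this]; ring

lemma Mx.SP4 (h : Mx X c) :
    ∑ a, ∑ b, ∑ e, ∑ d, X a b * X b e * X e d * ((1 - dl a e) * (1 - dl b d) * (1 - dl a d)) =
      DXD X - 2 * c * D2 X - T3 X + c * (n * ((n : ℝ) - 1)) := by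
  have s1 : ∀ a b e, ∑ d, X a b * X b e * X e d * ((1 - dl a e) * (1 - dl b d) * (1 - dl a d)) =
      X a b * ((1 - dl a e) * (X b e * (DD X e - X b e - X a e))) := by
    intro a b e
    by_cases hab : a = b
    · subst hab; simp [h.diag]
    have i1 : ∑ d, (1 - dl b d) * ((1 - dl a d) * X e d) = DD X e - X b e - X a e := by
      rw [sum_dl1, sum_dl1, DD, h.symm e a, h.symm e b]
      simp [dl, hab]; ring
    rw [← i1]
    simp only [Finset.mul_sum]
    refine Finset.sum_congr rfl fun d _ => by ring
  have s2 : ∀ a b, ∑ e, ∑ d, X a b * X b e * X e d * ((1 - dl a e) * (1 - dl b d) * (1 - dl a d)) =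
      X a b * (∑ d, X b d * DD X d) - X a b * (((n : ℝ) - 1) + c * DD X b) - X a b * MM X a b
        - X a b ^ 2 * DD X a + X a b ^ 3 := by
    intro a b
    simp_rw [s1]
    rw [← Finset.mul_sum, sum_dl1]
    have : ∑ e, X b e * (DD X e - X b e - X a e) =
      (∑ d, X b d * DD X d) - (((n : ℝ) - 1) + c * DD X b) - MM X a b := by
      rw [← h.q b, MM, ← Finset.sum_sub_distrib, ← Finset.sum_sub_distrib]
      refine Finset.sum_congr rfl fun d _ => by ring
    rw [this, h.diag, h.symm b a]; ring
  simp_rw [s2]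
  simp only [Finset.sum_add_distrib, Finset.sum_sub_distrib]
  rw [h.X3]
  have t1 : ∑ a, ∑ b, X a b * (((n : ℝ) - 1) + c * DD X b) = c * D2 X := by
    rw [Finset.sum_comm, ← h.sumDq]
    refine Finset.sum_congr rfl fun b _ => ?_
    rw [← Finset.sum_mul]
    congr 1
    unfold DD; refine Finset.sum_congr rfl fun a _ => h.symm a b
  have t2 : ∑ a, ∑ b, X a b ^ 2 * DD X a = c * D2 X := by
    rw [← h.sumDq]
    refine Finset.sum_congr rfl fun a _ => ?_
    rw [← Finset.sum_mul, h.q]; ring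
  rw [t1, t2]
  unfold DXD T3
  ring

/-- Sum of squared codegrees -/
def M2 (X : Fin n → Fin n → ℝ) : ℝ := ∑ a, ∑ b, MM X a b ^ 2

lemma Mx.SC4 (h : Mx X c) :
    ∑ a, ∑ b, ∑ e, ∑ d, X a b * X b e * X e d * X d a * ((1 - dl a e) * (1 - dl b d)) =
      M2 X - 2 * (n * ((n : ℝ) - 1) ^ 2 + c ^ 2 * D2 X) + (1 + c ^ 2) * (n * ((n : ℝ) - 1)) := by
  have s1 : ∀ a b e, ∑ d, X a b * X b e * X e d * X d a * ((1 - dl a e) * (1 - dl b d)) =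
      X a b * ((1 - dl a e) * (X b e * (MM X a e - X b e * X a b))) := by
    intro a b e
    have i1 : ∑ d, (1 - dl b d) * (X a d * X e d) = MM X a e - X b e * X a b := by
      rw [sum_dl1, MM, h.symm e b]; ring
    rw [← i1]
    simp only [Finset.mul_sum]
    refine Finset.sum_congr rfl fun d _ => by rw [h.symm d a]; ring
  have s2 : ∀ a b, ∑ e, ∑ d, X a b * X b e * X e d * X d a * ((1 - dl a e) * (1 - dl b d)) =
      (∑ e, X a b * X b e * MM X a e) - X a b ^ 2 * (((n : ℝ) - 1) + c * DD X b)
        - X a b ^ 2 * (((n : ℝ) - 1) + c * DD X a) + X a b ^ 4 := by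
    intro a b
    simp_rw [s1]
    rw [← Finset.mul_sum, sum_dl1]
    have : X a b * ∑ e, X b e * (MM X a e - X b e * X a b) =
      (∑ e, X a b * X b e * MM X a e) - X a b ^ 2 * (((n : ℝ) - 1) + c * DD X b) := by
      rw [← h.q b, Finset.mul_sum, Finset.mul_sum, ← Finset.sum_sub_distrib]
      refine Finset.sum_congr rfl fun d _ => by ring
    rw [mul_sub, this, h.MMd, h.symm b a]; ring
  simp_rw [s2]
  simp only [Finset.sum_add_distrib, Finset.sum_sub_distrib]
  rw [h.X4]
  have t2 : ∑ a, ∑ b, X a b ^ 2 * (((n : ℝ) - 1) + c * DD X a) = n * ((n : ℝ) - 1) ^ 2 + c ^ 2 * D2 X := by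
    rw [← h.sumq2]
    refine Finset.sum_congr rfl fun a _ => ?_
    rw [← Finset.sum_mul, h.q]; ring
  have t1 : ∑ a, ∑ b, X a b ^ 2 * (((n : ℝ) - 1) + c * DD X b) = n * ((n : ℝ) - 1) ^ 2 + c ^ 2 * D2 X := by
    rw [← t2, Finset.sum_comm]
    refine Finset.sum_congr rfl fun a _ => Finset.sum_congr rfl fun b _ => by rw [h.symm]
  have t3 : ∑ a, ∑ b, ∑ e, X a b * X b e * MM X a e = M2 X := by
    unfold M2
    refine Finset.sum_congr rfl fun a _ => ?_
    rw [Finset.sum_comm]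
    refine Finset.sum_congr rfl fun e _ => ?_
    rw [← Finset.sum_mul, pow_two]
    congr 1
    unfold MM
    refine Finset.sum_congr rfl fun b _ => by rw [h.symm b e]
  rw [t1, t2, t3]
  ring

/-- path derivative -/
def pp (X : Fin n → Fin n → ℝ) (u v : Fin n) : ℝ := DD X u + DD X v - 2 * X u v

lemma off_sum (φ : Fin n → Fin n → ℝ) :
    ∑ u, ∑ v, (1 - dl u v) * φ u v = (∑ u, ∑ v, φ u v) - ∑ u, φ u u := by
  rw [← Finset.sum_sub_distrib]
  exact Finset.sum_congr rfl fun u _ => sum_dl1 u _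

lemma sum_l (f : Fin n → ℝ) : ∑ u : Fin n, ∑ _v : Fin n, f u = n * ∑ u, f u := by
  simp [Finset.mul_sum]
lemma sum_r (f : Fin n → ℝ) : ∑ _u : Fin n, ∑ v : Fin n, f v = n * ∑ u, f u := by
  simp

lemma Mx.DX (h : Mx X c) : ∑ u, ∑ v, DD X u * X u v = D2 X := by
  unfold D2; refine Finset.sum_congr rfl fun u _ => ?_
  rw [← Finset.mul_sum]; unfold DD; ring
lemma Mx.DX' (h : Mx X c) : ∑ u, ∑ v, DD X v * X u v = D2 X := by
  rw [← h.DX, Finset.sum_comm]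
  refine Finset.sum_congr rfl fun u _ => Finset.sum_congr rfl fun v _ => by rw [h.symm]

lemma Mx.QPP (h : Mx X c) : ∑ u, ∑ v, (1 - dl u v) * pp X u v ^ 2 =
    2 * (((n : ℝ) - 6) * D2 X + 2 * (n * ((n : ℝ) - 1))) := by
  rw [off_sum]
  have e1 : ∀ u v, pp X u v ^ 2 = DD X u ^ 2 + DD X v ^ 2 + 2 * (DD X u * DD X v) + 4 * X u v ^ 2
     - 4 * (DD X u * X u v) - 4 * (DD X v * X u v) := by intro u v; unfold pp; ring
  have e2 : ∀ u, pp X u u ^ 2 = 4 * DD X u ^ 2 := by intro u; unfold pp; rw [h.diag]; ring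
  simp_rw [e2]
  simp_rw [e1]
  simp only [Finset.sum_add_distrib, Finset.sum_sub_distrib, ← Finset.mul_sum]
  rw [sum_l (fun u => DD X u ^ 2), sum_r (fun u => DD X u ^ 2), h.D0]
  simp only [mul_zero, Finset.mul_sum]
  simp only [← Finset.mul_sum]
  rw [h.X2]
  have a1 := h.DX
  have a2 := h.DX'
  simp only [← Finset.mul_sum] at a1
  rw [a1, a2]
  unfold D2; simp; ring

lemma Mx.QPK (h : Mx X c) : ∑ u, ∑ v, (1 - dl u v) * (pp X u v * MM X u v) =
    2 * (DXD X - c * D2 X - T3 X) := by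
  rw [off_sum]
  have e1 : ∀ u v, pp X u v * MM X u v = DD X u * MM X u v + DD X v * MM X v u
     - 2 * (X u v * MM X u v) := by intro u v; unfold pp; rw [MM_symm X v u]; ring
  have e2 : ∀ u, pp X u u * MM X u u = 2 * (DD X u * (((n : ℝ) - 1) + c * DD X u)) := by
    intro u; unfold pp; rw [h.diag, h.MMd]; ring
  simp_rw [e2]
  simp_rw [e1]
  have a1 := h.DXDMM
  have a2 : ∑ u, ∑ v, DD X v * MM X v u = DXD X := by rw [Finset.sum_comm, a1]
  simp only [Finset.sum_add_distrib, Finset.sum_sub_distrib]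
  rw [a1, a2, ← Finset.mul_sum, h.sumDq]
  simp only [← Finset.mul_sum]
  unfold T3
  ring

lemma Mx.QKK (h : Mx X c) : ∑ u, ∑ v, (1 - dl u v) * MM X u v ^ 2 =
    M2 X - (n * ((n : ℝ) - 1) ^ 2 + c ^ 2 * D2 X) := by
  rw [off_sum]
  simp_rw [h.MMd]
  rw [h.sumq2, M2]

lemma Mx.QP1 (h : Mx X c) : ∑ u, ∑ v, (1 - dl u v) * pp X u v = 0 := by
  rw [off_sum]
  unfold pp
  simp only [Finset.sum_add_distrib, Finset.sum_sub_distrib, h.diag, ← Finset.mul_sum, h.tot]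
  rw [sum_l (fun u => DD X u), sum_r (fun u => DD X u), h.D0]
  simp

lemma Mx.QK1 (h : Mx X c) : ∑ u, ∑ v, (1 - dl u v) * MM X u v = D2 X - n * ((n : ℝ) - 1) := by
  rw [off_sum]
  simp_rw [h.MMd]
  rw [h.sumq]
  congr 1
  unfold D2 MM
  have : ∀ u, ∑ v, ∑ w, X u w * X v w = ∑ w, X u w * DD X w := by
    intro u
    rw [Finset.sum_comm]
    refine Finset.sum_congr rfl fun w _ => ?_
    rw [← Finset.mul_sum]
    congr 1
    unfold DD; refine Finset.sum_congr rfl fun a _ => h.symm a w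
  simp_rw [this]
  rw [Finset.sum_comm]
  refine Finset.sum_congr rfl fun w _ => ?_
  rw [← Finset.sum_mul, pow_two]
  congr 1
  unfold DD; refine Finset.sum_congr rfl fun a _ => h.symm a w

end Mat
end GS

end


set_option linter.unusedSectionVars false
noncomputable section
namespace GS

section Conn
variable {n : ℕ}

lemma edge_sum {u v : Fin n} (huv : u ≠ v) (φ : Fin n → Fin n → ℝ) :
    ∑ a, ∑ b, (if s(u, v) = s(a, b) then φ a b else 0) = φ u v + φ v u := by
  have : ∀ a b, (if s(u, v) = s(a, b) then φ a b else 0) = dl u a * (dl v b * φ a b) + dl v a * (dl u b * φ a b) := by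
    intro a b
    simp only [Sym2.eq_iff, dl]
    by_cases h1 : u = a <;> by_cases h2 : v = b <;> by_cases h3 : u = b <;> by_cases h4 : v = a <;>
      simp_all
  simp_rw [this, Finset.sum_add_distrib, ← Finset.mul_sum, sum_dl]

lemma Ed_sum (ψ : Sym2 (Fin n) → ℝ) :
    ∑ e ∈ Ed n, ψ e = 1 / 2 * ∑ u, ∑ v, (1 - dl u v) * ψ s(u, v) := by
  have h1 : ∀ e ∈ Ed n, ∑ a, ∑ b, (if e = s(a, b) then ψ s(a, b) else 0) = 2 * ψ e := by
    intro e he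
    induction e with | _ u v =>
    have huv : u ≠ v := by simpa [Ed] using he
    rw [edge_sum huv (fun a b => ψ s(a, b)), Sym2.eq_swap (a := v)]; ring
  have h2 : ∑ e ∈ Ed n, 2 * ψ e = ∑ u, ∑ v, (1 - dl u v) * ψ s(u, v) := by
    rw [← Finset.sum_congr rfl h1, Finset.sum_comm]
    refine Finset.sum_congr rfl fun a _ => ?_
    rw [Finset.sum_comm]
    refine Finset.sum_congr rfl fun b _ => ?_
    rw [Finset.sum_ite_eq']
    by_cases hab : a = b <;> simp [Ed, dl, hab]
  rw [← Finset.mul_sum] at h2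
  linarith

lemma mx_XX {Ω : Finset (Sym2 (Fin n) → Bool)} {p B c : ℝ} (h : Good (Ed n) Ω p B c)
    {x : Sym2 (Fin n) → Bool} (hx : x ∈ Ω) : Mx (XX p x) c := by
  refine ⟨XX_symm p x, XX_self p x, ?_, ?_⟩
  · intro u v
    by_cases e : u = v
    · subst e; simp [XX_self, dl]
    · rw [XX_ne p x e, h.sq]; simp [dl, e]
  · have h0 := h.sum0 x hx
    rw [Ed_sum] at h0
    have : ∑ u, ∑ v, XX p x u v = ∑ u, ∑ v, (1 - dl u v) * chi p s(u, v) x := by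
      refine Finset.sum_congr rfl fun u _ => Finset.sum_congr rfl fun v _ => ?_
      by_cases e : u = v <;> simp [XX, dl, e]
    rw [this]; linarith

lemma ss_bd {k : ℕ} (hn : 2 ≤ n) {Ω : Finset (Sym2 (Fin n) → Bool)} {p B c : ℝ} (h : Good (Ed n) Ω p B c)
    (Γ : Finset (Sym2 (Fin k))) (hΓ : ∀ e ∈ Γ, ¬ e.IsDiag)
    (hcov : ∀ b : Fin k, ∃ e ∈ Γ, b ∈ e) :
    Ex Ω (fun x => SS p Γ x ^ 2) ≤ coreC B Γ.card k * (n : ℝ) ^ k := by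
  have := core_sq hn h Γ hΓ hcov Finset.univ
  rwa [Fintype.card_fin] at this

lemma PF_GP (p : ℝ) (x : Sym2 (Fin n) → Bool) : PF p (ind GP) x = 1 / 2 * SS p GP x := by
  have := ind_sum cov_GP (fun E : Finset (Sym2 (Fin n)) => mon p E x)
  rw [aut_GP] at this
  unfold SS PF
  rw [this]; push_cast; ring
lemma PF_GK (p : ℝ) (x : Sym2 (Fin n) → Bool) : PF p (ind GK) x = 1 / 6 * SS p GK x := by
  have := ind_sum cov_GK (fun E : Finset (Sym2 (Fin n)) => mon p E x)
  rw [aut_GK] at this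
  unfold SS PF
  rw [this]; push_cast; ring

lemma dmon_pair (p : ℝ) (x : Sym2 (Fin n) → Bool) (e : Sym2 (Fin n)) {f g : Sym2 (Fin n)} (h : f ≠ g) :
    dmon p e {f, g} x = (if e = f then chi p g x else 0) + (if e = g then chi p f x else 0) := by
  unfold dmon
  by_cases h1 : e = f
  · subst h1
    have : ({e, g} : Finset (Sym2 (Fin n))).erase e = {g} := by
      ext y; simp only [Finset.mem_erase, Finset.mem_insert, Finset.mem_singleton]; grind
    simp [this, mon, h]
  by_cases h2 : e = g
  · subst h2
    have : ({f, e} : Finset (Sym2 (Fin n))).erase e = {f} := by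
      ext y; simp only [Finset.mem_erase, Finset.mem_insert, Finset.mem_singleton]; grind
    simp [this, mon, h1]
  · simp [h1, h2]

lemma dmon_triple (p : ℝ) (x : Sym2 (Fin n) → Bool) (e : Sym2 (Fin n)) {f g k : Sym2 (Fin n)} (h : f ≠ g)
    (h' : f ≠ k) (h'' : g ≠ k) :
    dmon p e {f, g, k} x = (if e = f then chi p g x * chi p k x else 0) +
      (if e = g then chi p f x * chi p k x else 0) + (if e = k then chi p f x * chi p g x else 0) := by
  unfold dmon
  by_cases h1 : e = f
  · subst h1
    have : ({e, g, k} : Finset (Sym2 (Fin n))).erase e = {g, k} := by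
      ext y; simp only [Finset.mem_erase, Finset.mem_insert, Finset.mem_singleton]; grind
    simp [this, mon, h, h', Finset.prod_insert, h'']
  by_cases h2 : e = g
  · subst h2
    have : ({f, e, k} : Finset (Sym2 (Fin n))).erase e = {f, k} := by
      ext y; simp only [Finset.mem_erase, Finset.mem_insert, Finset.mem_singleton]; grind
    simp [this, mon, h1, h', Finset.prod_insert, h'']
  by_cases h3 : e = k
  · subst h3
    have : ({f, g, e} : Finset (Sym2 (Fin n))).erase e = {f, g} := by
      ext y; simp only [Finset.mem_erase, Finset.mem_insert, Finset.mem_singleton]; grind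
    simp [this, mon, h1, h2, h, Finset.prod_insert]
  · simp [h1, h2, h3]

lemma PL_GP (p : ℝ) (x : Sym2 (Fin n) → Bool) {u v : Fin n} (huv : u ≠ v) :
    PL p (ind GP) s(u, v) x = pp (XX p x) u v := by
  have h0 := ind_sum cov_GP (fun E : Finset (Sym2 (Fin n)) => dmon p s(u, v) E x)
  rw [aut_GP] at h0
  rw [emb_sum (fun g => dmon p s(u, v) (img GP g) x), fun3] at h0
  have h1 : ∀ a b d, (if Function.Injective ![a, b, d] then dmon p s(u, v) (img GP ![a, b, d]) x else 0) =
      (if s(u, v) = s(a, b) then (1 - dl b d) * XX p x a d else 0) +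
      (if s(u, v) = s(a, d) then (1 - dl d b) * XX p x a b else 0) := by
    intro a b d
    simp only [inj3]
    by_cases e1 : a = b
    · subst e1
      have : s(u, v) ≠ s(a, a) := by simp [Sym2.eq_iff]; grind
      simp [this, XX_self]
    by_cases e2 : a = d
    · subst e2
      have : s(u, v) ≠ s(a, a) := by simp [Sym2.eq_iff]; grind
      simp [this, XX_self]
    by_cases e3 : b = d
    · subst e3; simp [dl]
    have e4 : s(a, b) ≠ s(a, d) := by simp [Sym2.eq_iff]; grind
    rw [if_pos ⟨e1, e2, e3⟩, img_GP, dmon_pair p x _ e4, ← XX_ne p x e1, ← XX_ne p x e2]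
    simp [dl, e3, Ne.symm e3]
  simp_rw [h1, Finset.sum_add_distrib] at h0
  have h2 : ∑ a, ∑ b, ∑ d, (if s(u, v) = s(a, b) then (1 - dl b d) * XX p x a d else 0) = pp (XX p x) u v := by
    have : ∀ a b, ∑ d, (if s(u, v) = s(a, b) then (1 - dl b d) * XX p x a d else 0) =
      if s(u, v) = s(a, b) then DD (XX p x) a - XX p x a b else 0 := by
      intro a b
      split_ifs
      · rw [sum_dl1, DD]
      · simp
    simp_rw [this]
    rw [edge_sum huv (fun a b => DD (XX p x) a - XX p x a b), XX_symm p x v u, pp]; ring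
  have h3 : ∑ a, ∑ b, ∑ d, (if s(u, v) = s(a, d) then (1 - dl d b) * XX p x a b else 0) = pp (XX p x) u v := by
    rw [← h2]
    refine Finset.sum_congr rfl fun a _ => Finset.sum_comm
  rw [h2, h3] at h0
  unfold PL
  push_cast at h0
  linarith

lemma PL_GK (p : ℝ) (x : Sym2 (Fin n) → Bool) {u v : Fin n} (huv : u ≠ v) :
    PL p (ind GK) s(u, v) x = MM (XX p x) u v := by
  have h0 := ind_sum cov_GK (fun E : Finset (Sym2 (Fin n)) => dmon p s(u, v) E x)
  rw [aut_GK] at h0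
  rw [emb_sum (fun g => dmon p s(u, v) (img GK g) x), fun3] at h0
  have h1 : ∀ a b d, (if Function.Injective ![a, b, d] then dmon p s(u, v) (img GK ![a, b, d]) x else 0) =
      (if s(u, v) = s(a, b) then XX p x a d * XX p x b d else 0) +
      (if s(u, v) = s(a, d) then XX p x a b * XX p x d b else 0) +
      (if s(u, v) = s(b, d) then XX p x b a * XX p x d a else 0) := by
    intro a b d
    simp only [inj3]
    have hd : ∀ a, s(u, v) ≠ s(a, a) := by intro a; simp [Sym2.eq_iff]; grind
    by_cases e1 : a = b
    · subst e1
      simp [hd, XX_self]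
    by_cases e2 : a = d
    · subst e2
      simp [hd, XX_self]
    by_cases e3 : b = d
    · subst e3; simp [hd, XX_self]
    have e4 : s(a, b) ≠ s(a, d) := by simp [Sym2.eq_iff]; grind
    have e5 : s(a, b) ≠ s(b, d) := by simp [Sym2.eq_iff]; grind
    have e6 : s(a, d) ≠ s(b, d) := by simp [Sym2.eq_iff]; grind
    rw [if_pos ⟨e1, e2, e3⟩, img_GK, dmon_triple p x _ e4 e5 e6, ← XX_ne p x e1, ← XX_ne p x e2, ← XX_ne p x e3,
      XX_symm p x d b, XX_symm p x d a, XX_symm p x b a]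
  simp_rw [h1, Finset.sum_add_distrib] at h0
  have h2 : ∑ a, ∑ b, ∑ d, (if s(u, v) = s(a, b) then XX p x a d * XX p x b d else 0) = 2 * MM (XX p x) u v := by
    have : ∀ a b, ∑ d, (if s(u, v) = s(a, b) then XX p x a d * XX p x b d else 0) =
      if s(u, v) = s(a, b) then MM (XX p x) a b else 0 := by
      intro a b
      split_ifs
      · rw [MM]
      · simp
    simp_rw [this]
    rw [edge_sum huv (fun a b => MM (XX p x) a b), MM_symm _ v u]; ring
  have h3 : ∑ a, ∑ b, ∑ d, (if s(u, v) = s(a, d) then XX p x a b * XX p x d b else 0) = 2 * MM (XX p x) u v := by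
    rw [← h2]
    refine Finset.sum_congr rfl fun a _ => Finset.sum_comm
  have h4 : ∑ a, ∑ b, ∑ d, (if s(u, v) = s(b, d) then XX p x b a * XX p x d a else 0) = 2 * MM (XX p x) u v := by
    rw [← h3, Finset.sum_comm]
  rw [h2, h3, h4] at h0
  unfold PL
  push_cast at h0
  linarith

lemma deg_GP {u v : Fin n} (huv : u ≠ v) :
    ∑ E : Finset (Sym2 (Fin n)), (if s(u, v) ∈ E then ind GP E else 0) ≤ 2 * n := by
  have h0 := ind_sum cov_GP (fun E : Finset (Sym2 (Fin n)) => if s(u, v) ∈ E then (1 : ℝ) else 0)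
  rw [aut_GP] at h0
  rw [emb_sum (fun g => if s(u, v) ∈ img GP g then (1 : ℝ) else 0), fun3] at h0
  have h1 : ∀ a b d, (if Function.Injective ![a, b, d] then if s(u, v) ∈ img GP ![a, b, d] then (1 : ℝ) else 0 else 0) ≤
      (if s(u, v) = s(a, b) then 1 else 0) + (if s(u, v) = s(a, d) then 1 else 0) := by
    intro a b d
    rw [img_GP]
    simp only [Finset.mem_insert, Finset.mem_singleton]
    by_cases e1 : s(u, v) = s(a, b) <;> by_cases e2 : s(u, v) = s(a, d) <;> simp only [e1, e2, if_true, if_false, or_false, or_true, true_or, false_or] <;> split_ifs <;> norm_num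
  have h2 : ∑ a : Fin n, ∑ b : Fin n, ∑ d : Fin n, (if s(u, v) = s(a, b) then (1 : ℝ) else 0) = 2 * n := by
    have : ∀ a b, ∑ d : Fin n, (if s(u, v) = s(a, b) then (1 : ℝ) else 0) = if s(u, v) = s(a, b) then (n : ℝ) else 0 := by
      intro a b; split_ifs <;> simp
    simp_rw [this]
    rw [edge_sum huv (fun _ _ => (n : ℝ))]; ring
  have h3 : ∑ a : Fin n, ∑ b : Fin n, ∑ d : Fin n, (if s(u, v) = s(a, d) then (1 : ℝ) else 0) = 2 * n := by
    rw [← h2]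
    refine Finset.sum_congr rfl fun a _ => Finset.sum_comm
  have h4 := Finset.sum_le_sum fun a (_ : a ∈ Finset.univ) => Finset.sum_le_sum fun b (_ : b ∈ Finset.univ) =>
    Finset.sum_le_sum fun d (_ : d ∈ Finset.univ) => h1 a b d
  simp_rw [Finset.sum_add_distrib] at h4
  rw [h0, h2, h3] at h4
  have h5 : ∑ E : Finset (Sym2 (Fin n)), (if s(u, v) ∈ E then ind GP E else 0) =
      ∑ E : Finset (Sym2 (Fin n)), ind GP E * (if s(u, v) ∈ E then (1 : ℝ) else 0) := by simp
  rw [h5]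
  push_cast at h4
  linarith

lemma deg_GK {u v : Fin n} (huv : u ≠ v) :
    ∑ E : Finset (Sym2 (Fin n)), (if s(u, v) ∈ E then ind GK E else 0) ≤ n := by
  have h0 := ind_sum cov_GK (fun E : Finset (Sym2 (Fin n)) => if s(u, v) ∈ E then (1 : ℝ) else 0)
  rw [aut_GK] at h0
  rw [emb_sum (fun g => if s(u, v) ∈ img GK g then (1 : ℝ) else 0), fun3] at h0
  have h1 : ∀ a b d, (if Function.Injective ![a, b, d] then if s(u, v) ∈ img GK ![a, b, d] then (1 : ℝ) else 0 else 0) ≤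
      (if s(u, v) = s(a, b) then 1 else 0) + (if s(u, v) = s(a, d) then 1 else 0) +
      (if s(u, v) = s(b, d) then 1 else 0) := by
    intro a b d
    rw [img_GK]
    simp only [Finset.mem_insert, Finset.mem_singleton]
    by_cases e1 : s(u, v) = s(a, b) <;> by_cases e2 : s(u, v) = s(a, d) <;> by_cases e3 : s(u, v) = s(b, d) <;>
      simp only [e1, e2, e3, if_true, if_false, or_false, or_true, true_or, false_or] <;> split_ifs <;> norm_num
  have h2 : ∑ a : Fin n, ∑ b : Fin n, ∑ d : Fin n, (if s(u, v) = s(a, b) then (1 : ℝ) else 0) = 2 * n := by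
    have : ∀ a b, ∑ d : Fin n, (if s(u, v) = s(a, b) then (1 : ℝ) else 0) = if s(u, v) = s(a, b) then (n : ℝ) else 0 := by
      intro a b; split_ifs <;> simp
    simp_rw [this]
    rw [edge_sum huv (fun _ _ => (n : ℝ))]; ring
  have h3 : ∑ a : Fin n, ∑ b : Fin n, ∑ d : Fin n, (if s(u, v) = s(a, d) then (1 : ℝ) else 0) = 2 * n := by
    rw [← h2]
    refine Finset.sum_congr rfl fun a _ => Finset.sum_comm
  have h3' : ∑ a : Fin n, ∑ b : Fin n, ∑ d : Fin n, (if s(u, v) = s(b, d) then (1 : ℝ) else 0) = 2 * n := by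
    rw [← h3, Finset.sum_comm]
  have h4 := Finset.sum_le_sum fun a (_ : a ∈ Finset.univ) => Finset.sum_le_sum fun b (_ : b ∈ Finset.univ) =>
    Finset.sum_le_sum fun d (_ : d ∈ Finset.univ) => h1 a b d
  simp_rw [Finset.sum_add_distrib] at h4
  rw [h0, h2, h3, h3'] at h4
  have h5 : ∑ E : Finset (Sym2 (Fin n)), (if s(u, v) ∈ E then ind GK E else 0) =
      ∑ E : Finset (Sym2 (Fin n)), ind GK E * (if s(u, v) ∈ E then (1 : ℝ) else 0) := by simp
  rw [h5]
  push_cast at h4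
  linarith

end Conn
end GS

end


set_option linter.unusedSectionVars false
noncomputable section
namespace GS

section Inst
variable {n : ℕ} {Ω : Finset (Sym2 (Fin n) → Bool)} {p B c : ℝ}

lemma Ed_congr {φ ψ : Sym2 (Fin n) → ℝ} (hh : ∀ u v : Fin n, u ≠ v → φ s(u, v) = ψ s(u, v)) :
    ∑ e ∈ Ed n, φ e = ∑ e ∈ Ed n, ψ e := by
  refine Finset.sum_congr rfl fun e he => ?_
  induction e with | _ u v =>
  exact hh u v (by simpa [Ed] using he)

lemma dl_mul_congr {u v : Fin n} {x y : ℝ} (h : u ≠ v → x = y) : (1 - dl u v) * x = (1 - dl u v) * y := by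
  by_cases e : u = v
  · simp [dl, e]
  · rw [h e]

lemma qPP (h : Good (Ed n) Ω p B c) {x : Sym2 (Fin n) → Bool} (hx : x ∈ Ω) :
    ∑ e ∈ Ed n, PL p (ind GP) e x ^ 2 = ((n : ℝ) - 6) * SS p GP x + n * ((n : ℝ) - 1) * (n - 4) := by
  have hm := mx_XX h hx
  rw [Ed_sum, SS_GP, hm.SP]
  have := hm.QPP
  have h2 : ∑ u : Fin n, ∑ v : Fin n, (1 - dl u v) * PL p (ind GP) s(u, v) x ^ 2 =
    ∑ u, ∑ v, (1 - dl u v) * pp (XX p x) u v ^ 2 :=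
    Finset.sum_congr rfl fun u _ => Finset.sum_congr rfl fun v _ => dl_mul_congr fun e => by rw [PL_GP p x e]
  rw [h2, this]; ring

lemma qPK (h : Good (Ed n) Ω p B c) {x : Sym2 (Fin n) → Bool} (hx : x ∈ Ω) :
    ∑ e ∈ Ed n, PL p (ind GP) e x * PL p (ind GK) e x = SS p GP4 x + c * SS p GP x := by
  have hm := mx_XX h hx
  rw [Ed_sum, SS_GP, hm.SP, SS_GP4, hm.SP4]
  have := hm.QPK
  have h2 : ∑ u : Fin n, ∑ v : Fin n, (1 - dl u v) * (PL p (ind GP) s(u, v) x * PL p (ind GK) s(u, v) x) =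
    ∑ u, ∑ v, (1 - dl u v) * (pp (XX p x) u v * MM (XX p x) u v) :=
    Finset.sum_congr rfl fun u _ => Finset.sum_congr rfl fun v _ => dl_mul_congr fun e => by
      rw [PL_GP p x e, PL_GK p x e]
  rw [h2, this]; ring

lemma qKK (h : Good (Ed n) Ω p B c) {x : Sym2 (Fin n) → Bool} (hx : x ∈ Ω) :
    ∑ e ∈ Ed n, PL p (ind GK) e x ^ 2 = 1 / 2 * (SS p GC4 x + c ^ 2 * SS p GP x + n * ((n : ℝ) - 1) * (n - 2)) := by
  have hm := mx_XX h hx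
  rw [Ed_sum, SS_GP, hm.SP, SS_GC4, hm.SC4]
  have := hm.QKK
  have h2 : ∑ u : Fin n, ∑ v : Fin n, (1 - dl u v) * PL p (ind GK) s(u, v) x ^ 2 =
    ∑ u, ∑ v, (1 - dl u v) * MM (XX p x) u v ^ 2 :=
    Finset.sum_congr rfl fun u _ => Finset.sum_congr rfl fun v _ => dl_mul_congr fun e => by rw [PL_GK p x e]
  rw [h2, this]; ring

lemma qP1 (h : Good (Ed n) Ω p B c) {x : Sym2 (Fin n) → Bool} (hx : x ∈ Ω) :
    ∑ e ∈ Ed n, PL p (ind GP) e x = 0 := by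
  have hm := mx_XX h hx
  rw [Ed_sum]
  have := hm.QP1
  have h2 : ∑ u : Fin n, ∑ v : Fin n, (1 - dl u v) * PL p (ind GP) s(u, v) x =
    ∑ u, ∑ v, (1 - dl u v) * pp (XX p x) u v :=
    Finset.sum_congr rfl fun u _ => Finset.sum_congr rfl fun v _ => dl_mul_congr fun e => by rw [PL_GP p x e]
  rw [h2, this]; ring

lemma qK1 (h : Good (Ed n) Ω p B c) {x : Sym2 (Fin n) → Bool} (hx : x ∈ Ω) :
    ∑ e ∈ Ed n, PL p (ind GK) e x = 1 / 2 * SS p GP x := by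
  have hm := mx_XX h hx
  rw [Ed_sum, SS_GP, hm.SP]
  have := hm.QK1
  have h2 : ∑ u : Fin n, ∑ v : Fin n, (1 - dl u v) * PL p (ind GK) s(u, v) x =
    ∑ u, ∑ v, (1 - dl u v) * MM (XX p x) u v :=
    Finset.sum_congr rfl fun u _ => Finset.sum_congr rfl fun v _ => dl_mul_congr fun e => by rw [PL_GK p x e]
  rw [h2, this]

/-- Weight combining the two three-vertex graphs. -/
def wt (a b : ℝ) (E : Finset (Sym2 (Fin n))) : ℝ := a * ind GP E + b * ind GK E

lemma PL_wt (a b : ℝ) (e : Sym2 (Fin n)) (x : Sym2 (Fin n) → Bool) :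
    PL p (wt a b) e x = a * PL p (ind GP) e x + b * PL p (ind GK) e x := PL_lin p a b _ _ e x

lemma PF_wt (a b : ℝ) (x : Sym2 (Fin n) → Bool) :
    PF p (wt a b) x = a / 2 * SS p GP x + b / 6 * SS p GK x := by
  have := PF_lin p a b (ind GP) (ind GK) x
  rw [PF_GP, PF_GK] at this
  unfold wt
  rw [this]; ring

lemma eu_P (x : Sym2 (Fin n) → Bool) : ∑ e ∈ Ed n, chi p e x * PL p (ind GP) e x = SS p GP x := by
  rw [PL_euler p (Ed n) 2 (ind GP) (fun E hE => ind_sub nd_GP hE) (fun E hE => by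
    rw [ind_card hE]; simp [GP]; try decide), PF_GP]; ring
lemma eu_K (x : Sym2 (Fin n) → Bool) : ∑ e ∈ Ed n, chi p e x * PL p (ind GK) e x = 1 / 2 * SS p GK x := by
  rw [PL_euler p (Ed n) 3 (ind GK) (fun E hE => ind_sub nd_GK hE) (fun E hE => by
    rw [ind_card hE]; have : GK.card = 3 := by decide
    rw [this]; norm_num), PF_GK]; ring

lemma eu_wt (a b : ℝ) (x : Sym2 (Fin n) → Bool) : ∑ e ∈ Ed n, chi p e x * PL p (wt a b) e x =
    a * SS p GP x + b / 2 * SS p GK x := by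
  have : ∀ e : Sym2 (Fin n), chi p e x * PL p (wt a b) e x = a * (chi p e x * PL p (ind GP) e x) +
      b * (chi p e x * PL p (ind GK) e x) := by intro e; rw [PL_wt]; ring
  simp_rw [this]
  rw [Finset.sum_add_distrib, ← Finset.mul_sum, ← Finset.mul_sum, eu_P, eu_K]; ring

lemma one_wt (h : Good (Ed n) Ω p B c) {x : Sym2 (Fin n) → Bool} (hx : x ∈ Ω) (a b : ℝ) :
    ∑ e ∈ Ed n, PL p (wt a b) e x = b / 2 * SS p GP x := by
  simp_rw [PL_wt]
  rw [Finset.sum_add_distrib, ← Finset.mul_sum, ← Finset.mul_sum, qP1 h hx, qK1 h hx]; ring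

lemma bil_wt (h : Good (Ed n) Ω p B c) {x : Sym2 (Fin n) → Bool} (hx : x ∈ Ω) (a b a' b' : ℝ) :
    ∑ e ∈ Ed n, PL p (wt a b) e x * PL p (wt a' b') e x =
     a * a' * (((n : ℝ) - 6) * SS p GP x + n * ((n : ℝ) - 1) * (n - 4)) +
     (a * b' + a' * b) * (SS p GP4 x + c * SS p GP x) +
     b * b' * (1 / 2 * (SS p GC4 x + c ^ 2 * SS p GP x + n * ((n : ℝ) - 1) * (n - 2))) := by
  have : ∀ e : Sym2 (Fin n), PL p (wt a b) e x * PL p (wt a' b') e x =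
    a * a' * PL p (ind GP) e x ^ 2 + (a * b' + a' * b) * (PL p (ind GP) e x * PL p (ind GK) e x) +
    b * b' * PL p (ind GK) e x ^ 2 := by intro e; rw [PL_wt, PL_wt]; ring
  simp_rw [this]
  rw [Finset.sum_add_distrib, Finset.sum_add_distrib, ← Finset.mul_sum, ← Finset.mul_sum, ← Finset.mul_sum,
    qPP h hx, qPK h hx, qKK h hx]

lemma wt_card (a b : ℝ) (E : Finset (Sym2 (Fin n))) (h : wt a b E ≠ 0) : E.card ≤ 3 := by
  by_cases h1 : ind GP E ≠ 0
  · rw [ind_card h1]; decide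
  by_cases h2 : ind GK E ≠ 0
  · rw [ind_card h2]; decide
  push Not at h1 h2
  simp [wt, h1, h2] at h

lemma wt_deg (a b : ℝ) {u v : Fin n} (huv : u ≠ v) :
    ∑ E : Finset (Sym2 (Fin n)), (if s(u, v) ∈ E then |wt a b E| else 0) ≤ (2 * |a| + |b|) * n := by
  have h1 := deg_GP huv
  have h2 := deg_GK huv
  calc _ ≤ ∑ E : Finset (Sym2 (Fin n)), (|a| * (if s(u, v) ∈ E then ind GP E else 0) +
        |b| * (if s(u, v) ∈ E then ind GK E else 0)) := by
        refine Finset.sum_le_sum fun E _ => ?_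
        split_ifs
        · unfold wt
          refine (abs_add_le _ _).trans ?_
          rw [abs_mul, abs_mul, abs_of_nonneg (ind_nonneg _ _), abs_of_nonneg (ind_nonneg _ _)]
        · simp
    _ = |a| * ∑ E : Finset (Sym2 (Fin n)), (if s(u, v) ∈ E then ind GP E else 0) +
        |b| * ∑ E : Finset (Sym2 (Fin n)), (if s(u, v) ∈ E then ind GK E else 0) := by
        rw [Finset.sum_add_distrib, Finset.mul_sum, Finset.mul_sum]
    _ ≤ |a| * (2 * n) + |b| * n := by gcongr
    _ = _ := by ring

lemma cross_real {a b P K B c : ℝ} (hB : 1 ≤ B) (hc : |c| ≤ B) :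
    |(b / 3 / 2 * P + c * (a / 2 * P + b / 3 / 2 * K)) * (b / 2 * P) +
      b / 3 / 2 * P * (b / 2 * P + c * (a * P + b / 2 * K)) -
      2 * (a / 2 * P + b / 3 / 2 * K) * (a * P + b / 2 * K)| ≤ 6 * B * ((|a| + |b|) * (|P| + |K|)) ^ 2 := by
  obtain ⟨R, hR⟩ : ∃ R, R = (|a| + |b|) * (|P| + |K|) := ⟨_, rfl⟩
  rw [← hR]
  have m1 : |a * P| + |b * P| + |b * K| ≤ R := by
    rw [abs_mul, abs_mul, abs_mul, hR]
    have := mul_nonneg (abs_nonneg a) (abs_nonneg K)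
    linarith
  have R0 : 0 ≤ R := by rw [hR]; positivity
  have a1 : |b / 3 / 2 * P| ≤ R / 6 := by
    have : b / 3 / 2 * P = (b * P) / 6 := by ring
    rw [this, abs_div, abs_of_pos (by norm_num : (0:ℝ) < 6)]
    linarith [abs_nonneg (a * P), abs_nonneg (b * K)]
  have a2 : |b / 2 * P| ≤ R / 2 := by
    have : b / 2 * P = (b * P) / 2 := by ring
    rw [this, abs_div, abs_of_pos (by norm_num : (0:ℝ) < 2)]
    linarith [abs_nonneg (a * P), abs_nonneg (b * K)]
  have a3 : |a / 2 * P + b / 3 / 2 * K| ≤ R / 2 := by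
    have : a / 2 * P + b / 3 / 2 * K = (a * P) / 2 + (b * K) / 6 := by ring
    rw [this]
    refine (abs_add_le _ _).trans ?_
    rw [abs_div, abs_div, abs_of_pos (by norm_num : (0:ℝ) < 6), abs_of_pos (by norm_num : (0:ℝ) < 2)]
    linarith [abs_nonneg (a * P), abs_nonneg (b * K), abs_nonneg (b * P)]
  have a4 : |a * P + b / 2 * K| ≤ R := by
    have : a * P + b / 2 * K = (a * P) + (b * K) / 2 := by ring
    rw [this]
    refine (abs_add_le _ _).trans ?_
    rw [abs_div, abs_of_pos (by norm_num : (0:ℝ) < 2)]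
    linarith [abs_nonneg (a * P), abs_nonneg (b * K), abs_nonneg (b * P)]
  have b3 : |c * (a / 2 * P + b / 3 / 2 * K)| ≤ B * (R / 2) := by
    rw [abs_mul]; gcongr
  have b4 : |c * (a * P + b / 2 * K)| ≤ B * R := by
    rw [abs_mul]; gcongr
  have t1 : |(b / 3 / 2 * P + c * (a / 2 * P + b / 3 / 2 * K)) * (b / 2 * P)| ≤ (R / 6 + B * (R / 2)) * (R / 2) := by
    rw [abs_mul]
    exact mul_le_mul ((abs_add_le _ _).trans (add_le_add a1 b3)) a2 (abs_nonneg _) (by positivity)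
  have t2 : |(b / 3 / 2 * P) * (b / 2 * P + c * (a * P + b / 2 * K))| ≤ (R / 6) * (R / 2 + B * R) := by
    rw [abs_mul]
    exact mul_le_mul a1 ((abs_add_le _ _).trans (add_le_add a2 b4)) (abs_nonneg _) (by positivity)
  have t3 : |2 * (a / 2 * P + b / 3 / 2 * K) * (a * P + b / 2 * K)| ≤ 2 * (R / 2) * R := by
    rw [abs_mul, abs_mul, abs_of_pos (by norm_num : (0:ℝ) < 2)]
    exact mul_le_mul (by linarith) a4 (abs_nonneg _) (by positivity)
  refine (abs_sub _ _).trans ((add_le_add ((abs_add_le _ _).trans (add_le_add t1 t2)) t3).trans ?_)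
  have : 0 ≤ (B - 1) * R ^ 2 := mul_nonneg (by linarith) (sq_nonneg _)
  nlinarith [sq_nonneg R]

/-- The cross term. -/
lemma cross_wt (h : Good (Ed n) Ω p B c) {x : Sym2 (Fin n) → Bool} (hx : x ∈ Ω) (a b : ℝ) :
    |∑ e ∈ Ed n, ∑ f ∈ Ed n, (chi p e x - chi p f x) ^ 2 * (PL p (wt (a / 2) (b / 3)) e x * PL p (wt a b) f x)| ≤
      6 * B * ((|a| + |b|) * (|SS p GP x| + |SS p GK x|)) ^ 2 := by
  set G := fun e => PL p (wt (a / 2) (b / 3)) e x with hG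
  set L := fun e => PL p (wt a b) e x with hL
  have e1 : ∀ e f, (chi p e x - chi p f x) ^ 2 * (PL p (wt (a / 2) (b / 3)) e x * PL p (wt a b) f x) =
     (G e + c * (chi p e x * G e)) * L f + G e * (L f + c * (chi p f x * L f)) - 2 * (chi p e x * G e) * (chi p f x * L f) := by
    intro e f
    have s1 := h.sq e x
    have s2 := h.sq f x
    simp only [hG, hL]
    linear_combination (PL p (wt (a / 2) (b / 3)) e x * PL p (wt a b) f x) * (s1 + s2)
  have e2 : ∑ e ∈ Ed n, ∑ f ∈ Ed n, (chi p e x - chi p f x) ^ 2 * (PL p (wt (a / 2) (b / 3)) e x * PL p (wt a b) f x) =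
     (∑ e ∈ Ed n, G e + c * ∑ e ∈ Ed n, chi p e x * G e) * (∑ f ∈ Ed n, L f) +
     (∑ e ∈ Ed n, G e) * (∑ f ∈ Ed n, L f + c * ∑ f ∈ Ed n, chi p f x * L f) -
     2 * (∑ e ∈ Ed n, chi p e x * G e) * ∑ f ∈ Ed n, chi p f x * L f := by
    simp_rw [e1, Finset.sum_sub_distrib, Finset.sum_add_distrib, ← Finset.mul_sum, ← Finset.sum_mul,
      Finset.sum_add_distrib, ← Finset.mul_sum]
  rw [e2]
  have g1 : ∑ e ∈ Ed n, G e = b / 3 / 2 * SS p GP x := one_wt h hx _ _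
  have g2 : ∑ e ∈ Ed n, L e = b / 2 * SS p GP x := one_wt h hx _ _
  have g3 : ∑ e ∈ Ed n, chi p e x * G e = a / 2 * SS p GP x + b / 3 / 2 * SS p GK x := eu_wt _ _ _
  have g4 : ∑ e ∈ Ed n, chi p e x * L e = a * SS p GP x + b / 2 * SS p GK x := eu_wt _ _ _
  rw [g1, g2, g3, g4]
  exact cross_real h.hB h.hc

end Inst
end GS

end


set_option linter.unusedSectionVars false
noncomputable section
namespace GS

section Inst2
variable {n : ℕ} {Ω : Finset (Sym2 (Fin n) → Bool)} {p B c : ℝ}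

def KB (B : ℝ) : ℝ := 1 + coreC B 2 3 + coreC B 3 3 + coreC B 3 4 + coreC B 4 4

lemma KB_le {B : ℝ} (hB : 1 ≤ B) : 1 ≤ KB B ∧ coreC B 2 3 ≤ KB B ∧ coreC B 3 3 ≤ KB B ∧ coreC B 3 4 ≤ KB B ∧
    coreC B 4 4 ≤ KB B := by
  have h1 := coreC_nonneg hB 2 3
  have h2 := coreC_nonneg hB 3 3
  have h3 := coreC_nonneg hB 3 4
  have h4 := coreC_nonneg hB 4 4
  unfold KB
  refine ⟨?_, ?_, ?_, ?_, ?_⟩ <;> linarith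

lemma mom_bd (hn : 3 ≤ n) (h : Good (Ed n) Ω p B c) {s : ℝ} (hs : 0 ≤ s) (hsn : s ^ 2 = n) :
    Ex Ω (fun x => SS p GP x ^ 2) ≤ (KB B * s ^ 3) ^ 2 ∧ Ex Ω (fun x => SS p GK x ^ 2) ≤ (KB B * s ^ 3) ^ 2 ∧
    Ex Ω (fun x => SS p GP4 x ^ 2) ≤ (KB B * s ^ 4) ^ 2 ∧ Ex Ω (fun x => SS p GC4 x ^ 2) ≤ (KB B * s ^ 4) ^ 2 := by
  obtain ⟨k0, k1, k2, k3, k4⟩ := KB_le h.hB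
  have c1 : GP.card = 2 := by decide
  have c2 : GK.card = 3 := by decide
  have c3 : GP4.card = 3 := by decide
  have c4 : GC4.card = 4 := by decide
  have hK : KB B ≤ KB B ^ 2 := by nlinarith
  have e3 : (n : ℝ) ^ 3 = (s ^ 3) ^ 2 := by rw [← hsn]; ring
  have e4 : (n : ℝ) ^ 4 = (s ^ 4) ^ 2 := by rw [← hsn]; ring
  refine ⟨?_, ?_, ?_, ?_⟩
  · refine (ss_bd (by omega) h GP nd_GP cov_GP).trans ?_
    rw [c1, e3, mul_pow]; gcongr; linarith
  · refine (ss_bd (by omega) h GK nd_GK cov_GK).trans ?_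
    rw [c2, e3, mul_pow]; gcongr; linarith
  · refine (ss_bd (by omega) h GP4 nd_GP4 cov_GP4).trans ?_
    rw [c3, e4, mul_pow]; gcongr; linarith
  · refine (ss_bd (by omega) h GC4 nd_GC4 cov_GC4).trans ?_
    rw [c4, e4, mul_pow]; gcongr; linarith

lemma ab_bd (hn : 3 ≤ n) {a b s r : ℝ} (hs : 0 < s) (hsn : s ^ 2 = n) (hr : r * s = 1)
    (hab : a ^ 2 * (n * ((n : ℝ) - 1) * (n - 2)) / 2 + b ^ 2 * (n * ((n : ℝ) - 1) * (n - 2)) / 6 = 1) :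
    |a| ≤ 6 * r ^ 3 ∧ |b| ≤ 6 * r ^ 3 := by
  have hn' : (3 : ℝ) ≤ n := by exact_mod_cast hn
  have hr0 : 0 < r := by
    by_contra hh; push Not at hh
    nlinarith
  have ht : 2 / 9 * (n : ℝ) ^ 3 ≤ n * ((n : ℝ) - 1) * (n - 2) := by
    have : 0 ≤ (n : ℝ) * (((n : ℝ) - 3) * (7 * n - 6)) := by
      apply mul_nonneg (by linarith) (mul_nonneg (by linarith) (by linarith))
    nlinarith
  have e6 : (n : ℝ) ^ 3 * (r ^ 3) ^ 2 = 1 := by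
    rw [← hsn]
    calc _ = (r * s) ^ 6 := by ring
      _ = 1 := by rw [hr]; norm_num
  set τ := (n : ℝ) * ((n : ℝ) - 1) * (n - 2)
  have hτ : 2 / 9 ≤ τ * (r ^ 3) ^ 2 := by
    have := mul_le_mul_of_nonneg_right ht (sq_nonneg (r ^ 3))
    linarith
  have hτ0 : 0 < τ := by nlinarith [pow_pos (show (0:ℝ) < n by linarith) 3]
  have key : ∀ z : ℝ, z ^ 2 * τ ≤ 6 → |z| ≤ 6 * r ^ 3 := by
    intro z hz
    apply abs_le_of_sq_le_sq _ (by positivity)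
    by_contra hh; push Not at hh
    have := mul_lt_mul_of_pos_right hh hτ0
    nlinarith
  have p1 : 0 ≤ a ^ 2 * τ := by positivity
  have p2 : 0 ≤ b ^ 2 * τ := by positivity
  exact ⟨key a (by linarith), key b (by linarith)⟩

lemma wt_bL (h : Good (Ed n) Ω p B c) {a b s r : ℝ} (hs : 0 < s) (hsn : s ^ 2 = n) (hr : r * s = 1)
    (ha : |a| ≤ 6 * r ^ 3) (hb : |b| ≤ 6 * r ^ 3) {e : Sym2 (Fin n)} (he : e ∈ Ed n) (x : Sym2 (Fin n) → Bool) :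
    |PL p (wt a b) e x| ≤ 54 * B ^ 3 * r ∧ ∑ f ∈ Ed n, |PY p (wt a b) e f x| ≤ 54 * B ^ 3 * r := by
  have hB : 0 ≤ B := by linarith [h.hB]
  have hr0 : 0 < r := by
    by_contra hh; push Not at hh
    nlinarith
  have hd : ∑ E : Finset (Sym2 (Fin n)), (if e ∈ E then |wt a b E| else 0) ≤ 18 * r := by
    induction e with | _ u v =>
    have huv : u ≠ v := by simpa [Ed] using he
    refine (wt_deg a b huv).trans ?_
    calc (2 * |a| + |b|) * (n : ℝ) ≤ (2 * (6 * r ^ 3) + 6 * r ^ 3) * n := by gcongr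
      _ = 18 * r * (r * s) ^ 2 := by rw [← hsn]; ring
      _ = _ := by rw [hr]; ring
  constructor
  · refine (PL_bd h (wt a b) (wt_card a b) e x).trans ?_
    calc _ ≤ B ^ 3 * (18 * r) := by gcongr
      _ ≤ _ := by have : 0 ≤ B ^ 3 * r := by positivity
                  linarith
  · refine (PY_bd h (wt a b) (wt_card a b) e x).trans ?_
    calc _ ≤ ((3 : ℕ) : ℝ) * B ^ 3 * (18 * r) := by gcongr
      _ = _ := by push_cast; ring

lemma Ex_lin5 {X : Type*} (Ω : Finset X) (hΩ : Ω.Nonempty) (f1 f2 f3 : X → ℝ) (c0 c1 c2 c3 : ℝ) :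
    Ex Ω (fun x => c0 + c1 * f1 x + c2 * f2 x + c3 * f3 x) = c0 + c1 * Ex Ω f1 + c2 * Ex Ω f2 + c3 * Ex Ω f3 := by
  rw [Ex_add, Ex_add, Ex_add, Ex_const Ω hΩ, Ex_mul, Ex_mul, Ex_mul]

/-- Bound for expectation of the abs of bilinear forms. -/
lemma Ebd (hn : 3 ≤ n) (h : Good (Ed n) Ω p B c) {s : ℝ} (hs : 1 ≤ s) (hsn : s ^ 2 = n)
    {f : (Sym2 (Fin n) → Bool) → ℝ} {c0 c1 c2 c3 : ℝ} (h1 : 0 ≤ c1) (h2 : 0 ≤ c2) (h3 : 0 ≤ c3)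
    (hf : ∀ x ∈ Ω, f x ≤ c0 + c1 * |SS p GP x| + c2 * |SS p GP4 x| + c3 * |SS p GC4 x|) :
    Ex Ω f ≤ c0 + c1 * (KB B * s ^ 3) + c2 * (KB B * s ^ 4) + c3 * (KB B * s ^ 4) := by
  obtain ⟨m1, m2, m3, m4⟩ := mom_bd hn h (by linarith) hsn
  have k0 := (KB_le h.hB).1
  refine (Ex_mono Ω hf).trans ?_
  rw [Ex_lin5 Ω h.ne]
  have e1 := Ex_abs_le Ω h.ne (by positivity) m1
  have e3 := Ex_abs_le Ω h.ne (by positivity) m3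
  have e4 := Ex_abs_le Ω h.ne (by positivity) m4
  gcongr

lemma abs_n6 (hn : 3 ≤ n) : |(n : ℝ) - 6| ≤ n := by
  have hn' : (3 : ℝ) ≤ n := by exact_mod_cast hn
  rw [abs_le]; constructor <;> linarith

lemma q1_pt (hn : 3 ≤ n) (h : Good (Ed n) Ω p B c) {x : Sym2 (Fin n) → Bool} (hx : x ∈ Ω) {a b s r : ℝ}
    (hs : 0 < s) (hsn : s ^ 2 = n) (hr : r * s = 1)
    (ha : |a| ≤ 6 * r ^ 3) (hb : |b| ≤ 6 * r ^ 3)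
    (hab : a ^ 2 * (n * ((n : ℝ) - 1) * (n - 2)) / 2 + b ^ 2 * (n * ((n : ℝ) - 1) * (n - 2)) / 6 = 1) :
    |∑ e ∈ Ed n, PL p (wt (a / 2) (b / 3)) e x * PL p (wt a b) e x - 1| ≤
      36 * r ^ 6 * s ^ 4 + (36 * r ^ 6 * (s ^ 2 + B + B ^ 2)) * |SS p GP x| + (36 * r ^ 6) * |SS p GP4 x| +
       (36 * r ^ 6) * |SS p GC4 x| := by
  have hB := h.hB
  have hc := h.hc
  have hr0 : 0 < r := by
    by_contra hh; push Not at hh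
    nlinarith
  have hn' : (3 : ℝ) ≤ n := by exact_mod_cast hn
  have e : ∑ e ∈ Ed n, PL p (wt (a / 2) (b / 3)) e x * PL p (wt a b) e x - 1 =
      (a * a) * (-(n * ((n : ℝ) - 1))) + (a * a) * (((n : ℝ) - 6) * SS p GP x / 2) +
      (a * b) * ((SS p GP4 x + c * SS p GP x) * (5 / 6)) + (b * b) * ((SS p GC4 x + c ^ 2 * SS p GP x) / 6) := by
    rw [bil_wt h hx]
    linear_combination hab
  have key : ∀ y z w Q : ℝ, |y| ≤ 6 * r ^ 3 → |z| ≤ 6 * r ^ 3 → |w| ≤ Q → |y * z * w| ≤ 36 * r ^ 6 * Q := by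
    intro y z w Q hy hz hw
    rw [abs_mul, abs_mul]
    calc |y| * |z| * |w| ≤ (6 * r ^ 3) * (6 * r ^ 3) * Q := by gcongr
      _ = _ := by ring
  have hP := abs_nonneg (SS p GP x)
  have w1 : |(-(n * ((n : ℝ) - 1)))| ≤ s ^ 4 := by
    rw [abs_neg, abs_of_nonneg (mul_nonneg (by linarith) (by linarith))]
    have : s ^ 4 = (n : ℝ) ^ 2 := by rw [← hsn]; ring
    rw [this]; nlinarith
  have w2 : |((n : ℝ) - 6) * SS p GP x / 2| ≤ s ^ 2 * |SS p GP x| := by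
    rw [abs_div, abs_mul, abs_of_pos (by norm_num : (0:ℝ) < 2), hsn]
    have := mul_le_mul_of_nonneg_right (abs_n6 hn) hP
    have h4 : 0 ≤ |(n:ℝ) - 6| * |SS p GP x| := by positivity
    linarith
  have w3 : |(SS p GP4 x + c * SS p GP x) * (5 / 6)| ≤ |SS p GP4 x| + B * |SS p GP x| := by
    rw [abs_mul, abs_of_pos (by norm_num : (0:ℝ) < 5/6)]
    have t : |SS p GP4 x + c * SS p GP x| ≤ |SS p GP4 x| + B * |SS p GP x| := by
      refine (abs_add_le _ _).trans ?_
      rw [abs_mul]; gcongr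
    have := abs_nonneg (SS p GP4 x + c * SS p GP x)
    linarith
  have w4 : |(SS p GC4 x + c ^ 2 * SS p GP x) / 6| ≤ |SS p GC4 x| + B ^ 2 * |SS p GP x| := by
    rw [abs_div, abs_of_pos (by norm_num : (0:ℝ) < 6)]
    have t : |SS p GC4 x + c ^ 2 * SS p GP x| ≤ |SS p GC4 x| + B ^ 2 * |SS p GP x| := by
      refine (abs_add_le _ _).trans ?_
      rw [abs_mul, abs_pow]; gcongr
    have := abs_nonneg (SS p GC4 x + c ^ 2 * SS p GP x)
    linarith
  rw [e]
  refine (abs_add_le _ _).trans ((add_le_add ((abs_add_le _ _).trans (add_le_add ((abs_add_le _ _).trans (add_le_add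
    (key _ _ _ _ ha ha w1) (key _ _ _ _ ha ha w2))) (key _ _ _ _ ha hb w3))) (key _ _ _ _ hb hb w4)).trans ?_)
  apply le_of_eq; ring

lemma v_pt (hn : 3 ≤ n) (h : Good (Ed n) Ω p B c) {x : Sym2 (Fin n) → Bool} (hx : x ∈ Ω) {a b s r : ℝ}
    (hs : 0 < s) (hsn : s ^ 2 = n) (hr : r * s = 1)
    (ha : |a| ≤ 6 * r ^ 3) (hb : |b| ≤ 6 * r ^ 3) :
    ∑ e ∈ Ed n, PL p (wt a b) e x ^ 2 ≤
      72 * r ^ 6 * s ^ 6 + (36 * r ^ 6 * (s ^ 2 + 2 * B + B ^ 2)) * |SS p GP x| + (72 * r ^ 6) * |SS p GP4 x| +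
       (36 * r ^ 6) * |SS p GC4 x| := by
  have hB := h.hB
  have hc := h.hc
  have hr0 : 0 < r := by
    by_contra hh; push Not at hh
    nlinarith
  have hn' : (3 : ℝ) ≤ n := by exact_mod_cast hn
  have e : ∑ e ∈ Ed n, PL p (wt a b) e x ^ 2 =
      (a * a) * (((n : ℝ) - 6) * SS p GP x + n * ((n : ℝ) - 1) * (n - 4)) +
      (a * b) * ((SS p GP4 x + c * SS p GP x) * 2) +
      (b * b) * ((SS p GC4 x + c ^ 2 * SS p GP x + n * ((n : ℝ) - 1) * (n - 2)) / 2) := by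
    have := bil_wt h hx a b a b
    simp_rw [← sq] at this
    rw [this]; ring
  have key : ∀ y z w Q : ℝ, |y| ≤ 6 * r ^ 3 → |z| ≤ 6 * r ^ 3 → |w| ≤ Q → |y * z * w| ≤ 36 * r ^ 6 * Q := by
    intro y z w Q hy hz hw
    rw [abs_mul, abs_mul]
    calc |y| * |z| * |w| ≤ (6 * r ^ 3) * (6 * r ^ 3) * Q := by gcongr
      _ = _ := by ring
  have hP := abs_nonneg (SS p GP x)
  have hs6 : s ^ 6 = (n : ℝ) ^ 3 := by rw [← hsn]; ring
  have nn1 : |n * ((n : ℝ) - 1) * (n - 4)| ≤ s ^ 6 := by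
    rw [hs6, abs_mul, abs_of_nonneg (mul_nonneg (by linarith : (0:ℝ) ≤ n) (by linarith : (0:ℝ) ≤ (n:ℝ) - 1))]
    have : |(n : ℝ) - 4| ≤ n := by rw [abs_le]; constructor <;> linarith
    calc (n : ℝ) * (n - 1) * |(n : ℝ) - 4| ≤ n * n * n := by
          gcongr
          linarith
      _ = _ := by ring
  have nn2 : |n * ((n : ℝ) - 1) * (n - 2)| ≤ s ^ 6 := by
    rw [hs6, abs_mul, abs_of_nonneg (mul_nonneg (by linarith : (0:ℝ) ≤ n) (by linarith : (0:ℝ) ≤ (n:ℝ) - 1))]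
    have : |(n : ℝ) - 2| ≤ n := by rw [abs_le]; constructor <;> linarith
    calc (n : ℝ) * (n - 1) * |(n : ℝ) - 2| ≤ n * n * n := by
          gcongr
          linarith
      _ = _ := by ring
  have w2 : |((n : ℝ) - 6) * SS p GP x + n * ((n : ℝ) - 1) * (n - 4)| ≤ s ^ 2 * |SS p GP x| + s ^ 6 := by
    refine (abs_add_le _ _).trans (add_le_add ?_ nn1)
    rw [abs_mul, hsn]
    exact mul_le_mul_of_nonneg_right (abs_n6 hn) hP
  have w3 : |(SS p GP4 x + c * SS p GP x) * 2| ≤ 2 * |SS p GP4 x| + 2 * B * |SS p GP x| := by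
    rw [abs_mul, abs_of_pos (by norm_num : (0:ℝ) < 2)]
    have t : |SS p GP4 x + c * SS p GP x| ≤ |SS p GP4 x| + B * |SS p GP x| := by
      refine (abs_add_le _ _).trans ?_
      rw [abs_mul]; gcongr
    linarith
  have w4 : |(SS p GC4 x + c ^ 2 * SS p GP x + n * ((n : ℝ) - 1) * (n - 2)) / 2| ≤
      |SS p GC4 x| + B ^ 2 * |SS p GP x| + s ^ 6 := by
    rw [abs_div, abs_of_pos (by norm_num : (0:ℝ) < 2)]
    have t : |SS p GC4 x + c ^ 2 * SS p GP x + n * ((n : ℝ) - 1) * (n - 2)| ≤ |SS p GC4 x| + B ^ 2 * |SS p GP x| + s ^ 6 := by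
      refine (abs_add_le _ _).trans (add_le_add ((abs_add_le _ _).trans ?_) nn2)
      rw [abs_mul, abs_pow]; gcongr
    have := abs_nonneg (SS p GC4 x + c ^ 2 * SS p GP x + n * ((n : ℝ) - 1) * (n - 2))
    linarith
  rw [e]
  refine (le_abs_self _).trans ((abs_add_le _ _).trans ((add_le_add ((abs_add_le _ _).trans (add_le_add
    (key _ _ _ _ ha ha w2) (key _ _ _ _ ha hb w3))) (key _ _ _ _ hb hb w4)).trans ?_))
  apply le_of_eq; ring

end Inst2
end GS

end


set_option linter.unusedSectionVars false
noncomputable section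
namespace GS

section Inst3
variable {n : ℕ} {Ω : Finset (Sym2 (Fin n) → Bool)} {p B c : ℝ}

lemma q1_E (hn : 3 ≤ n) (h : Good (Ed n) Ω p B c) {a b s r : ℝ}
    (hs : 1 ≤ s) (hsn : s ^ 2 = n) (hr : r * s = 1) (hr0 : 0 < r) (hr1 : r ≤ 1)
    (ha : |a| ≤ 6 * r ^ 3) (hb : |b| ≤ 6 * r ^ 3)
    (hab : a ^ 2 * (n * ((n : ℝ) - 1) * (n - 2)) / 2 + b ^ 2 * (n * ((n : ℝ) - 1) * (n - 2)) / 6 = 1) :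
    Ex Ω (fun x => |∑ e ∈ Ed n, PL p (wt (a / 2) (b / 3)) e x * PL p (wt a b) e x - 1|) ≤ 216 * B ^ 2 * KB B * r := by
  have hB := h.hB
  have k0 := (KB_le hB).1
  refine (Ebd hn h hs hsn (by positivity) (by positivity) (by positivity)
    (fun x hx => q1_pt hn h hx (by linarith) hsn hr ha hb hab)).trans ?_
  set K := KB B
  have e1 : 36 * r ^ 6 * s ^ 4 + 36 * r ^ 6 * (s ^ 2 + B + B ^ 2) * (K * s ^ 3) + 36 * r ^ 6 * (K * s ^ 4) +
      36 * r ^ 6 * (K * s ^ 4) = 36 * r * (r * (r * s) ^ 4 + K * (r * s) ^ 5 + K * (B + B ^ 2) * r ^ 2 * (r * s) ^ 3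
        + 2 * K * r * (r * s) ^ 4) := by ring
  rw [e1, hr]
  have h1 : 1 ≤ B ^ 2 := by nlinarith
  have h2 : B ≤ B ^ 2 := by nlinarith
  have hr2 : r ^ 2 ≤ 1 := by nlinarith
  have h3 : K * (B + B ^ 2) * r ^ 2 ≤ K * (B ^ 2 + B ^ 2) * 1 := by gcongr
  have h4 : K * 1 ≤ K * B ^ 2 := by gcongr
  have h5 : 2 * K * r ≤ 2 * K * 1 := by gcongr
  calc _ ≤ 36 * r * (6 * (K * B ^ 2)) := by
        gcongr; nlinarith
    _ = _ := by ring

lemma v_E (hn : 3 ≤ n) (h : Good (Ed n) Ω p B c) {a b s r : ℝ}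
    (hs : 1 ≤ s) (hsn : s ^ 2 = n) (hr : r * s = 1) (hr0 : 0 < r) (hr1 : r ≤ 1)
    (ha : |a| ≤ 6 * r ^ 3) (hb : |b| ≤ 6 * r ^ 3) :
    Ex Ω (fun x => ∑ e ∈ Ed n, PL p (wt a b) e x ^ 2) ≤ 324 * B ^ 2 * KB B := by
  have hB := h.hB
  have k0 := (KB_le hB).1
  refine (Ebd hn h hs hsn (by positivity) (by positivity) (by positivity)
    (fun x hx => v_pt hn h hx (by linarith) hsn hr ha hb)).trans ?_
  set K := KB B
  have e1 : 72 * r ^ 6 * s ^ 6 + 36 * r ^ 6 * (s ^ 2 + 2 * B + B ^ 2) * (K * s ^ 3) + 72 * r ^ 6 * (K * s ^ 4) +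
      36 * r ^ 6 * (K * s ^ 4) = 72 * (r * s) ^ 6 + 36 * K * (r * (r * s) ^ 5) + 36 * (K * (2 * B + B ^ 2) * r ^ 3) * (r * s) ^ 3
        + 108 * (K * r ^ 2) * (r * s) ^ 4 := by ring
  rw [e1, hr]
  have h1 : 1 ≤ B ^ 2 := by nlinarith
  have h2 : B ≤ B ^ 2 := by nlinarith
  have hr2 : r ^ 2 ≤ 1 := by nlinarith
  have hr3 : r ^ 3 ≤ 1 := pow_le_one₀ hr0.le hr1
  have h3 : K * (2 * B + B ^ 2) * r ^ 3 ≤ K * (2 * B ^ 2 + B ^ 2) * 1 := by gcongr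
  have h4 : K * 1 ≤ K * B ^ 2 := by gcongr
  have h5 : K * r ≤ K * 1 := by gcongr
  have h6 : K * r ^ 2 ≤ K * 1 := by gcongr
  nlinarith

lemma q2_E (hn : 3 ≤ n) (h : Good (Ed n) Ω p B c) {a b s r : ℝ}
    (hs : 1 ≤ s) (hsn : s ^ 2 = n) (hr : r * s = 1) (hr0 : 0 < r) (hr1 : r ≤ 1)
    (ha : |a| ≤ 6 * r ^ 3) (hb : |b| ≤ 6 * r ^ 3) :
    Ex Ω (fun x => |1 / (2 * ((Ed n).card : ℝ)) * ∑ e ∈ Ed n, ∑ f ∈ Ed n, (chi p e x - chi p f x) ^ 2 *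
      (PL p (wt (a / 2) (b / 3)) e x * PL p (wt a b) f x)|) ≤ 3456 * B * KB B ^ 2 * r := by
  have hB := h.hB
  have k0 := (KB_le hB).1
  have hn' : (3 : ℝ) ≤ n := by exact_mod_cast hn
  obtain ⟨m1, m2, m3, m4⟩ := mom_bd hn h (by linarith) hsn
  have hN : 2 * ((Ed n).card : ℝ) = n * (n - 1) := by rw [card_Ed, Nat.cast_choose_two]; ring
  rw [hN]
  have hNr : 1 / ((n : ℝ) * (n - 1)) ≤ r := by
    rw [div_le_iff₀ (mul_pos (by linarith) (by linarith))]
    have : r * (n : ℝ) = s := by rw [← hsn]; linear_combination s * hr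
    calc (1 : ℝ) ≤ s * 1 := by linarith
      _ ≤ s * (n - 1) := by gcongr; linarith
      _ = _ := by rw [← this]; ring
  have hN0 : 0 ≤ 1 / ((n : ℝ) * (n - 1)) := by
    apply div_nonneg zero_le_one (mul_nonneg _ _) <;> linarith
  have pt : ∀ x ∈ Ω, |1 / ((n : ℝ) * (n - 1)) * ∑ e ∈ Ed n, ∑ f ∈ Ed n, (chi p e x - chi p f x) ^ 2 *
      (PL p (wt (a / 2) (b / 3)) e x * PL p (wt a b) f x)| ≤
      (r * (6 * B * (144 * r ^ 6 * 2))) * (SS p GP x ^ 2 + SS p GK x ^ 2) := by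
    intro x hx
    rw [abs_mul, abs_of_nonneg hN0]
    have hc := cross_wt h hx a b
    have hR : ((|a| + |b|) * (|SS p GP x| + |SS p GK x|)) ^ 2 ≤
        144 * r ^ 6 * (2 * (SS p GP x ^ 2 + SS p GK x ^ 2)) := by
      rw [mul_pow]
      have i1 : (|a| + |b|) ^ 2 ≤ 144 * r ^ 6 := by
        calc (|a| + |b|) ^ 2 ≤ (6 * r ^ 3 + 6 * r ^ 3) ^ 2 := by gcongr
          _ = _ := by ring
      have i2 : (|SS p GP x| + |SS p GK x|) ^ 2 ≤ 2 * (SS p GP x ^ 2 + SS p GK x ^ 2) := by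
        rw [← sq_abs (SS p GP x), ← sq_abs (SS p GK x)]
        nlinarith [sq_nonneg (|SS p GP x| - |SS p GK x|)]
      gcongr
    calc _ ≤ r * (6 * B * (144 * r ^ 6 * (2 * (SS p GP x ^ 2 + SS p GK x ^ 2)))) := by
          gcongr
          refine hc.trans ?_
          gcongr
      _ = _ := by ring
  refine (Ex_mono Ω pt).trans ?_
  rw [Ex_mul, Ex_add]
  calc _ ≤ (r * (6 * B * (144 * r ^ 6 * 2))) * ((KB B * s ^ 3) ^ 2 + (KB B * s ^ 3) ^ 2) := by gcongr
    _ = 3456 * B * KB B ^ 2 * r * (r * s) ^ 6 := by ring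
    _ = _ := by rw [hr]; ring

def C3 (B : ℝ) : ℝ := 3 * (200 * B ^ 5 * (1 + (54 * B ^ 3) ^ 2) * (1 + 324 * B ^ 2 * KB B) *
  (54 * B ^ 3 + 3456 * B ^ 2 * KB B ^ 2))

lemma C3_nonneg {B : ℝ} (hB : 1 ≤ B) : 0 ≤ C3 B := by
  have k0 := (KB_le hB).1
  unfold C3; positivity

theorem main3 (hn : 3 ≤ n) (h : Good (Ed n) Ω p B c) {a b : ℝ}
    (hab : a ^ 2 * (n * ((n : ℝ) - 1) * (n - 2)) / 2 + b ^ 2 * (n * ((n : ℝ) - 1) * (n - 2)) / 6 = 1) (t : ℝ) :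
    ‖Ex Ω (fun x => cis t (PF p (wt a b) x)) - (Real.exp (-(t ^ 2) / 2) : ℝ)‖ ≤ C3 B * |t| * (1 / Real.sqrt n) := by
  have hB := h.hB
  have k0 := (KB_le hB).1
  have hn' : (3 : ℝ) ≤ n := by exact_mod_cast hn
  obtain ⟨s, hsd⟩ : ∃ s, s = Real.sqrt n := ⟨_, rfl⟩
  rw [← hsd]
  have hs : 1 ≤ s := by rw [hsd]; exact Real.one_le_sqrt.2 (by linarith)
  have hsn : s ^ 2 = n := by rw [hsd]; exact Real.sq_sqrt (by linarith)
  obtain ⟨r, hrd⟩ : ∃ r, r = 1 / s := ⟨_, rfl⟩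
  rw [← hrd]
  have hr : r * s = 1 := by rw [hrd]; field_simp
  have hr0 : 0 < r := by rw [hrd]; positivity
  have hr1 : r ≤ 1 := by nlinarith
  obtain ⟨ha, hb⟩ := ab_bd hn (by linarith) hsn hr hab
  have ha' : |a / 2| ≤ 6 * r ^ 3 := by
    rw [abs_div, abs_of_pos (by norm_num : (0:ℝ) < 2)]; linarith [abs_nonneg a]
  have hb' : |b / 3| ≤ 6 * r ^ 3 := by
    rw [abs_div, abs_of_pos (by norm_num : (0:ℝ) < 3)]; linarith [abs_nonneg b]
  have hst : Stein (Ed n) Ω p (PF p (wt a b)) (PL p (wt (a / 2) (b / 3))) (PL p (wt a b)) (PY p (wt a b))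
      (PY p (wt (a / 2) (b / 3))) (54 * B ^ 3 * r) (324 * B ^ 2 * KB B) (3456 * B ^ 2 * KB B ^ 2 * r) := by
    refine ⟨?_, ?_, ?_, ?_, by positivity, by positivity, ?_, ?_, ?_, ?_, ?_, ?_, ?_, ?_⟩
    · intro x _
      rw [eu_wt, PF_wt]; ring
    · intro e _ f _ x _; exact PF_diff p _ e f x
    · intro e _ f _ x _; exact PL_diff p _ e f x
    · intro e _ f _ x _; exact PL_diff p _ e f x
    · intro e he x _; exact (wt_bL h (by linarith) hsn hr ha' hb' he x).1
    · intro e he x _; exact (wt_bL h (by linarith) hsn hr ha hb he x).1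
    · intro e he x _; exact (wt_bL h (by linarith) hsn hr ha hb he x).2
    · intro e he x _; exact (wt_bL h (by linarith) hsn hr ha' hb' he x).2
    · exact v_E hn h hs hsn hr hr0 hr1 ha hb
    · exact v_E hn h hs hsn hr hr0 hr1 ha' hb'
    · refine (q1_E hn h hs hsn hr hr0 hr1 ha hb hab).trans ?_
      have : KB B ≤ KB B ^ 2 := by nlinarith
      gcongr; norm_num
    · refine (q2_E hn h hs hsn hr hr0 hr1 ha hb).trans ?_
      have : B ≤ B ^ 2 := by nlinarith
      gcongr
  refine (Ex_ode Ω h.ne _ (fun t => hst.final h t) t).trans ?_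
  have hd : (54 * B ^ 3 * r) ^ 2 ≤ (54 * B ^ 3) ^ 2 := by
    have : 54 * B ^ 3 * r ≤ 54 * B ^ 3 * 1 := by gcongr
    rw [mul_one] at this
    exact pow_le_pow_left₀ (by positivity) this 2
  calc _ ≤ 3 * (200 * B ^ 5 * (1 + (54 * B ^ 3) ^ 2) * (1 + 324 * B ^ 2 * KB B) *
        (54 * B ^ 3 * r + 3456 * B ^ 2 * KB B ^ 2 * r)) * |t| := by gcongr
    _ = _ := by unfold C3; ring

end Inst3
end GS

end


set_option linter.unusedSectionVars false
noncomputable section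
namespace GS

section Rep

lemma perm_ext {k N : ℕ} (x y : Fin k ↪ Fin N) : ∃ π : Equiv.Perm (Fin N), ∀ i, π (x i) = y i := by
  haveI := Equiv.Perm.isMultiplyPretransitive (Fin N) k
  obtain ⟨g, hg⟩ := MulAction.exists_smul_eq (Equiv.Perm (Fin N)) x y
  exact ⟨g, fun i => by rw [← hg]; rfl⟩

def Rep {ℓ k : ℕ} (H : SimpleGraph (Fin ℓ)) (Γ : Finset (Sym2 (Fin k))) : Prop :=
  ∃ ι : Fin k ↪ Fin ℓ, H.edgeSet = Sym2.map ι '' (Γ : Set (Sym2 (Fin k)))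

variable {ℓ k n : ℕ} {H : SimpleGraph (Fin ℓ)}

lemma rep_exists (h : Nat.card H.support = k) :
    ∃ Γ : Finset (Sym2 (Fin k)), (∀ e ∈ Γ, ¬ e.IsDiag) ∧ (∀ b : Fin k, ∃ e ∈ Γ, b ∈ e) ∧ Rep H Γ := by
  classical
  have ε : H.support ≃ Fin k := Finite.equivFinOfCardEq h
  set ι : Fin k ↪ Fin ℓ := ε.symm.toEmbedding.trans (Function.Embedding.subtype _) with hι
  have hι1 : ∀ i, ι i ∈ H.support := fun i => (ε.symm i).2
  have hι2 : ∀ v ∈ H.support, ∃ i, ι i = v := fun v hv => ⟨ε ⟨v, hv⟩, by simp [hι]⟩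
  refine ⟨Finset.univ.filter fun e => Sym2.map ι e ∈ H.edgeSet, ?_, ?_, ι, ?_⟩
  · intro e he hd
    simp only [Finset.mem_filter, Finset.mem_univ, true_and] at he
    induction e with | _ u v =>
    simp only [Sym2.isDiag_iff_proj_eq] at hd
    subst hd
    simp at he
  · intro b
    obtain ⟨w, hw⟩ := (H.mem_support).1 (hι1 b)
    obtain ⟨c, rfl⟩ := hι2 w ((H.mem_support).2 ⟨_, hw.symm⟩)
    exact ⟨s(b, c), by simpa using hw, by simp⟩
  · ext e
    constructor
    · intro he
      induction e with | _ u v =>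
      have huv : H.Adj u v := he
      obtain ⟨i, rfl⟩ := hι2 u ((H.mem_support).2 ⟨_, huv⟩)
      obtain ⟨j, rfl⟩ := hι2 v ((H.mem_support).2 ⟨_, huv.symm⟩)
      exact ⟨s(i, j), by simpa using huv, by simp⟩
    · rintro ⟨e', he', rfl⟩
      simpa using he'

lemma rep_perm {Γ : Finset (Sym2 (Fin k))} (h : Rep H Γ) (π : Equiv.Perm (Fin k)) :
    Rep H (Γ.image (Sym2.map π)) := by
  obtain ⟨ι, hι⟩ := h
  refine ⟨π.symm.toEmbedding.trans ι, ?_⟩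
  rw [hι, Finset.coe_image, Set.image_image]
  refine Set.image_congr fun e _ => ?_
  rw [Sym2.map_map]
  congr 1
  funext i; simp

lemma rep_iso {H' : SimpleGraph (Fin ℓ)} {Γ : Finset (Sym2 (Fin k))} (h : Rep H Γ) (h' : Rep H' Γ) :
    Nonempty (H ≃g H') := by
  obtain ⟨ι, hι⟩ := h
  obtain ⟨ι', hι'⟩ := h'
  obtain ⟨π, hπ⟩ := perm_ext ι ι'
  have e : H'.edgeSet = Sym2.map π '' H.edgeSet := by
    rw [hι, hι', Set.image_image]
    refine Set.image_congr fun e _ => ?_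
    rw [Sym2.map_map]
    congr 1
    funext i; simp [hπ]
  refine ⟨⟨π, ?_⟩⟩
  intro a b
  rw [← SimpleGraph.mem_edgeSet, ← SimpleGraph.mem_edgeSet, e, ← Sym2.map_mk]
  exact (Sym2.map.injective π.injective).mem_set_image

lemma rep_gf {Γ : Finset (Sym2 (Fin k))} (h : Rep H Γ) (hn : ℓ ≤ n) (p : ℝ) (x : Sym2 (Fin n) → Bool) :
    graphFactor H p x = PF p (ind Γ) x := by
  obtain ⟨ι, hι⟩ := h
  unfold graphFactor PF
  refine Finset.sum_congr rfl fun E _ => ?_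
  have key : (∃ f : Fin ℓ ↪ Fin n, (↑E : Set (Sym2 (Fin n))) = Sym2.map f '' H.edgeSet) ↔
      ∃ g : Fin k ↪ Fin n, E = img Γ g := by
    constructor
    · rintro ⟨f, hf⟩
      refine ⟨ι.trans f, ?_⟩
      rw [← Finset.coe_inj, hf, hι, img, Finset.coe_image, Set.image_image]
      refine Set.image_congr fun e _ => ?_
      rw [Sym2.map_map]; rfl
    · rintro ⟨g, rfl⟩
      obtain ⟨π, hπ⟩ := perm_ext (ι.trans (Fin.castLEEmb hn)) g
      refine ⟨(Fin.castLEEmb hn).trans π.toEmbedding, ?_⟩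
      rw [hι, img, Finset.coe_image, Set.image_image]
      refine Set.image_congr fun e _ => ?_
      rw [Sym2.map_map]
      congr 1
      funext i; simp [← hπ]
  unfold ind
  by_cases hc : ∃ g : Fin k ↪ Fin n, E = img Γ g
  · rw [if_pos (key.2 hc), if_pos hc, one_mul]; rfl
  · rw [if_neg (fun h => hc (key.1 h)), if_neg hc, zero_mul]

lemma gf_zero (hn : n < ℓ) (p : ℝ) (x : Sym2 (Fin n) → Bool) : graphFactor H p x = 0 := by
  unfold graphFactor
  refine Finset.sum_eq_zero fun E _ => if_neg ?_
  rintro ⟨f, _⟩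
  have := Fintype.card_le_of_embedding f
  simp at this; omega

set_option maxRecDepth 100000 in
lemma cls3 : ∀ Γ : Finset (Sym2 (Fin 3)), (∀ e ∈ Γ, ¬ e.IsDiag) → (∀ b : Fin 3, ∃ e ∈ Γ, b ∈ e) →
    ∃ π : Equiv.Perm (Fin 3), Γ.image (Sym2.map π) = GP ∨ Γ.image (Sym2.map π) = GK := by
  decide

lemma rep3 (h : Nat.card H.support = 3) : Rep H GP ∨ Rep H GK := by
  obtain ⟨Γ, h1, h2, h3⟩ := rep_exists h
  obtain ⟨π, hπ⟩ := cls3 Γ h1 h2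
  rcases hπ with hπ | hπ
  · left; rw [← hπ]; exact rep_perm h3 π
  · right; rw [← hπ]; exact rep_perm h3 π

lemma card_ne_one : Nat.card H.support ≠ 1 := by
  intro h
  obtain ⟨Γ, h1, h2, -⟩ := rep_exists h
  obtain ⟨e, he, -⟩ := h2 0
  apply h1 e he
  induction e with | _ u v =>
  simp only [Sym2.isDiag_iff_proj_eq]
  exact Subsingleton.elim _ _

lemma gf_sq {Ω : Finset (Sym2 (Fin n) → Bool)} {p B c : ℝ} (hn2 : 2 ≤ n) (hn : ℓ ≤ n) (h : Good (Ed n) Ω p B c)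
    (hk : Nat.card H.support = k) :
    ∃ Γ : Finset (Sym2 (Fin k)), Ex Ω (fun x => graphFactor H p x ^ 2) ≤ coreC B Γ.card k * (n : ℝ) ^ k := by
  obtain ⟨Γ, h1, h2, h3⟩ := rep_exists hk
  refine ⟨Γ, ?_⟩
  refine (Ex_mono Ω ?_).trans (ss_bd hn2 h Γ h1 h2)
  intro x _
  rw [rep_gf h3 hn]
  have := ind_sum h2 (fun E : Finset (Sym2 (Fin n)) => mon p E x)
  have e : SS p Γ x = aut Γ * PF p (ind Γ) x := this
  rw [e, mul_pow]
  have ha : (1 : ℝ) ≤ aut Γ := by exact_mod_cast aut_pos Γ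
  have : (1 : ℝ) ≤ (aut Γ : ℝ) ^ 2 := one_le_pow₀ ha
  nlinarith [sq_nonneg (PF p (ind Γ) x)]

end Rep
end GS

end


set_option linter.unusedSectionVars false
noncomputable section
namespace GS

section Bern
variable {α : Type*} [Fintype α] [DecidableEq α]

def Pw (p : ℝ) (x : α → Bool) : ℝ := ∏ i, (if x i then p else 1 - p)

lemma int_bern {p : ℝ} (hp0 : 0 ≤ p) (hp1 : p ≤ 1) (g : (α → Bool) → ℝ) :
    ∫ x, g x ∂(bernoulliPi α p) = ∑ x, Pw p x * g x := by
  unfold bernoulliPi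
  have hne : ∀ x : α → Bool, (∏ i : α, ENNReal.ofReal (if x i then p else 1 - p)) ≠ ∞ := by
    intro x
    exact ENNReal.prod_ne_top fun i _ => ENNReal.ofReal_ne_top
  rw [integral_finsetSum_measure]
  · refine Finset.sum_congr rfl fun x _ => ?_
    rw [integral_smul_measure, integral_dirac, ENNReal.toReal_prod, smul_eq_mul]
    congr 1
    refine Finset.prod_congr rfl fun i _ => ?_
    rw [ENNReal.toReal_ofReal]
    split_ifs <;> linarith
  · intro x _
    exact Integrable.smul_measure (integrable_dirac (by simp)) (hne x)

lemma sum_Pw (p : ℝ) (h : α → Bool → ℝ) :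
    ∑ x : α → Bool, Pw p x * ∏ i, h i (x i) = ∏ i, (p * h i true + (1 - p) * h i false) := by
  have : ∀ i, p * h i true + (1 - p) * h i false = ∑ b : Bool, (if b then p else 1 - p) * h i b := by
    intro i; simp
  simp_rw [this]
  rw [Finset.prod_univ_sum, Fintype.piFinset_univ]
  refine Finset.sum_congr rfl fun x _ => ?_
  rw [Pw, Finset.prod_mul_distrib]

lemma orth {p : ℝ} (hp0 : 0 < p) (hp1 : p < 1) (E E' : Finset α) :
    ∑ x : α → Bool, Pw p x * (mon p E x * mon p E' x) = if E = E' then 1 else 0 := by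
  set ch : Bool → ℝ := fun b => ((if b then (1 : ℝ) else 0) - p) / Real.sqrt (p * (1 - p)) with hch
  have hpp : 0 < p * (1 - p) := mul_pos hp0 (by linarith)
  have hs : Real.sqrt (p * (1 - p)) ≠ 0 := (Real.sqrt_pos.2 hpp).ne'
  have hs2 : Real.sqrt (p * (1 - p)) ^ 2 = p * (1 - p) := Real.sq_sqrt hpp.le
  have e1 : ∀ x : α → Bool, mon p E x * mon p E' x =
      ∏ i, ((fun i b => (if i ∈ E then ch b else 1) * (if i ∈ E' then ch b else 1)) i (x i)) := by
    intro x
    simp only []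
    rw [Finset.prod_mul_distrib, Finset.prod_ite_mem, Finset.prod_ite_mem, Finset.univ_inter, Finset.univ_inter]
    rfl
  refine ((Finset.sum_congr rfl fun x _ => by rw [e1 x]).trans (sum_Pw p (fun i b => (if i ∈ E then ch b else 1) * (if i ∈ E' then ch b else 1)))).trans ?_
  have m1 : p * ch true + (1 - p) * ch false = 0 := by
    simp only [hch]; field_simp; simp; ring
  have m2 : p * (ch true * ch true) + (1 - p) * (ch false * ch false) = 1 := by
    simp only [hch]
    field_simp
    rw [hs2]; simp; ring
  split_ifs with hE
  · subst hE
    refine Finset.prod_eq_one fun i _ => ?_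
    by_cases hi : i ∈ E
    · simpa [hi] using m2
    · simp [hi]
  · have : ∃ i, ¬ (i ∈ E ↔ i ∈ E') := by
      by_contra hh; push Not at hh
      exact hE (Finset.ext hh)
    obtain ⟨i, hi⟩ := this
    refine Finset.prod_eq_zero (Finset.mem_univ i) ?_
    by_cases h1 : i ∈ E <;> by_cases h2 : i ∈ E'
    · simp [h1, h2] at hi
    · simpa [h1, h2] using m1
    · simpa [h1, h2] using m1
    · simp [h1, h2] at hi

lemma var_PF {p : ℝ} (hp0 : 0 < p) (hp1 : p < 1) (w : Finset α → ℝ) (hw : w ∅ = 0) :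
    ∫ x, (PF p w x - ∫ y, PF p w y ∂(bernoulliPi α p)) ^ 2 ∂(bernoulliPi α p) = ∑ E, w E ^ 2 := by
  have hm : ∫ y, PF p w y ∂(bernoulliPi α p) = 0 := by
    rw [int_bern hp0.le hp1.le]
    unfold PF
    simp_rw [Finset.mul_sum]
    rw [Finset.sum_comm]
    refine Finset.sum_eq_zero fun E _ => ?_
    have := orth hp0 hp1 E ∅
    have e : ∀ x : α → Bool, Pw p x * (w E * mon p E x) = w E * (Pw p x * (mon p E x * mon p ∅ x)) := by
      intro x; simp [mon]; ring
    simp_rw [e]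
    rw [← Finset.mul_sum, this]
    split_ifs with h
    · rw [h, hw]; ring
    · ring
  rw [hm, int_bern hp0.le hp1.le]
  simp_rw [sub_zero]
  have e : ∀ x : α → Bool, Pw p x * PF p w x ^ 2 = ∑ E, ∑ E', w E * w E' * (Pw p x * (mon p E x * mon p E' x)) := by
    intro x
    unfold PF
    rw [sq, Finset.sum_mul_sum, Finset.mul_sum]
    refine Finset.sum_congr rfl fun E _ => ?_
    rw [Finset.mul_sum]
    refine Finset.sum_congr rfl fun E' _ => ?_
    ring
  simp_rw [e]
  rw [Finset.sum_comm]
  refine Finset.sum_congr rfl fun E _ => ?_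
  rw [Finset.sum_comm]
  simp_rw [← Finset.mul_sum, orth hp0 hp1]
  simp [sq]

end Bern

section Gnm
variable {n : ℕ}

lemma int_gnm (m : ℕ) (g : (Sym2 (Fin n) → Bool) → ℂ) :
    ∫ x, g x ∂(gnm n m) = Ex (Om n m) g := by
  classical
  unfold gnm finUniform
  set S : Set (Sym2 (Fin n) → Bool) := {x | (∀ e : Sym2 (Fin n), e.IsDiag → x e = false) ∧
    (Finset.univ.filter fun e : Sym2 (Fin n) => x e = true).card = m} with hS
  have hmem : ∀ x, x ∈ Om n m ↔ x ∈ S := by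
    intro x; simp [Om, hS]
  have hSc : (S : Set _) = (Om n m : Set _) := by ext x; simp [hmem]
  rw [integral_smul_measure, integral_finsetSum_measure]
  · unfold Ex
    have h1 : Nat.card S = (Om n m).card := by
      rw [hSc]; simp
    rw [h1]
    congr 1
    · simp
    · have : ∀ a, ∫ x, g x ∂(S.indicator (fun _ => (1 : ℝ≥0∞)) a • Measure.dirac a) = if a ∈ Om n m then g a else 0 := by
        intro a
        rw [integral_smul_measure, integral_dirac]
        by_cases ha : a ∈ S
        · simp [ha, (hmem a).2 ha]
        · simp [ha, mt (hmem a).1 ha]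
      simp_rw [this]
      simp
  · intro a _
    refine Integrable.smul_measure (integrable_dirac (by simp)) ?_
    by_cases ha : a ∈ S <;> simp [ha]

end Gnm

section Count
variable {n : ℕ}

lemma cnt_GP (hn : 3 ≤ n) : ∑ E : Finset (Sym2 (Fin n)), ind GP E = n * ((n : ℝ) - 1) * (n - 2) / 2 := by
  have := ind_sum cov_GP (fun _ : Finset (Sym2 (Fin n)) => (1 : ℝ))
  rw [aut_GP] at this
  simp only [mul_one, Finset.sum_const, Finset.card_univ, Fintype.card_embedding_eq, Fintype.card_fin, nsmul_eq_mul] at this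
  have d : ((n.descFactorial 3 : ℕ) : ℝ) = n * ((n : ℝ) - 1) * (n - 2) := by
    simp only [Nat.descFactorial]
    push_cast [Nat.cast_sub (show 2 ≤ n by omega), Nat.cast_sub (show 1 ≤ n by omega)]
    simp; ring
  rw [d] at this
  push_cast at this
  linarith

lemma cnt_GK (hn : 3 ≤ n) : ∑ E : Finset (Sym2 (Fin n)), ind GK E = n * ((n : ℝ) - 1) * (n - 2) / 6 := by
  have := ind_sum cov_GK (fun _ : Finset (Sym2 (Fin n)) => (1 : ℝ))
  rw [aut_GK] at this
  simp only [mul_one, Finset.sum_const, Finset.card_univ, Fintype.card_embedding_eq, Fintype.card_fin, nsmul_eq_mul] at this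
  have d : ((n.descFactorial 3 : ℕ) : ℝ) = n * ((n : ℝ) - 1) * (n - 2) := by
    simp only [Nat.descFactorial]
    push_cast [Nat.cast_sub (show 2 ≤ n by omega), Nat.cast_sub (show 1 ≤ n by omega)]
    simp; ring
  rw [d] at this
  push_cast at this
  linarith

lemma wt_sq (hn : 3 ≤ n) (a b : ℝ) : ∑ E : Finset (Sym2 (Fin n)), wt a b E ^ 2 =
    a ^ 2 * (n * ((n : ℝ) - 1) * (n - 2)) / 2 + b ^ 2 * (n * ((n : ℝ) - 1) * (n - 2)) / 6 := by
  have e : ∀ E : Finset (Sym2 (Fin n)), wt a b E ^ 2 = a ^ 2 * ind GP E + b ^ 2 * ind GK E := by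
    intro E
    have h0 : ind GP E * ind GK E = 0 := by
      by_contra hh
      have h1 := ind_card (left_ne_zero_of_mul hh)
      have h2 := ind_card (right_ne_zero_of_mul hh)
      rw [h1] at h2
      revert h2; decide
    unfold wt
    linear_combination a ^ 2 * ind_sq GP E + b ^ 2 * ind_sq GK E + 2 * a * b * h0
  simp_rw [e]
  rw [Finset.sum_add_distrib, ← Finset.mul_sum, ← Finset.mul_sum, cnt_GP hn, cnt_GK hn]; ring

lemma wt_empty (a b : ℝ) : wt a b (∅ : Finset (Sym2 (Fin n))) = 0 := by
  have h1 : ind GP (∅ : Finset (Sym2 (Fin n))) = 0 := by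
    by_contra hh; have := ind_card hh
    have h3 : GP.card = 2 := by decide
    rw [Finset.card_empty, h3] at this; omega
  have h2 : ind GK (∅ : Finset (Sym2 (Fin n))) = 0 := by
    by_contra hh; have := ind_card hh
    have h3 : GK.card = 3 := by decide
    rw [Finset.card_empty, h3] at this; omega
  simp [wt, h1, h2]

end Count
end GS

end


set_option linter.unusedSectionVars false
noncomputable section
namespace GS

open Classical in
def al {ℓ : ℕ} (ℋ : Finset (SimpleGraph (Fin ℓ))) (Δ : SimpleGraph (Fin ℓ) → ℝ) : ℝ :=
  ∑ H ∈ (ℋ.filter fun G => Nat.card G.support = 3).filter (fun H => Rep H GP), Δ H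
open Classical in
def be {ℓ : ℕ} (ℋ : Finset (SimpleGraph (Fin ℓ))) (Δ : SimpleGraph (Fin ℓ) → ℝ) : ℝ :=
  ∑ H ∈ (ℋ.filter fun G => Nat.card G.support = 3).filter (fun H => ¬ Rep H GP), Δ H
def tl {ℓ : ℕ} (ℋ : Finset (SimpleGraph (Fin ℓ))) (Δ : SimpleGraph (Fin ℓ) → ℝ)
    (p : ℝ) {n : ℕ} (x : Sym2 (Fin n) → Bool) : ℝ :=
  ∑ G ∈ ℋ.filter fun G => 4 ≤ Nat.card G.support,
    (n : ℝ) ^ (ℓ - Nat.card G.support) * Δ G * graphFactor G p x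

variable {ℓ n : ℕ} {ℋ ℋ' : Finset (SimpleGraph (Fin ℓ))} {Δ : SimpleGraph (Fin ℓ) → ℝ} {lam : ℝ}

lemma part3 (hn : ℓ ≤ n) (p : ℝ) (x : Sym2 (Fin n) → Bool) :
    graphStatPart ℓ ℋ Δ p 3 x =
      PF p (wt ((n : ℝ) ^ (ℓ - 3) * al ℋ Δ) ((n : ℝ) ^ (ℓ - 3) * be ℋ Δ)) x := by
  classical
  have hl := PF_lin p ((n : ℝ) ^ (ℓ - 3) * al ℋ Δ) ((n : ℝ) ^ (ℓ - 3) * be ℋ Δ) (ind GP) (ind GK) x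
  have : PF p (wt ((n : ℝ) ^ (ℓ - 3) * al ℋ Δ) ((n : ℝ) ^ (ℓ - 3) * be ℋ Δ)) x = _ := hl
  rw [this]
  unfold graphStatPart al be
  rw [← Finset.sum_filter_add_sum_filter_not (ℋ.filter fun G => Nat.card G.support = 3) (fun H => Rep H GP)]
  rw [Finset.mul_sum, Finset.mul_sum, Finset.sum_mul, Finset.sum_mul]
  congr 1
  · refine Finset.sum_congr rfl fun H hH => ?_
    simp only [Finset.mem_filter] at hH
    rw [rep_gf hH.2 hn, hH.1.2]
  · refine Finset.sum_congr rfl fun H hH => ?_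
    simp only [Finset.mem_filter] at hH
    rw [rep_gf ((rep3 hH.1.2).resolve_left hH.2) hn, hH.1.2]

lemma ab_low (hℓ : 3 ≤ ℓ) (h : IsFactorSystem ℓ lam ℋ ℋ' Δ) : lam ≤ |al ℋ Δ| ∨ lam ≤ |be ℋ Δ| := by
  classical
  obtain ⟨hs, hi, hk, -, hd⟩ := h
  obtain ⟨G, hG, -, hG3⟩ := hk 3 le_rfl hℓ
  by_cases hr : Rep G GP
  · left
    have : (ℋ.filter fun G => Nat.card G.support = 3).filter (fun H => Rep H GP) = {G} := by
      ext H
      simp only [Finset.mem_filter, Finset.mem_singleton]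
      constructor
      · rintro ⟨⟨h1, h2⟩, h3⟩
        exact hi H h1 G (hs hG) (rep_iso h3 hr)
      · rintro rfl; exact ⟨⟨hs hG, hG3⟩, hr⟩
    have e : al ℋ Δ = Δ G := by
      unfold al
      rw [← Finset.sum_singleton Δ G, ← this]
    rw [e]; exact hd G hG
  · right
    have : (ℋ.filter fun G => Nat.card G.support = 3).filter (fun H => ¬ Rep H GP) = {G} := by
      ext H
      simp only [Finset.mem_filter, Finset.mem_singleton]
      constructor
      · rintro ⟨⟨h1, h2⟩, h3⟩
        exact hi H h1 G (hs hG) (rep_iso ((rep3 h2).resolve_left h3) ((rep3 hG3).resolve_left hr))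
      · rintro rfl; exact ⟨⟨hs hG, hG3⟩, hr⟩
    have e : be ℋ Δ = Δ G := by
      unfold be
      rw [← Finset.sum_singleton Δ G, ← this]
    rw [e]; exact hd G hG

lemma decomp (p : ℝ) (x : Sym2 (Fin n) → Bool) :
    graphStat ℓ ℋ Δ p x - graphStatPart ℓ ℋ Δ p 0 x - graphStatPart ℓ ℋ Δ p 2 x =
      graphStatPart ℓ ℋ Δ p 3 x + tl ℋ Δ p x := by
  unfold graphStat graphStatPart tl
  simp only [Finset.sum_filter]
  rw [sub_sub, sub_eq_iff_eq_add, ← Finset.sum_add_distrib, ← Finset.sum_add_distrib, ← Finset.sum_add_distrib]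
  refine Finset.sum_congr rfl fun G _ => ?_
  have := card_ne_one (H := G)
  by_cases h0 : Nat.card G.support = 0
  · simp [h0]
  by_cases h2 : Nat.card G.support = 2
  · simp [h2]
  by_cases h3 : Nat.card G.support = 3
  · simp [h3]
  have h4 : 4 ≤ Nat.card G.support := by omega
  simp only [h0, h2, h3, h4, if_true, if_false]
  ring

lemma card_le (H : SimpleGraph (Fin ℓ)) : Nat.card H.support ≤ ℓ := by
  have := Nat.card_le_card_of_injective (Subtype.val : H.support → Fin ℓ) Subtype.val_injective
  simpa using this

def TT (ℓ : ℕ) (B : ℝ) : ℝ := 1 + ∑ k ∈ Finset.range (ℓ + 1), ∑ Γ : Finset (Sym2 (Fin k)), coreC B Γ.card k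

lemma TT_one {B : ℝ} (hB : 1 ≤ B) : 1 ≤ TT ℓ B := by
  unfold TT
  have : 0 ≤ ∑ k ∈ Finset.range (ℓ + 1), ∑ Γ : Finset (Sym2 (Fin k)), coreC B Γ.card k :=
    Finset.sum_nonneg fun k _ => Finset.sum_nonneg fun Γ _ => coreC_nonneg hB _ _
  linarith

lemma TT_ge {B : ℝ} (hB : 1 ≤ B) {k : ℕ} (hk : k ≤ ℓ) (Γ : Finset (Sym2 (Fin k))) : coreC B Γ.card k ≤ TT ℓ B := by
  unfold TT
  have h1 : coreC B Γ.card k ≤ ∑ Γ : Finset (Sym2 (Fin k)), coreC B Γ.card k :=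
    Finset.single_le_sum (f := fun Γ : Finset (Sym2 (Fin k)) => coreC B Γ.card k)
      (fun Γ _ => coreC_nonneg hB _ _) (Finset.mem_univ Γ)
  have h2 : ∑ Γ : Finset (Sym2 (Fin k)), coreC B Γ.card k ≤
      ∑ k ∈ Finset.range (ℓ + 1), ∑ Γ : Finset (Sym2 (Fin k)), coreC B Γ.card k :=
    Finset.single_le_sum (f := fun k => ∑ Γ : Finset (Sym2 (Fin k)), coreC B Γ.card k)
      (fun k _ => Finset.sum_nonneg fun Γ _ => coreC_nonneg hB _ _) (Finset.mem_range.2 (by omega))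
  linarith

def NN (ℓ : ℕ) : ℝ := Nat.card (SimpleGraph (Fin ℓ))

lemma tail_bd {Ω : Finset (Sym2 (Fin n) → Bool)} {p B c : ℝ} (hn2 : 3 ≤ n) (hn : ℓ ≤ n)
    (h : Good (Ed n) Ω p B c) (hl : 0 < lam) (hd : ∀ G ∈ ℋ, |Δ G| ≤ 1 / lam) :
    Ex Ω (fun x => |tl ℋ Δ p x|) ≤ NN ℓ * (1 / lam * TT ℓ B) * Real.sqrt n ^ (2 * ℓ - 4) := by
  classical
  set s := Real.sqrt n with hs
  have hss : s ^ 2 = n := Real.sq_sqrt (by positivity)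
  have hs1 : 1 ≤ s := by
    rw [hs, Real.one_le_sqrt]; exact_mod_cast (by omega : 1 ≤ n)
  have hs0 : 0 ≤ s := by linarith
  have hT := TT_one (ℓ := ℓ) h.hB
  have hterm : ∀ G ∈ ℋ.filter fun G => 4 ≤ Nat.card G.support,
      Ex Ω (fun x => |(n : ℝ) ^ (ℓ - Nat.card G.support) * Δ G * graphFactor G p x|) ≤
        1 / lam * TT ℓ B * s ^ (2 * ℓ - 4) := by
    intro G hG
    simp only [Finset.mem_filter] at hG
    have hkl : Nat.card G.support ≤ ℓ := card_le G
    obtain ⟨k, hk⟩ : ∃ k, Nat.card G.support = k := ⟨_, rfl⟩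
    obtain ⟨Γ, hΓ⟩ := gf_sq (by omega) hn h hk
    rw [hk] at hG hkl ⊢
    have h1 : Ex Ω (fun x => |graphFactor G p x|) ≤ TT ℓ B * s ^ k := by
      apply Ex_abs_le Ω h.ne (by positivity)
      refine hΓ.trans ?_
      have : (TT ℓ B * s ^ k) ^ 2 = TT ℓ B ^ 2 * (n : ℝ) ^ k := by
        rw [← hss]; ring
      rw [this]
      have h2 := TT_ge h.hB hkl Γ
      have : TT ℓ B ≤ TT ℓ B ^ 2 := by nlinarith
      gcongr
      linarith
    have e : Ex Ω (fun x => |(n : ℝ) ^ (ℓ - k) * Δ G * graphFactor G p x|) =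
        ((n : ℝ) ^ (ℓ - k) * |Δ G|) * Ex Ω (fun x => |graphFactor G p x|) := by
      rw [← Ex_mul]
      refine Ex_congr Ω fun x _ => ?_
      rw [abs_mul, abs_mul, abs_of_nonneg (by positivity : (0 : ℝ) ≤ (n : ℝ) ^ (ℓ - k))]
    rw [e]
    calc ((n : ℝ) ^ (ℓ - k) * |Δ G|) * Ex Ω (fun x => |graphFactor G p x|)
        ≤ ((n : ℝ) ^ (ℓ - k) * (1 / lam)) * (TT ℓ B * s ^ k) := by
          have := hd G hG.1
          gcongr
          exact Ex_nonneg Ω fun x _ => abs_nonneg _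
      _ = 1 / lam * TT ℓ B * s ^ (2 * (ℓ - k) + k) := by rw [← hss]; ring
      _ ≤ _ := by
          have : 2 * (ℓ - k) + k ≤ 2 * ℓ - 4 := by omega
          gcongr
  calc Ex Ω (fun x => |tl ℋ Δ p x|) ≤ Ex Ω (fun x => ∑ G ∈ ℋ.filter fun G => 4 ≤ Nat.card G.support,
      |(n : ℝ) ^ (ℓ - Nat.card G.support) * Δ G * graphFactor G p x|) :=
        Ex_mono Ω fun x _ => Finset.abs_sum_le_sum_abs _ _
    _ = ∑ G ∈ ℋ.filter fun G => 4 ≤ Nat.card G.support, Ex Ω (fun x =>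
      |(n : ℝ) ^ (ℓ - Nat.card G.support) * Δ G * graphFactor G p x|) := Ex_sum Ω _ _
    _ ≤ ∑ G ∈ ℋ.filter fun G => 4 ≤ Nat.card G.support, 1 / lam * TT ℓ B * s ^ (2 * ℓ - 4) :=
        Finset.sum_le_sum hterm
    _ = ((ℋ.filter fun G => 4 ≤ Nat.card G.support).card : ℝ) * (1 / lam * TT ℓ B) * s ^ (2 * ℓ - 4) := by
        rw [Finset.sum_const, nsmul_eq_mul]; ring
    _ ≤ _ := by
        have : ((ℋ.filter fun G => 4 ≤ Nat.card G.support).card : ℝ) ≤ NN ℓ := by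
          unfold NN
          rw [Nat.card_eq_fintype_card]
          exact_mod_cast Finset.card_le_univ _
        gcongr

lemma sig_low (hℓ : 3 ≤ ℓ) (hn : 3 ≤ n) (hl : 0 < lam) {α β : ℝ} (hab : lam ≤ |α| ∨ lam ≤ |β|) :
    (lam / 6 * Real.sqrt n ^ (2 * ℓ - 3)) ^ 2 ≤
     ((n : ℝ) ^ (ℓ - 3) * α) ^ 2 * (n * ((n : ℝ) - 1) * (n - 2)) / 2 +
      ((n : ℝ) ^ (ℓ - 3) * β) ^ 2 * (n * ((n : ℝ) - 1) * (n - 2)) / 6 := by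
  set s := Real.sqrt n with hs
  have hss : s ^ 2 = n := Real.sq_sqrt (by positivity)
  obtain ⟨j, rfl⟩ := Nat.exists_eq_add_of_le hℓ
  have e : (lam / 6 * s ^ (2 * (3 + j) - 3)) ^ 2 = lam ^ 2 / 36 * ((n : ℝ) ^ j) ^ 2 * n ^ 3 := by
    rw [← hss, show 2 * (3 + j) - 3 = 2 * j + 3 by omega]; ring
  rw [e, show 3 + j - 3 = j by omega]
  have hn' : (3 : ℝ) ≤ n := by exact_mod_cast hn
  set N : ℝ := (n : ℝ)
  set τ := N * (N - 1) * (N - 2) with hτ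
  have hτ1 : N ^ 3 / 6 ≤ τ := by
    have : N ^ 2 / 6 ≤ (N - 1) * (N - 2) := by nlinarith
    rw [hτ]; nlinarith
  have hτ0 : 0 ≤ τ := le_trans (by positivity) hτ1
  have hab2 : lam ^ 2 ≤ α ^ 2 + β ^ 2 := by
    rcases hab with h | h
    · have := pow_le_pow_left₀ hl.le h 2
      rw [sq_abs] at this; nlinarith [sq_nonneg β]
    · have := pow_le_pow_left₀ hl.le h 2
      rw [sq_abs] at this; nlinarith [sq_nonneg α]
  have h1 : lam ^ 2 / 36 * N ^ 3 ≤ (α ^ 2 / 6 + β ^ 2 / 6) * τ := by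
    calc lam ^ 2 / 36 * N ^ 3 = lam ^ 2 / 6 * (N ^ 3 / 6) := by ring
      _ ≤ (α ^ 2 / 6 + β ^ 2 / 6) * τ := by
        gcongr; linarith
  have h2 : (α ^ 2 / 6 + β ^ 2 / 6) * τ ≤ (α ^ 2 / 2 + β ^ 2 / 6) * τ := by
    gcongr; nlinarith [sq_nonneg α]
  have h3 : (0 : ℝ) ≤ (N ^ j) ^ 2 := by positivity
  nlinarith [mul_le_mul_of_nonneg_left (h1.trans h2) h3]

end GS

end


set_option linter.unusedSectionVars false
noncomputable section
namespace GS

lemma exp_small (t : ℝ) : ‖(1 : ℂ) - (Real.exp (-(t ^ 2) / 2) : ℝ)‖ ≤ |t| := by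
  have e : (1 : ℂ) - (Real.exp (-(t ^ 2) / 2) : ℝ) = ((1 - Real.exp (-(t ^ 2) / 2) : ℝ) : ℂ) := by push_cast; ring
  rw [e, Complex.norm_real, Real.norm_eq_abs]
  have h1 : Real.exp (-(t ^ 2) / 2) ≤ 1 := Real.exp_le_one_iff.2 (by nlinarith [sq_nonneg t])
  have h2 := Real.add_one_le_exp (-(t ^ 2) / 2)
  have h3 := Real.exp_pos (-(t ^ 2) / 2)
  rw [abs_of_nonneg (by linarith)]
  by_cases h : |t| ≤ 1
  · nlinarith [sq_abs t, abs_nonneg t]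
  · linarith

lemma main_big {ℓ n : ℕ} (hℓ : 3 ≤ ℓ) (hn : 3 ≤ n) (hln : ℓ ≤ n) {lam : ℝ} (hl : 0 < lam)
    {ℋ ℋ' : Finset (SimpleGraph (Fin ℓ))} {Δ : SimpleGraph (Fin ℓ) → ℝ} (hsys : IsFactorSystem ℓ lam ℋ ℋ' Δ)
    {Ω : Finset (Sym2 (Fin n) → Bool)} {p B c : ℝ} (h : Good (Ed n) Ω p B c) (hp0 : 0 < p) (hp1 : p < 1) (t : ℝ) :
    ‖Ex Ω (fun x => cis t ((graphStat ℓ ℋ Δ p x - graphStatPart ℓ ℋ Δ p 0 x - graphStatPart ℓ ℋ Δ p 2 x) /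
      Real.sqrt (∫ x, (graphStatPart ℓ ℋ Δ p 3 x -
          ∫ y, graphStatPart ℓ ℋ Δ p 3 y ∂(gnp n p)) ^ 2 ∂(gnp n p)))) - (Real.exp (-(t^2)/2) : ℝ)‖ ≤
      (C3 B + 6 / lam * (NN ℓ * (1 / lam * TT ℓ B))) * |t| * (1 / Real.sqrt n) := by
  set a' := (n : ℝ) ^ (ℓ - 3) * al ℋ Δ with ha'
  set b' := (n : ℝ) ^ (ℓ - 3) * be ℋ Δ with hb'
  have hp3 : ∀ x : Sym2 (Fin n) → Bool, graphStatPart ℓ ℋ Δ p 3 x = PF p (wt a' b') x := fun x => part3 hln p x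
  simp_rw [decomp, hp3]
  unfold gnp
  rw [var_PF hp0 hp1 _ (wt_empty a' b'), wt_sq hn]
  set V := a' ^ 2 * (n * ((n : ℝ) - 1) * (n - 2)) / 2 + b' ^ 2 * (n * ((n : ℝ) - 1) * (n - 2)) / 6 with hV
  set s := Real.sqrt n with hs
  have hs0 : 0 < s := Real.sqrt_pos.2 (by exact_mod_cast (by omega : 0 < n))
  have hVl : (lam / 6 * s ^ (2 * ℓ - 3)) ^ 2 ≤ V := sig_low hℓ hn hl (ab_low hℓ hsys)
  have hσl : lam / 6 * s ^ (2 * ℓ - 3) ≤ Real.sqrt V := Real.le_sqrt_of_sq_le hVl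
  have hl0 : 0 < lam / 6 * s ^ (2 * ℓ - 3) := by positivity
  have hV0 : 0 < V := lt_of_lt_of_le (by positivity) hVl
  have hσ2 : Real.sqrt V ^ 2 = V := Real.sq_sqrt hV0.le
  set σ := Real.sqrt V with hσ
  have hσ0 : 0 < σ := lt_of_lt_of_le hl0 hσl
  have hm := main3 (Ω := Ω) hn h (a := a' / σ) (b := b' / σ) (by
    have : (a' / σ) ^ 2 * (n * ((n : ℝ) - 1) * (n - 2)) / 2 + (b' / σ) ^ 2 * (n * ((n : ℝ) - 1) * (n - 2)) / 6 =
      V / σ ^ 2 := by rw [hV]; field_simp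
    rw [this, hσ2]; exact div_self hV0.ne') t
  have hF : ∀ x : Sym2 (Fin n) → Bool, (PF p (wt a' b') x + tl ℋ Δ p x) / σ =
      PF p (wt (a' / σ) (b' / σ)) x + tl ℋ Δ p x / σ := by
    intro x
    rw [PF_wt, PF_wt]; ring
  have htail := tail_bd (lam := lam) hn hln h hl hsys.2.2.2.1
  set T0 := NN ℓ * (1 / lam * TT ℓ B) with hT0
  have hT00 : 0 ≤ T0 := by
    have := TT_one (ℓ := ℓ) h.hB
    have : 0 ≤ NN ℓ := Nat.cast_nonneg _
    positivity
  have hd : ‖Ex Ω (fun x => cis t ((PF p (wt a' b') x + tl ℋ Δ p x) / σ)) -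
      Ex Ω (fun x => cis t (PF p (wt (a' / σ) (b' / σ)) x))‖ ≤ 6 / lam * T0 * |t| * (1 / s) := by
    rw [← Ex_sub]
    calc _ ≤ Ex Ω (fun x => ‖cis t ((PF p (wt a' b') x + tl ℋ Δ p x) / σ) -
          cis t (PF p (wt (a' / σ) (b' / σ)) x)‖) := norm_Ex_le Ω _
      _ ≤ Ex Ω (fun x => (|t| / σ) * |tl ℋ Δ p x|) := by
          refine Ex_mono Ω fun x _ => ?_
          refine (norm_cis_sub _ _ _).trans ?_
          rw [hF, add_sub_cancel_left, abs_div, abs_of_pos hσ0]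
          apply le_of_eq; ring
      _ = |t| / σ * Ex Ω (fun x => |tl ℋ Δ p x|) := Ex_mul Ω _ _
      _ ≤ |t| / (lam / 6 * s ^ (2 * ℓ - 3)) * (T0 * s ^ (2 * ℓ - 4)) := by
          gcongr
          exact Ex_nonneg Ω fun x _ => abs_nonneg _
      _ = _ := by
          rw [show 2 * ℓ - 3 = (2 * ℓ - 4) + 1 by omega, pow_succ]
          field_simp
  calc _ = ‖(Ex Ω (fun x => cis t ((PF p (wt a' b') x + tl ℋ Δ p x) / σ)) -
      Ex Ω (fun x => cis t (PF p (wt (a' / σ) (b' / σ)) x))) +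
      (Ex Ω (fun x => cis t (PF p (wt (a' / σ) (b' / σ)) x)) - (Real.exp (-(t^2)/2) : ℝ))‖ := by
        congr 1; ring
    _ ≤ _ := norm_add_le _ _
    _ ≤ 6 / lam * T0 * |t| * (1 / s) + C3 B * |t| * (1 / s) := add_le_add hd hm
    _ = _ := by ring

lemma main_small {ℓ n : ℕ} (hln : n < ℓ) {ℋ : Finset (SimpleGraph (Fin ℓ))} {Δ : SimpleGraph (Fin ℓ) → ℝ}
    {Ω : Finset (Sym2 (Fin n) → Bool)} (hΩ : Ω.Nonempty) (p σ t : ℝ) :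
    ‖Ex Ω (fun x => cis t ((graphStat ℓ ℋ Δ p x - graphStatPart ℓ ℋ Δ p 0 x - graphStatPart ℓ ℋ Δ p 2 x) / σ))
       - (Real.exp (-(t^2)/2) : ℝ)‖ ≤ |t| := by
  have e : ∀ x : Sym2 (Fin n) → Bool, cis t ((graphStat ℓ ℋ Δ p x - graphStatPart ℓ ℋ Δ p 0 x - graphStatPart ℓ ℋ Δ p 2 x) / σ) = 1 := by
    intro x
    simp [graphStat, graphStatPart, gf_zero hln, cis]
  simp_rw [e]
  rw [Ex_const Ω hΩ]
  exact exp_small t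

end GS

end


theorem graph_stat_char_fun_low_range
    (ℓ : ℕ) (hℓ : 3 ≤ ℓ) (lam : ℝ) (hlam : lam ∈ Set.Ioo (0 : ℝ) (1 / 2))
    (ε : ℝ) (hε : 0 < ε) :
    ∃ C : ℝ, 0 < C ∧ ∀ n : ℕ, 3 ≤ n → ∀ m : ℕ,
      (m : ℝ) / (n.choose 2) ∈ Set.Ioo lam (1 - lam) →
      ∀ ℋ ℋ' : Finset (SimpleGraph (Fin ℓ)), ∀ Δ : SimpleGraph (Fin ℓ) → ℝ,
        IsFactorSystem ℓ lam ℋ ℋ' Δ →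
        let p : ℝ := (m : ℝ) / (n.choose 2)
        let σ := Real.sqrt (∫ x, (graphStatPart ℓ ℋ Δ p 3 x -
          ∫ y, graphStatPart ℓ ℋ Δ p 3 y ∂(gnp n p)) ^ 2 ∂(gnp n p))
        let K : (Sym2 (Fin n) → Bool) → ℝ := fun x =>
          (graphStat ℓ ℋ Δ p x - graphStatPart ℓ ℋ Δ p 0 x - graphStatPart ℓ ℋ Δ p 2 x) / σ
        ∀ t : ℝ,
          ‖(∫ x, Complex.exp (Complex.I * Complex.ofReal (t * K x)) ∂(gnm n m)) -
              Complex.ofReal (Real.exp (-(t ^ 2) / 2))‖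
            ≤ C * |t| * (n : ℝ) ^ (ε - 1 / 2) := by
  have hl := hlam.1
  have hB : (1 : ℝ) ≤ 1 / lam := by
    rw [le_div_iff₀ hl]; linarith [hlam.2]
  set D := GS.C3 (1 / lam) + 6 / lam * (GS.NN ℓ * (1 / lam * GS.TT ℓ (1 / lam))) with hD
  have hD0 : 0 ≤ D := by
    have h1 := GS.TT_one (ℓ := ℓ) hB
    have h2 : 0 ≤ GS.NN ℓ := Nat.cast_nonneg _
    have h3 := GS.C3_nonneg hB
    positivity
  refine ⟨D + ℓ + 1, by positivity, ?_⟩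
  intro n hn m hp ℋ ℋ' Δ hsys p σ K t
  have hG := GS.good_gnm hn hlam hp
  have hn1 : (1 : ℝ) ≤ n := by exact_mod_cast (by omega : 1 ≤ n)
  have hn0 : (0 : ℝ) < n := by linarith
  have hs0 : 0 < Real.sqrt n := Real.sqrt_pos.2 hn0
  have hr : 1 / Real.sqrt n ≤ (n : ℝ) ^ (ε - 1 / 2) := by
    have : 1 / Real.sqrt n = (n : ℝ) ^ (-(1 / 2) : ℝ) := by
      rw [Real.rpow_neg hn0.le, Real.sqrt_eq_rpow, one_div]
    rw [this]
    exact Real.rpow_le_rpow_of_exponent_le hn1 (by linarith)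
  have hint : (∫ x, Complex.exp (Complex.I * Complex.ofReal (t * K x)) ∂(gnm n m)) =
      GS.Ex (GS.Om n m) (fun x => GS.cis t (K x)) := GS.int_gnm m _
  rw [hint]
  have hkey : ‖GS.Ex (GS.Om n m) (fun x => GS.cis t (K x)) - Complex.ofReal (Real.exp (-(t ^ 2) / 2))‖ ≤
      (D + ℓ + 1) * |t| * (1 / Real.sqrt n) := by
    by_cases hln : ℓ ≤ n
    · refine (GS.main_big hℓ hn hln hl hsys hG (hl.trans hp.1) (by linarith [hp.2]) t).trans ?_
      rw [← hD]
      gcongr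
      have : (0 : ℝ) ≤ ℓ := Nat.cast_nonneg _
      linarith
    · push Not at hln
      refine (GS.main_small hln hG.ne p σ t).trans ?_
      have hsl : Real.sqrt n ≤ ℓ := by
        have h1 : Real.sqrt n ≤ n := by
          rw [Real.sqrt_le_left (by positivity)]; nlinarith
        have h2 : (n : ℝ) ≤ ℓ := by exact_mod_cast hln.le
        linarith
      have : 1 ≤ (D + ℓ + 1) * (1 / Real.sqrt n) := by
        rw [mul_one_div, le_div_iff₀ hs0]; linarith
      nlinarith [abs_nonneg t]
  refine hkey.trans ?_
  gcongr
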